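/- arXiv:1512.07289 — 3 statements merged into one kernel-verified Lean document; each statement's English description precedes it below -/
import Mathlib

section
/- There exists an absolute constant c > 0 such that for every n ≥ 2, if K and L are origin-symmetric convex bodies in R^n with S_K(t) ≤ S_L(t) for all t ≥ 0, then |K| ≤ c · L_K · |L|, where L_K denotes the isotropic constant of K. -/
open MeasureTheory Metric Set
open scoped RealInnerProductSpace ENNReal NNReal

noncomputable section

/-- Euclidean space `ℝ^n`. -/
abbrev Euc (n : ℕ) := EuclideanSpace ℝ (Fin n)

/-- A convex body: a compact convex set with nonempty interior. -/
def IsConvexBody {n : ℕ} (K : Set (Euc n)) : Prop :=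
  Convex ℝ K ∧ IsCompact K ∧ (interior K).Nonempty

/-- The Haar (rotation invariant) probability measure of a set of directions on the
unit sphere `S^{n-1}`, realized as normalized `(n-1)`-dimensional Hausdorff measure. -/
def sphHaar (n : ℕ) (A : Set (Euc n)) : ℝ≥0∞ :=
  μH[(n : ℝ) - 1] (A ∩ sphere (0 : Euc n) 1) / μH[(n : ℝ) - 1] (sphere (0 : Euc n) 1)

/-- `|K ∩ θ^⊥|`: the `(n-1)`-dimensional Hausdorff measure of the central section of `K`
perpendicular to `θ`. -/
def sectionVol (n : ℕ) (K : Set (Euc n)) (θ : Euc n) : ℝ≥0∞ :=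
  μH[(n : ℝ) - 1] (K ∩ {x : Euc n | ⟪x, θ⟫ = 0})

/-- `S_K(t)`: distribution function of the areas of central hyperplane sections. -/
def Sdist (n : ℕ) (K : Set (Euc n)) (t : ℝ) : ℝ≥0∞ :=
  sphHaar n {θ : Euc n | ENNReal.ofReal t ≤ sectionVol n K θ}

/-- `|K | θ^⊥|`: the `(n-1)`-dimensional Hausdorff measure of the orthogonal projection
of `K` onto the hyperplane `θ^⊥` (for a unit vector `θ`). -/
def projVol (n : ℕ) (K : Set (Euc n)) (θ : Euc n) : ℝ≥0∞ :=
  μH[(n : ℝ) - 1] ((fun x => x - ⟪x, θ⟫ • θ) '' K)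

/-- `Π_K(t)`: distribution function of the volumes of hyperplane projections. -/
def PiDist (n : ℕ) (K : Set (Euc n)) (t : ℝ) : ℝ≥0∞ :=
  sphHaar n {θ : Euc n | ENNReal.ofReal t ≤ projVol n K θ}

/-- The radial function `ρ_K(θ) = max {a ≥ 0 : a • θ ∈ K}`. -/
def radial {n : ℕ} (K : Set (Euc n)) (θ : Euc n) : ℝ :=
  sSup {a : ℝ | 0 ≤ a ∧ a • θ ∈ K}

/-- The support function `h_K(θ) = sup_{y ∈ K} ⟨θ, y⟩`. -/
def suppFn {n : ℕ} (K : Set (Euc n)) (θ : Euc n) : ℝ :=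
  sSup ((fun y => ⟪θ, y⟫) '' K)

/-- The polar body `K° = {x : ⟨x, y⟩ ≤ 1 for all y ∈ K}`. -/
def polarBody {n : ℕ} (K : Set (Euc n)) : Set (Euc n) :=
  {x | ∀ y ∈ K, ⟪x, y⟫ ≤ 1}

/-- The isotropic constant of an origin-symmetric convex body `K ⊆ ℝⁿ`:
`L_K = inf over volume-preserving linear maps T of
((1/(n·|K|^{(n+2)/n})) ∫_{T(K)} |x|² dx)^{1/2}`. -/
def isoConst (n : ℕ) (K : Set (Euc n)) : ℝ :=
  sInf {r : ℝ | ∃ T : Euc n ≃ₗ[ℝ] Euc n,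
    |LinearMap.det (T : Euc n →ₗ[ℝ] Euc n)| = 1 ∧
    r = ((1 / ((n : ℝ) * (volume K).toReal ^ (((n : ℝ) + 2) / n))) *
      ∫ x in (T : Euc n → Euc n) '' K, ‖x‖ ^ 2) ^ ((1 : ℝ) / 2)}

/-- One-dimensional Brunn-Minkowski inequality for compact sets. -/
theorem volume_combo_le_of_isCompact {a b : ℝ} (ha : 0 ≤ a) (hb : 0 ≤ b) {X Y Z : Set ℝ}
    (hX : IsCompact X) (hY : IsCompact Y) (hX0 : X.Nonempty) (hY0 : Y.Nonempty)
    (h : ∀ x ∈ X, ∀ y ∈ Y, a * x + b * y ∈ Z) :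
    ENNReal.ofReal a * volume X + ENNReal.ofReal b * volume Y ≤ volume Z := by
  obtain ⟨x₁, hx₁, hx₁'⟩ := hX.exists_isGreatest hX0
  obtain ⟨y₀, hy₀, hy₀'⟩ := hY.exists_isLeast hY0
  have him : ∀ (c d : ℝ) (S : Set ℝ), 0 ≤ c →
      volume ((fun x => c * x + d) '' S) = ENNReal.ofReal c * volume S := by
    intro c d S hc
    have : (fun x => c * x + d) '' S = (fun x => x + d) '' ((fun x => c • x) '' S) := by
      rw [Set.image_image]; rfl
    rw [this, Set.image_add_right, measure_preimage_add_right, Set.image_smul,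
      Measure.addHaar_smul]
    simp [abs_of_nonneg hc]
  rw [← him a (b * y₀) X ha, ← him b (a * x₁) Y hb]
  have hYc : IsCompact ((fun y => b * y + a * x₁) '' Y) := hY.image (by fun_prop)
  rw [← measure_union₀ hYc.measurableSet.nullMeasurableSet]
  · apply measure_mono
    rintro _ (⟨x, hx, rfl⟩ | ⟨y, hy, rfl⟩)
    · exact h x hx y₀ hy₀
    · have := h x₁ hx₁ y hy
      rwa [add_comm] at this
  · have hsub : ((fun x => a * x + b * y₀) '' X) ∩ ((fun y => b * y + a * x₁) '' Y)
        ⊆ {a * x₁ + b * y₀} := by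
      rintro _ ⟨⟨x, hx, rfl⟩, ⟨y, hy, hxy⟩⟩
      have h1 := mul_le_mul_of_nonneg_left (hx₁' hx) ha
      have h2 := mul_le_mul_of_nonneg_left (hy₀' hy) hb
      simp only at hxy
      simp only [Set.mem_singleton_iff]
      linarith
    exact measure_mono_null hsub (by simp)

/-- One-dimensional Brunn-Minkowski inequality. -/
theorem volume_combo_le {a b : ℝ} (ha : 0 ≤ a) (hb : 0 ≤ b) {X Y Z : Set ℝ}
    (hX : MeasurableSet X) (hY : MeasurableSet Y) (hX0 : X.Nonempty) (hY0 : Y.Nonempty)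
    (h : ∀ x ∈ X, ∀ y ∈ Y, a * x + b * y ∈ Z) :
    ENNReal.ofReal a * volume X + ENNReal.ofReal b * volume Y ≤ volume Z := by
  have key : ∀ C, C ⊆ X → IsCompact C → ∀ D, D ⊆ Y → IsCompact D →
      ENNReal.ofReal a * volume C + ENNReal.ofReal b * volume D ≤ volume Z := by
    intro C hCX hC D hDY hD
    obtain ⟨x, hx⟩ := hX0
    obtain ⟨y, hy⟩ := hY0
    refine le_trans ?_ (volume_combo_le_of_isCompact ha hb (hC.insert x) (hD.insert y)
      (Set.insert_nonempty _ _) (Set.insert_nonempty _ _) (Z := Z) ?_)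
    · gcongr <;> exact Set.subset_insert _ _
    · intro x' hx' y' hy'
      exact h x' (Set.insert_subset hx hCX hx') y' (Set.insert_subset hy hDY hy')
  have hsup : ∀ (c : ℝ≥0∞) (S : Set ℝ), MeasurableSet S →
      c * volume S = ⨆ C, ⨆ _ : C ⊆ S ∧ IsCompact C, c * volume C := by
    intro c S hS
    rw [hS.measure_eq_iSup_isCompact]
    simp only [ENNReal.mul_iSup, iSup_and]
  rw [hsup _ X hX, hsup _ Y hY]
  exact ENNReal.biSup_add_biSup_le' ⟨∅, by simp⟩ ⟨∅, by simp⟩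
    fun C hC D hD => key C hC.1 hC.2 D hD.1 hD.2

/-- One-dimensional Prékopa-Leindler inequality for functions with supremum `1`. -/
theorem lintegral_combo_le_of_sup_one {a b : ℝ} (ha : 0 < a) (hb : 0 < b) (hab : a + b = 1)
    {f g h : ℝ → ℝ} (hf : Measurable f) (hg : Measurable g) (hh : Measurable h)
    (hf0 : ∀ x, 0 ≤ f x) (hg0 : ∀ x, 0 ≤ g x) (hh0 : ∀ x, 0 ≤ h x)
    (hf1 : ∀ x, f x ≤ 1) (hg1 : ∀ x, g x ≤ 1)
    (hfs : ∀ t < 1, ∃ x, t < f x) (hgs : ∀ t < 1, ∃ x, t < g x)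
    (H : ∀ x y, f x ^ a * g y ^ b ≤ h (a * x + b * y)) :
    ENNReal.ofReal a * (∫⁻ x, ENNReal.ofReal (f x)) +
      ENNReal.ofReal b * (∫⁻ x, ENNReal.ofReal (g x)) ≤ ∫⁻ x, ENNReal.ofReal (h x) := by
  rw [lintegral_eq_lintegral_meas_lt _ (ae_of_all _ hf0) hf.aemeasurable,
    lintegral_eq_lintegral_meas_lt _ (ae_of_all _ hg0) hg.aemeasurable,
    lintegral_eq_lintegral_meas_lt _ (ae_of_all _ hh0) hh.aemeasurable]
  have hm : ∀ k : ℝ → ℝ, Measurable fun t => volume {x | t < k x} := fun k =>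
    Antitone.measurable fun s t hst => measure_mono fun x hx => lt_of_le_of_lt hst hx
  rw [← lintegral_const_mul _ (hm f), ← lintegral_const_mul _ (hm g),
    ← lintegral_add_left ((hm f).const_mul _)]
  refine setLIntegral_mono (hm h) fun t ht => ?_
  rcases lt_or_ge t 1 with h1 | h1
  · refine volume_combo_le ha.le hb.le (measurableSet_lt measurable_const hf)
      (measurableSet_lt measurable_const hg) (hfs t h1) (hgs t h1) fun x hx y hy => ?_
    refine lt_of_lt_of_le ?_ (H x y)
    have ht0 : (0 : ℝ) < t := ht
    calc t = t ^ a * t ^ b := by rw [← Real.rpow_add ht0, hab, Real.rpow_one]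
      _ < f x ^ a * g y ^ b := by
        have h2 := Real.rpow_lt_rpow ht0.le hx ha
        have h3 := Real.rpow_lt_rpow ht0.le hy hb
        gcongr
  · have e1 : {x | t < f x} = ∅ := by
      ext x; simpa using (hf1 x).trans h1
    have e2 : {x | t < g x} = ∅ := by
      ext x; simpa using (hg1 x).trans h1
    simp [e1, e2]

theorem ENNReal.geom_mean_le_arith_mean2 {a b : ℝ} (ha : 0 < a) (hb : 0 < b) (hab : a + b = 1)
    (x y : ℝ≥0∞) : x ^ a * y ^ b ≤ ENNReal.ofReal a * x + ENNReal.ofReal b * y := by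
  have hpq : (a⁻¹).HolderConjugate b⁻¹ :=
    ⟨by simp [hab], by positivity, by positivity⟩
  refine (ENNReal.young_inequality (x ^ a) (y ^ b) hpq).trans_eq ?_
  rw [← ENNReal.rpow_mul, ← ENNReal.rpow_mul, mul_inv_cancel₀ ha.ne', mul_inv_cancel₀ hb.ne',
    ENNReal.rpow_one, ENNReal.rpow_one, ENNReal.ofReal_inv_of_pos ha, ENNReal.ofReal_inv_of_pos hb,
    div_eq_mul_inv, div_eq_mul_inv, inv_inv, inv_inv, mul_comm x, mul_comm y]

/-- One-dimensional Prékopa-Leindler inequality for bounded functions. -/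
theorem prekopa_leindler_one_of_bounded {a b : ℝ} (ha : 0 < a) (hb : 0 < b) (hab : a + b = 1)
    {f g h : ℝ → ℝ≥0∞} (hf : Measurable f) (hg : Measurable g) (hh : Measurable h)
    {N : ℝ≥0∞} (hN : N ≠ ∞) (hfN : ∀ x, f x ≤ N) (hgN : ∀ x, g x ≤ N)
    (H : ∀ x y, f x ^ a * g y ^ b ≤ h (a * x + b * y)) :
    (∫⁻ x, f x) ^ a * (∫⁻ x, g x) ^ b ≤ ∫⁻ x, h x := by
  set A := ⨆ x, f x with hA
  set B := ⨆ x, g x with hB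
  have hAt : A ≠ ∞ := ((iSup_le hfN).trans_lt hN.lt_top).ne
  have hBt : B ≠ ∞ := ((iSup_le hgN).trans_lt hN.lt_top).ne
  rcases eq_or_ne A 0 with hA0 | hA0
  · have : ∀ x, f x = 0 := by simpa [hA] using hA0
    simp [this, ha]
  rcases eq_or_ne B 0 with hB0 | hB0
  · have : ∀ x, g x = 0 := by simpa [hB] using hB0
    simp [this, hb]
  have hfA : ∀ x, f x ≤ A := le_iSup f
  have hgB : ∀ x, g x ≤ B := le_iSup g
  set C := A ^ a * B ^ b with hC
  have hCt : C ≠ ∞ := ENNReal.mul_ne_top (ENNReal.rpow_ne_top_of_nonneg ha.le hAt)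
    (ENNReal.rpow_ne_top_of_nonneg hb.le hBt)
  have hC0 : C ≠ 0 := mul_ne_zero (by simp [ENNReal.rpow_eq_zero_iff, hA0, hAt])
    (by simp [ENNReal.rpow_eq_zero_iff, hB0, hBt])
  have hsup : ∀ (k : ℝ → ℝ≥0∞), (⨆ x, k x) ≠ 0 → (⨆ x, k x) ≠ ∞ → ∀ t : ℝ, t < 1 →
      ∃ x, t < (k x / ⨆ x, k x).toReal := by
    intro k h0 ht t h1
    rcases lt_or_ge t 0 with h2 | h2
    · exact ⟨0, h2.trans_le ENNReal.toReal_nonneg⟩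
    have : ENNReal.ofReal t * (⨆ x, k x) < ⨆ x, k x := by
      calc _ < 1 * (⨆ x, k x) := ENNReal.mul_lt_mul_left h0 ht (by simpa using h1)
        _ = _ := one_mul _
    obtain ⟨x, hx⟩ := lt_iSup_iff.1 this
    refine ⟨x, ?_⟩
    rw [← ENNReal.ofReal_lt_iff_lt_toReal h2
      (ENNReal.div_ne_top ((le_iSup k x).trans_lt ht.lt_top).ne h0)]
    rwa [ENNReal.lt_div_iff_mul_lt (Or.inl h0) (Or.inl ht)]
  have key := lintegral_combo_le_of_sup_one ha hb hab
    (f := fun x => (f x / A).toReal) (g := fun x => (g x / B).toReal)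
    (h := fun x => (min (h x) C / C).toReal)
    (by fun_prop) (by fun_prop) (by fun_prop)
    (fun _ => ENNReal.toReal_nonneg) (fun _ => ENNReal.toReal_nonneg)
    (fun _ => ENNReal.toReal_nonneg)
    (fun x => ENNReal.toReal_le_of_le_ofReal zero_le_one
      (by simpa using ENNReal.div_le_of_le_mul (by simpa using hfA x)))
    (fun x => ENNReal.toReal_le_of_le_ofReal zero_le_one
      (by simpa using ENNReal.div_le_of_le_mul (by simpa using hgB x)))
    (hsup f hA0 hAt) (hsup g hB0 hBt) ?_
  · have e : ∀ (k : ℝ → ℝ≥0∞) (D : ℝ≥0∞), D ≠ 0 → D ≠ ∞ → (∀ x, k x ≤ D) → Measurable k →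
        ∫⁻ x, ENNReal.ofReal (k x / D).toReal = (∫⁻ x, k x) / D := by
      intro k D h0 ht hk hkm
      rw [div_eq_mul_inv, ← lintegral_mul_const _ hkm]
      refine lintegral_congr fun x => ?_
      rw [ENNReal.ofReal_toReal (ENNReal.div_ne_top ((hk x).trans_lt ht.lt_top).ne h0),
        div_eq_mul_inv]
    rw [e f A hA0 hAt hfA hf, e g B hB0 hBt hgB hg,
      e _ C hC0 hCt (fun x => min_le_right _ _) (hh.min measurable_const)] at key
    have k2 := (ENNReal.geom_mean_le_arith_mean2 ha hb hab _ _).trans key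
    rw [ENNReal.div_rpow_of_nonneg _ _ ha.le, ENNReal.div_rpow_of_nonneg _ _ hb.le] at k2
    have hAa : A ^ a ≠ 0 := by simp [ENNReal.rpow_eq_zero_iff, hA0, hAt]
    have hBb : B ^ b ≠ 0 := by simp [ENNReal.rpow_eq_zero_iff, hB0, hBt]
    have hAa' : A ^ a ≠ ∞ := ENNReal.rpow_ne_top_of_nonneg ha.le hAt
    have hBb' : B ^ b ≠ ∞ := ENNReal.rpow_ne_top_of_nonneg hb.le hBt
    rw [← ENNReal.mul_div_mul_comm (Or.inl hAa) (Or.inl hAa'), ← hC,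
      ENNReal.div_le_iff hC0 hCt, ENNReal.div_mul_cancel hC0 hCt] at k2
    exact k2.trans (lintegral_mono fun x => min_le_left _ _)
  · intro x y
    rw [ENNReal.toReal_rpow, ENNReal.toReal_rpow, ← ENNReal.toReal_mul]
    refine ENNReal.toReal_mono (ENNReal.div_ne_top (min_le_right _ _ |>.trans_lt hCt.lt_top).ne hC0)
      ?_
    rw [ENNReal.div_rpow_of_nonneg _ _ ha.le, ENNReal.div_rpow_of_nonneg _ _ hb.le,
      ← ENNReal.mul_div_mul_comm (Or.inl (by simp [ENNReal.rpow_eq_zero_iff, hA0, hAt]))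
        (Or.inl (ENNReal.rpow_ne_top_of_nonneg ha.le hAt))]
    refine ENNReal.div_le_div_right (le_min (H x y) ?_) _
    exact mul_le_mul' (ENNReal.rpow_le_rpow (hfA x) ha.le) (ENNReal.rpow_le_rpow (hgB y) hb.le)

/-- One-dimensional Prékopa-Leindler inequality. -/
theorem prekopa_leindler_one {a b : ℝ} (ha : 0 < a) (hb : 0 < b) (hab : a + b = 1)
    {f g h : ℝ → ℝ≥0∞} (hf : Measurable f) (hg : Measurable g) (hh : Measurable h)
    (H : ∀ x y, f x ^ a * g y ^ b ≤ h (a * x + b * y)) :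
    (∫⁻ x, f x) ^ a * (∫⁻ x, g x) ^ b ≤ ∫⁻ x, h x := by
  rcases eq_or_ne (∫⁻ x, f x) 0 with hf0 | hf0
  · simp [hf0, ha]
  rcases eq_or_ne (∫⁻ x, g x) 0 with hg0 | hg0
  · simp [hg0, hb]
  have htr : ∀ k : ℝ → ℝ≥0∞, Measurable k →
      Filter.Tendsto (fun N : ℕ => ∫⁻ x, min (k x) N) Filter.atTop (nhds (∫⁻ x, k x)) := by
    intro k hk
    refine lintegral_tendsto_of_tendsto_of_monotone
      (fun N => (hk.min measurable_const).aemeasurable)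
      (ae_of_all _ fun x M N hMN => min_le_min le_rfl (by exact_mod_cast hMN))
      (ae_of_all _ fun x => ?_)
    have : Filter.Tendsto (fun N : ℕ => min (k x) (N : ℝ≥0∞)) Filter.atTop
        (nhds (min (k x) ∞)) := tendsto_const_nhds.min ENNReal.tendsto_nat_nhds_top
    simpa using this
  have hlim := ENNReal.Tendsto.mul
    ((ENNReal.continuous_rpow_const (y := a)).continuousAt.tendsto.comp (htr f hf))
    (Or.inl (by simp [ENNReal.rpow_eq_zero_iff, hf0, not_lt_of_ge ha.le]))
    ((ENNReal.continuous_rpow_const (y := b)).continuousAt.tendsto.comp (htr g hg))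
    (Or.inl (by simp [ENNReal.rpow_eq_zero_iff, hg0, not_lt_of_ge hb.le]))
  refine le_of_tendsto' hlim fun N => ?_
  refine prekopa_leindler_one_of_bounded ha hb hab (hf.min measurable_const)
    (hg.min measurable_const) hh (ENNReal.natCast_ne_top N) (fun x => min_le_right _ _)
    (fun x => min_le_right _ _) fun x y => le_trans ?_ (H x y)
  gcongr <;> exact min_le_left _ _

theorem measurable_fin_cons (d : ℕ) :
    Measurable fun p : ℝ × (Fin d → ℝ) => (Fin.cons p.1 p.2 : Fin (d + 1) → ℝ) := by
  rw [measurable_pi_iff]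
  intro i
  refine Fin.cases ?_ (fun i => ?_) i
  · simpa using measurable_fst
  · simp only [Fin.cons_succ]
    fun_prop

theorem lintegral_fin_succ {d : ℕ} {f : (Fin (d + 1) → ℝ) → ℝ≥0∞} (hf : Measurable f) :
    ∫⁻ x, f x = ∫⁻ t : ℝ, ∫⁻ z : Fin d → ℝ, f (Fin.cons t z) := by
  have hmp := (volume_preserving_piFinSuccAbove (fun _ : Fin (d + 1) => ℝ) 0).symm
  rw [← hmp.lintegral_comp hf]
  have e : ∀ p, (MeasurableEquiv.piFinSuccAbove (fun _ : Fin (d + 1) => ℝ) 0).symm p =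
      Fin.cons p.1 p.2 := fun p => Fin.insertNth_zero' p.1 p.2
  simp only [e]
  exact lintegral_prod (fun p : ℝ × (Fin d → ℝ) => f (Fin.cons p.1 p.2))
    (hf.comp (measurable_fin_cons d)).aemeasurable

/-- The Prékopa-Leindler inequality. -/
theorem prekopa_leindler {a b : ℝ} (ha : 0 < a) (hb : 0 < b) (hab : a + b = 1) (d : ℕ)
    {f g h : (Fin d → ℝ) → ℝ≥0∞} (hf : Measurable f) (hg : Measurable g) (hh : Measurable h)
    (H : ∀ x y, f x ^ a * g y ^ b ≤ h (a • x + b • y)) :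
    (∫⁻ x, f x) ^ a * (∫⁻ x, g x) ^ b ≤ ∫⁻ x, h x := by
  induction d with
  | zero =>
    have h1 : ∀ k : (Fin 0 → ℝ) → ℝ≥0∞, ∫⁻ x, k x = k default := by
      intro k
      rw [lintegral_unique, volume_pi, Measure.pi_univ]
      simp only [Finset.univ_eq_empty, Finset.prod_empty, mul_one]
      exact congrArg k (Subsingleton.elim _ _)
    rw [h1, h1, h1]
    exact (H default default).trans_eq (congrArg h (Subsingleton.elim _ _))
  | succ d ih =>
    have hcons := measurable_fin_cons d
    have hcons' : ∀ t : ℝ, Measurable fun z : Fin d → ℝ => (Fin.cons t z : Fin (d + 1) → ℝ) :=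
      fun t => hcons.comp measurable_prodMk_left
    rw [lintegral_fin_succ hf, lintegral_fin_succ hg, lintegral_fin_succ hh]
    refine prekopa_leindler_one ha hb hab (hf.comp hcons).lintegral_prod_right'
      (hg.comp hcons).lintegral_prod_right' (hh.comp hcons).lintegral_prod_right' fun s t => ?_
    refine ih (hf.comp (hcons' s)) (hg.comp (hcons' t)) (hh.comp (hcons' _)) fun x y => ?_
    refine (H (Fin.cons s x) (Fin.cons t y)).trans_eq ?_
    refine congrArg h ?_
    ext i
    refine Fin.cases ?_ (fun i => ?_) i <;> simp

/-- If `f` is even, non-increasing in `|t|` and midpoint log-concave, its value at `0` controls its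
second moment. -/
theorem sq_mul_second_moment_le {f : ℝ → ℝ≥0∞} (hf : Measurable f)
    (hmono : ∀ s t, |s| ≤ |t| → f t ≤ f s) (hlc : ∀ u, f 0 * f (2 * u) ≤ f u ^ 2)
    (hf0 : f 0 ≠ ∞) (hI0 : ∫⁻ t, f t ≠ 0) (hI : ∫⁻ t, f t ≠ ∞)
    (hJ : ∫⁻ t, ENNReal.ofReal (t ^ 2) * f t ≠ ∞) :
    f 0 ^ 2 * ∫⁻ t, ENNReal.ofReal (t ^ 2) * f t ≤ 1024 * (∫⁻ t, f t) ^ 3 := by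
  rcases eq_or_ne (f 0) 0 with h0 | h0
  · simp [h0]
  obtain ⟨F, hF, hFe⟩ : ∃ F : ℝ, 0 < F ∧ f 0 = ENNReal.ofReal F :=
    ⟨(f 0).toReal, ENNReal.toReal_pos h0 hf0, (ENNReal.ofReal_toReal hf0).symm⟩
  obtain ⟨I, hIp, hIe⟩ : ∃ I : ℝ, 0 < I ∧ ∫⁻ t, f t = ENNReal.ofReal I :=
    ⟨_, ENNReal.toReal_pos hI0 hI, (ENNReal.ofReal_toReal hI).symm⟩
  obtain ⟨J, hJp, hJe⟩ : ∃ J : ℝ, 0 ≤ J ∧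
      ∫⁻ t, ENNReal.ofReal (t ^ 2) * f t = ENNReal.ofReal J :=
    ⟨_, ENNReal.toReal_nonneg, (ENNReal.ofReal_toReal hJ).symm⟩
  set s : ℝ := 8 * I / F with hs
  have hsp : 0 < s := by positivity
  have hfs : f s ≤ ENNReal.ofReal (F / 16) := by
    have h1 : f s * ENNReal.ofReal (2 * s) ≤ ENNReal.ofReal I := by
      rw [← hIe]
      calc f s * ENNReal.ofReal (2 * s) = ∫⁻ t in Set.Icc (-s) s, f s := by
            rw [setLIntegral_const, Real.volume_Icc]; ring_nf
        _ ≤ ∫⁻ t in Set.Icc (-s) s, f t :=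
            setLIntegral_mono hf fun t ht => hmono t s (by
              rw [abs_of_pos hsp]; exact abs_le.2 ht)
        _ ≤ ∫⁻ t, f t := setLIntegral_le_lintegral _ _
    have h2 : ENNReal.ofReal (F / 16) = ENNReal.ofReal I / ENNReal.ofReal (2 * s) := by
      rw [← ENNReal.ofReal_div_of_pos (by positivity)]
      congr 1
      rw [hs]; field_simp; norm_num
    rw [h2]
    exact ENNReal.le_div_iff_mul_le (Or.inl (by simpa using hsp))
      (Or.inl ENNReal.ofReal_ne_top) |>.2 h1
  have hscale : ∫⁻ t, ENNReal.ofReal (t ^ 2) * f t =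
      8 * ∫⁻ u, ENNReal.ofReal (u ^ 2) * f (2 * u) := by
    have h1 := Real.smul_map_volume_mul_left (a := 2) two_ne_zero
    conv_lhs => rw [← h1]
    rw [lintegral_smul_measure, lintegral_map (by fun_prop) (by fun_prop)]
    have h2 : ∀ u : ℝ, ENNReal.ofReal ((2 * u) ^ 2) * f (2 * u) =
        4 * (ENNReal.ofReal (u ^ 2) * f (2 * u)) := by
      intro u
      rw [mul_pow, ENNReal.ofReal_mul (by positivity), mul_assoc]
      norm_num
    simp only [h2]
    rw [lintegral_const_mul _ (by fun_prop), smul_eq_mul, ← mul_assoc]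
    norm_num
  have hmain : f 0 * ∫⁻ t, ENNReal.ofReal (t ^ 2) * f t ≤
      8 * (ENNReal.ofReal (s ^ 2 * F) * (∫⁻ t, f t) +
        ENNReal.ofReal (F / 16) * (∫⁻ t, ENNReal.ofReal (t ^ 2) * f t)) := by
    conv_lhs => rw [hscale, mul_left_comm]
    refine mul_le_mul' le_rfl ?_
    rw [← lintegral_const_mul _ (by fun_prop), ← lintegral_const_mul _ (by fun_prop),
      ← lintegral_const_mul _ (by fun_prop), ← lintegral_add_left (by fun_prop)]
    refine lintegral_mono fun u => ?_
    have h1 : f 0 * (ENNReal.ofReal (u ^ 2) * f (2 * u)) ≤ ENNReal.ofReal (u ^ 2) * f u ^ 2 := by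
      rw [mul_left_comm]
      gcongr
      exact hlc u
    refine h1.trans ?_
    rcases le_or_gt |u| s with hu | hu
    · refine le_add_right ?_
      have h2 : u ^ 2 ≤ s ^ 2 := sq_le_sq.2 (by rwa [abs_of_pos hsp])
      have h3 : f u ≤ ENNReal.ofReal F := hFe ▸ hmono 0 u (by simp)
      rw [ENNReal.ofReal_mul (by positivity), sq (f u), ← mul_assoc, mul_assoc, mul_assoc]
      gcongr
    · refine le_add_left ?_
      have h3 : f u ≤ ENNReal.ofReal (F / 16) :=
        (hmono s u (by rw [abs_of_pos hsp]; exact hu.le)).trans hfs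
      rw [sq (f u), mul_comm (ENNReal.ofReal (F / 16)), ← mul_assoc]
      gcongr
  rw [hIe, hJe, hFe] at *
  have e8 : (8 : ℝ≥0∞) = ENNReal.ofReal 8 := by simp
  have e1024 : (1024 : ℝ≥0∞) = ENNReal.ofReal 1024 := by simp
  rw [e8, ← ENNReal.ofReal_mul (by positivity), ← ENNReal.ofReal_mul (by positivity),
    ← ENNReal.ofReal_mul (by positivity), ← ENNReal.ofReal_add (by positivity) (by positivity),
    ← ENNReal.ofReal_mul (by positivity), ENNReal.ofReal_le_ofReal_iff (by positivity)] at hmain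
  rw [e1024, ← ENNReal.ofReal_pow hF.le, ← ENNReal.ofReal_pow hIp.le,
    ← ENNReal.ofReal_mul (by positivity), ← ENNReal.ofReal_mul (by positivity),
    ENNReal.ofReal_le_ofReal_iff (by positivity)]
  have h5 : s * F = 8 * I := by rw [hs]; field_simp
  have h6 : F * J ≤ 16 * (s ^ 2 * F * I) := by linarith
  calc F ^ 2 * J = F * (F * J) := by ring
    _ ≤ F * (16 * (s ^ 2 * F * I)) := by gcongr
    _ = 16 * (s * F) ^ 2 * I := by ring
    _ = 1024 * I ^ 3 := by rw [h5]; ring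

/-- The `m`-dimensional volume of the slice of `K` at height `t` along the first vector of `b`. -/
def sliceVol {m : ℕ} (b : OrthonormalBasis (Fin (m + 1)) ℝ (Euc (m + 1))) (K : Set (Euc (m + 1)))
    (t : ℝ) : ℝ≥0∞ :=
  volume {z : Fin m → ℝ | b.repr.symm (WithLp.toLp 2 (Fin.cons t z : Fin (m + 1) → ℝ)) ∈ K}

section Slices

variable {m : ℕ} (b : OrthonormalBasis (Fin (m + 1)) ℝ (Euc (m + 1))) {K : Set (Euc (m + 1))}

theorem measurable_slice_map : Measurable fun p : ℝ × (Fin m → ℝ) =>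
    b.repr.symm (WithLp.toLp 2 (Fin.cons p.1 p.2 : Fin (m + 1) → ℝ)) :=
  b.repr.symm.continuous.measurable.comp
    ((WithLp.measurable_toLp 2 _).comp (measurable_fin_cons m))

theorem measurable_slice_map_right (t : ℝ) : Measurable fun z : Fin m → ℝ =>
    b.repr.symm (WithLp.toLp 2 (Fin.cons t z : Fin (m + 1) → ℝ)) :=
  (measurable_slice_map b).comp measurable_prodMk_left

theorem slice_map_combo (a c s t : ℝ) (x y : Fin m → ℝ) :
    b.repr.symm (WithLp.toLp 2 (Fin.cons (a * s + c * t) (a • x + c • y) : Fin (m + 1) → ℝ)) =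
      a • b.repr.symm (WithLp.toLp 2 (Fin.cons s x : Fin (m + 1) → ℝ)) +
      c • b.repr.symm (WithLp.toLp 2 (Fin.cons t y : Fin (m + 1) → ℝ)) := by
  rw [← map_smul, ← map_smul, ← map_add]
  congr 1
  ext i
  refine Fin.cases ?_ (fun i => ?_) i <;> simp

theorem inner_slice_map (t : ℝ) (z : Fin m → ℝ) :
    ⟪b.repr.symm (WithLp.toLp 2 (Fin.cons t z : Fin (m + 1) → ℝ)), b 0⟫ = t := by
  rw [real_inner_comm, ← b.repr_apply_apply]
  simp

theorem measurable_sliceVol (hK : MeasurableSet K) : Measurable (sliceVol b K) :=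
  measurable_measure_prodMk_left (measurable_slice_map b hK)

/-- Fubini's theorem along the first vector of an orthonormal basis. -/
theorem setLIntegral_inner_eq (hK : MeasurableSet K) {φ : ℝ → ℝ≥0∞} (hφ : Measurable φ) :
    ∫⁻ y in K, φ ⟪y, b 0⟫ = ∫⁻ t, φ t * sliceVol b K t := by
  have hm : Measurable fun y : Euc (m + 1) => φ ⟪y, b 0⟫ := hφ.comp (by fun_prop)
  have hmp := b.measurePreserving_repr_symm.comp
    (PiLp.volume_preserving_toLp (Fin (m + 1)))
  rw [← lintegral_indicator hK, ← hmp.lintegral_comp (hm.indicator hK)]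
  refine (lintegral_fin_succ ((hm.indicator hK).comp hmp.measurable)).trans ?_
  refine lintegral_congr fun t => ?_
  have hs : MeasurableSet {z : Fin m → ℝ |
      b.repr.symm (WithLp.toLp 2 (Fin.cons t z : Fin (m + 1) → ℝ)) ∈ K} :=
    measurable_slice_map_right b t hK
  rw [sliceVol, ← setLIntegral_const, ← lintegral_indicator hs]
  refine lintegral_congr fun z => ?_
  by_cases hz : b.repr.symm (WithLp.toLp 2 (Fin.cons t z : Fin (m + 1) → ℝ)) ∈ K <;>
    simp [hz, inner_slice_map]

theorem sliceVol_log_concave (hK : MeasurableSet K) (hc : Convex ℝ K) {a c : ℝ} (ha : 0 < a)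
    (hc0 : 0 < c) (hac : a + c = 1) (s t : ℝ) :
    sliceVol b K s ^ a * sliceVol b K t ^ c ≤ sliceVol b K (a * s + c * t) := by
  have hm : ∀ t, MeasurableSet {z : Fin m → ℝ |
      b.repr.symm (WithLp.toLp 2 (Fin.cons t z : Fin (m + 1) → ℝ)) ∈ K} :=
    fun t => measurable_slice_map_right b t hK
  simp only [sliceVol, ← lintegral_indicator_one (hm _)]
  refine prekopa_leindler ha hc0 hac m (measurable_one.indicator (hm s))
    (measurable_one.indicator (hm t)) (measurable_one.indicator (hm _)) fun x y => ?_
  by_cases hx : b.repr.symm (WithLp.toLp 2 (Fin.cons s x : Fin (m + 1) → ℝ)) ∈ K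
  · by_cases hy : b.repr.symm (WithLp.toLp 2 (Fin.cons t y : Fin (m + 1) → ℝ)) ∈ K
    · have := hc hx hy ha.le hc0.le hac
      rw [← slice_map_combo] at this
      simp [hx, hy, this]
    · simp [hy, hc0]
  · simp [hx, ha]

theorem sliceVol_neg (hs : K = -K) (t : ℝ) : sliceVol b K (-t) = sliceVol b K t := by
  rw [sliceVol, sliceVol, ← Measure.measure_neg]
  congr 1
  ext z
  have := slice_map_combo b (-1) 0 t 0 z 0
  simp only [neg_smul, one_smul, zero_smul, add_zero, neg_mul, one_mul, mul_zero] at this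
  simp only [Set.mem_neg, Set.mem_ofPred_eq, this]
  conv_lhs => rw [hs]
  simp

theorem sliceVol_anti (hK : MeasurableSet K) (hc : Convex ℝ K) (hs : K = -K) {s t : ℝ}
    (hst : |s| ≤ |t|) : sliceVol b K t ≤ sliceVol b K s := by
  rcases eq_or_lt_of_le hst with h | h
  · rcases abs_eq_abs.1 h with h | h
    · rw [h]
    · rw [h, sliceVol_neg b hs]
  have ht : t ≠ 0 := by
    rintro rfl
    simp at h
    linarith [abs_nonneg s]
  have h1 : |s / t| < 1 := by rw [abs_div]; exact (div_lt_one (by positivity)).2 h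
  obtain ⟨h2, h3⟩ := abs_lt.1 h1
  have := sliceVol_log_concave b hK hc (a := (1 + s / t) / 2) (c := (1 - s / t) / 2)
    (by linarith) (by linarith) (by ring) t (-t)
  rw [sliceVol_neg b hs, ← ENNReal.rpow_add_of_nonneg _ _ (by linarith) (by linarith)] at this
  have e1 : (1 + s / t) / 2 + (1 - s / t) / 2 = 1 := by ring
  have e2 : (1 + s / t) / 2 * t + (1 - s / t) / 2 * -t = s := by field_simp; ring
  rwa [e1, e2, ENNReal.rpow_one] at this

theorem sliceVol_ne_top (hK : Bornology.IsBounded K) (t : ℝ) : sliceVol b K t ≠ ∞ := by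
  obtain ⟨R, hR⟩ := hK.subset_closedBall 0
  refine ((measure_mono (t := closedBall 0 R) fun z hz => ?_).trans_lt
    measure_closedBall_lt_top).ne
  have h1 := hR hz
  rw [mem_closedBall_zero_iff, LinearIsometryEquiv.norm_map] at h1
  rw [mem_closedBall_zero_iff, pi_norm_le_iff_of_nonneg ((norm_nonneg _).trans h1)]
  intro i
  refine le_trans ?_ h1
  simpa using PiLp.norm_apply_le (WithLp.toLp 2 (Fin.cons t z : Fin (m + 1) → ℝ)) i.succ

end Slices

/-- The ratio between `m`-dimensional Hausdorff measure and Lebesgue measure on `ℝ^m`. -/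
def hausdorffScale (m : ℕ) : ℝ≥0 :=
  (μH[(m : ℝ)] : Measure (Euc m)).addHaarScalarFactor volume

theorem hausdorffMeasure_eq_hausdorffScale_smul (m : ℕ) :
    (μH[(m : ℝ)] : Measure (Euc m)) = hausdorffScale m • volume :=
  Measure.isAddLeftInvariant_eq_smul _ _

theorem hausdorffScale_pos (m : ℕ) : 0 < hausdorffScale m :=
  Measure.addHaarScalarFactor_pos_of_isAddHaarMeasure _ _

/-- Every unit vector is the first vector of some orthonormal basis. -/
theorem exists_orthonormalBasis_zero {m : ℕ} {θ : Euc (m + 1)} (hθ : ‖θ‖ = 1) :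
    ∃ b : OrthonormalBasis (Fin (m + 1)) ℝ (Euc (m + 1)), b 0 = θ := by
  have ho : Orthonormal ℝ (({0} : Set (Fin (m + 1))).domRestrict fun _ => θ) := by
    refine ⟨fun _ => hθ, fun i j hij => (hij (Subsingleton.elim i j)).elim⟩
  obtain ⟨b, hb⟩ := ho.exists_orthonormalBasis_extension_of_card_eq (by simp)
  exact ⟨b, hb 0 rfl⟩

section Sections

variable {m : ℕ} (b : OrthonormalBasis (Fin (m + 1)) ℝ (Euc (m + 1))) {K : Set (Euc (m + 1))}

/-- The isometric parametrization of the hyperplane orthogonal to the first basis vector. -/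
def hyperplaneMap (z : Euc m) : Euc (m + 1) :=
  b.repr.symm (WithLp.toLp 2 (Fin.cons 0 z.ofLp : Fin (m + 1) → ℝ))

theorem isometry_hyperplaneMap : Isometry (hyperplaneMap b) := by
  refine Isometry.of_dist_eq fun x y => ?_
  rw [hyperplaneMap, hyperplaneMap, LinearIsometryEquiv.dist_map, EuclideanSpace.dist_eq,
    EuclideanSpace.dist_eq, Fin.sum_univ_succ]
  simp

theorem range_hyperplaneMap : range (hyperplaneMap b) = {x | ⟪x, b 0⟫ = 0} := by
  ext x
  constructor
  · rintro ⟨z, rfl⟩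
    exact inner_slice_map b 0 _
  · intro hx
    rw [Set.mem_ofPred_eq, real_inner_comm, ← b.repr_apply_apply] at hx
    refine ⟨WithLp.toLp 2 fun i => b.repr x i.succ, ?_⟩
    rw [hyperplaneMap, LinearIsometryEquiv.symm_apply_eq]
    ext i
    refine Fin.cases ?_ (fun i => ?_) i <;> simp [hx]

theorem sectionVol_eq (hK : MeasurableSet K) :
    sectionVol (m + 1) K (b 0) = hausdorffScale m * sliceVol b K 0 := by
  have hmp := PiLp.volume_preserving_toLp (Fin m)
  have hc := (isometry_hyperplaneMap b).continuous.measurable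
  rw [sectionVol, ← range_hyperplaneMap, ← Set.image_preimage_eq_inter_range]
  have e : ((m + 1 : ℕ) : ℝ) - 1 = m := by push_cast; ring
  rw [e, (isometry_hyperplaneMap b).hausdorffMeasure_image (Or.inl (by positivity)),
    hausdorffMeasure_eq_hausdorffScale_smul, Measure.smul_apply, ENNReal.smul_def, smul_eq_mul,
    ← hmp.measure_preimage (hc hK).nullMeasurableSet]
  rfl

/-- A convex body with much mass in a thin slab has a large central section. -/
theorem le_sectionVol_of_slab (hK : MeasurableSet K) (hc : Convex ℝ K) (hs : K = -K)
    {x : Euc (m + 1)} (hx : x ≠ 0) {ε : ℝ} (hε : 0 < ε)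
    (h : ENNReal.ofReal (2 * ε) ≤ volume (K ∩ {y | |⟪y, x⟫| ≤ ε})) :
    ENNReal.ofReal ‖x‖ * hausdorffScale m ≤ sectionVol (m + 1) K (‖x‖⁻¹ • x) := by
  have hx0 : 0 < ‖x‖ := norm_pos_iff.2 hx
  obtain ⟨b, hb⟩ := exists_orthonormalBasis_zero (θ := ‖x‖⁻¹ • x) (by
    rw [norm_smul, norm_inv, norm_norm, inv_mul_cancel₀ hx0.ne'])
  rw [← hb, sectionVol_eq b hK, mul_comm]
  refine mul_le_mul' le_rfl ?_
  set δ := ε / ‖x‖ with hδ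
  have hδ0 : 0 < δ := by positivity
  have hset : K ∩ {y | |⟪y, x⟫| ≤ ε} = {y | ⟪y, b 0⟫ ∈ Icc (-δ) δ} ∩ K := by
    rw [Set.inter_comm]
    congr 1
    ext y
    rw [Set.mem_ofPred_eq, Set.mem_ofPred_eq, hb, Set.mem_Icc, ← abs_le, inner_smul_right, abs_mul,
      abs_inv, abs_norm, hδ, inv_mul_eq_div, div_le_div_iff_of_pos_right hx0]
  have hm : MeasurableSet {y : Euc (m + 1) | ⟪y, b 0⟫ ∈ Icc (-δ) δ} :=
    (by fun_prop : Measurable fun y : Euc (m + 1) => ⟪y, b 0⟫) measurableSet_Icc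
  have h1 := setLIntegral_inner_eq b hK
    (measurable_one.indicator (measurableSet_Icc (a := -δ) (b := δ)) :
      Measurable ((Icc (-δ) δ).indicator (1 : ℝ → ℝ≥0∞)))
  have h2 : ∫⁻ y in K, (Icc (-δ) δ).indicator (1 : ℝ → ℝ≥0∞) ⟪y, b 0⟫ =
      volume (K ∩ {y | |⟪y, x⟫| ≤ ε}) := by
    rw [hset, ← Measure.restrict_apply hm,
      ← lintegral_indicator_one hm]
    rfl
  have h3 : ∫⁻ t, (Icc (-δ) δ).indicator (1 : ℝ → ℝ≥0∞) t * sliceVol b K t ≤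
      ENNReal.ofReal (2 * δ) * sliceVol b K 0 := by
    calc _ ≤ ∫⁻ t, (Icc (-δ) δ).indicator (fun _ => sliceVol b K 0) t := by
          refine lintegral_mono fun t => ?_
          by_cases ht : t ∈ Icc (-δ) δ
          · simpa [ht] using sliceVol_anti b hK hc hs (s := 0) (t := t) (by simp)
          · simp [ht]
      _ = _ := by
          rw [lintegral_indicator measurableSet_Icc, setLIntegral_const, Real.volume_Icc, mul_comm]
          ring_nf
  rw [← h2, h1] at h
  have h4 := h.trans h3
  have h5 : 2 * ε = 2 * δ * ‖x‖ := by rw [hδ]; field_simp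
  rw [h5, ENNReal.ofReal_mul (by positivity)] at h4
  exact (ENNReal.mul_le_mul_iff_right (by simpa using hδ0) ENNReal.ofReal_ne_top).1 h4

/-- A large central section forces a small second moment in the orthogonal direction. -/
theorem second_moment_le_of_le_sectionVol (hK : IsCompact K) (hc : Convex ℝ K) (hs : K = -K)
    (hK0 : volume K ≠ 0) {θ : Euc (m + 1)} (hθ : ‖θ‖ = 1) {r : ℝ} (hr : 0 ≤ r)
    (h : ENNReal.ofReal r * hausdorffScale m ≤ sectionVol (m + 1) K θ) :
    ∫⁻ y in K, ENNReal.ofReal (⟪y, r • θ⟫ ^ 2) ≤ 1024 * volume K ^ 3 := by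
  have hKm := hK.measurableSet
  obtain ⟨b, rfl⟩ := exists_orthonormalBasis_zero hθ
  have hκ : (hausdorffScale m : ℝ≥0∞) ≠ 0 := by simpa using (hausdorffScale_pos m).ne'
  rw [sectionVol_eq b hKm, mul_comm, ENNReal.mul_le_mul_iff_right hκ ENNReal.coe_ne_top] at h
  have hvol : ∫⁻ t, sliceVol b K t = volume K := by
    have := setLIntegral_inner_eq b hKm (φ := 1) measurable_one
    simpa using this.symm
  have hmom : ∫⁻ t, ENNReal.ofReal (t ^ 2) * sliceVol b K t =
      ∫⁻ y in K, ENNReal.ofReal (⟪y, b 0⟫ ^ 2) :=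
    (setLIntegral_inner_eq b hKm (φ := fun t => ENNReal.ofReal (t ^ 2)) (by fun_prop)).symm
  have hfin : ∫⁻ y in K, ENNReal.ofReal (⟪y, b 0⟫ ^ 2) ≠ ∞ := by
    have hi : IntegrableOn (fun y : Euc (m + 1) => ⟪y, b 0⟫ ^ 2) K :=
      ContinuousOn.integrableOn_compact hK (by fun_prop)
    exact hi.lintegral_lt_top.ne
  have key := sq_mul_second_moment_le (measurable_sliceVol b hKm)
    (fun s t hst => sliceVol_anti b hKm hc hs hst)
    (fun u => by
      have h1 := sliceVol_log_concave b hKm hc (a := 1 / 2) (c := 1 / 2) (by norm_num) (by norm_num)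
        (by norm_num) 0 (2 * u)
      have e : (1 / 2 : ℝ) * 0 + 1 / 2 * (2 * u) = u := by ring
      rw [e] at h1
      have h2 := pow_le_pow_left₀ (by simp) h1 2
      rw [mul_pow, ← ENNReal.rpow_natCast, ← ENNReal.rpow_natCast, ← ENNReal.rpow_mul,
        ← ENNReal.rpow_mul] at h2
      norm_num at h2
      simpa using h2)
    (sliceVol_ne_top b hK.isBounded 0) (by rwa [hvol]) (by rw [hvol]; exact hK.measure_lt_top.ne)
    (by rwa [hmom])
  rw [hvol, hmom] at key
  refine le_trans (le_of_eq_of_le ?_ (mul_le_mul_left (pow_le_pow_left₀ (by simp) h 2) _)) key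
  rw [← ENNReal.ofReal_pow hr, ← lintegral_const_mul _ (by fun_prop)]
  refine lintegral_congr fun y => ?_
  rw [← ENNReal.ofReal_mul (by positivity), inner_smul_right, mul_pow]

end Sections

theorem measure_ball_ne_zero_of_forall_eq {X : Type*} [PseudoMetricSpace X]
    [SecondCountableTopology X] [MeasurableSpace X] {ν : Measure X} (hν : ν ≠ 0) {r : ℝ}
    (hr : 0 < r) {c : ℝ≥0∞} (hc : ∀ x, ν (ball x r) = c) : c ≠ 0 := fun h =>
  hν <| Measure.measure_univ_eq_zero.1 <| measure_null_of_locally_null _ fun x _ =>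
    ⟨ball x r, mem_nhdsWithin_of_mem_nhds (ball_mem_nhds x hr), (hc x).trans h⟩

section UniformlyDistributed

variable {X : Type*} [PseudoMetricSpace X] [SecondCountableTopology X] [MeasurableSpace X]
  [BorelSpace X]

theorem measure_isOpen_le_liminf_ratio (μ ν : Measure X) [IsFiniteMeasure μ] [IsFiniteMeasure ν]
    (hν : ν ≠ 0) {g h : ℕ → ℝ≥0∞} (hg : ∀ (k : ℕ) x, μ (ball x (1 / ((k : ℝ) + 1))) = g k)
    (hh : ∀ (k : ℕ) x, ν (ball x (1 / ((k : ℝ) + 1))) = h k) {U : Set X} (hU : IsOpen U) :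
    μ U ≤ Filter.liminf (fun k => g k / h k) Filter.atTop * ν U := by
  have hpos : ∀ k : ℕ, (0 : ℝ) < 1 / ((k : ℝ) + 1) := fun k => by positivity
  rcases isEmpty_or_nonempty X with hX | ⟨⟨x₀⟩⟩
  · exact (hν (Subsingleton.elim _ _)).elim
  have hh0 : ∀ k, h k ≠ 0 := fun k => measure_ball_ne_zero_of_forall_eq hν (hpos k) (hh k)
  have hht : ∀ k, h k ≠ ∞ := fun k => by rw [← hh k x₀]; exact measure_ne_top _ _
  have hD : ∀ k : ℕ, MeasurableSet {p : X × X | p.2 ∈ U ∧ dist p.2 p.1 < 1 / ((k : ℝ) + 1)} :=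
    fun k => ((hU.preimage continuous_snd).inter
      (isOpen_lt (continuous_snd.dist continuous_fst) continuous_const)).measurableSet
  have hsect : ∀ (k : ℕ) x,
      (Prod.mk x ⁻¹' {p : X × X | p.2 ∈ U ∧ dist p.2 p.1 < 1 / ((k : ℝ) + 1)}) =
      U ∩ ball x (1 / ((k : ℝ) + 1)) := fun k x => rfl
  have hmeas : ∀ k : ℕ, Measurable fun x => ν (U ∩ ball x (1 / ((k : ℝ) + 1))) / h k := fun k => by
    have := measurable_measure_prodMk_left (ν := ν) (hD k)
    simp only [hsect] at this
    exact this.div_const _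
  have hlim : ∀ x ∈ U, Filter.liminf (fun k : ℕ => ν (U ∩ ball x (1 / ((k : ℝ) + 1))) / h k)
      Filter.atTop = 1 := by
    intro x hx
    obtain ⟨ε, hε, hεU⟩ := Metric.isOpen_iff.1 hU x hx
    refine (Filter.Tendsto.congr' ?_ tendsto_const_nhds).liminf_eq
    obtain ⟨N, hN⟩ := exists_nat_one_div_lt hε
    filter_upwards [Filter.eventually_ge_atTop N] with k hk
    have hsub : ball x (1 / ((k : ℝ) + 1)) ⊆ U :=
      (ball_subset_ball ((Nat.one_div_le_one_div hk).trans hN.le)).trans hεU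
    rw [inter_eq_right.2 hsub, hh, ENNReal.div_self (hh0 k) (hht k)]
  have hfub : ∀ k : ℕ, ∫⁻ x in U, ν (U ∩ ball x (1 / ((k : ℝ) + 1))) / h k ∂μ ≤
      g k / h k * ν U := by
    intro k
    have e1 : ∫⁻ x in U, ν (U ∩ ball x (1 / ((k : ℝ) + 1))) ∂μ =
        ((μ.restrict U).prod ν)
          {p : X × X | p.2 ∈ U ∧ dist p.2 p.1 < 1 / ((k : ℝ) + 1)} := by
      rw [Measure.prod_apply (hD k)]
      rfl
    have e2 : ((μ.restrict U).prod ν)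
          {p : X × X | p.2 ∈ U ∧ dist p.2 p.1 < 1 / ((k : ℝ) + 1)} ≤ g k * ν U := by
      rw [Measure.prod_apply_symm (hD k)]
      calc _ ≤ ∫⁻ y, U.indicator (fun _ => g k) y ∂ν := by
            refine lintegral_mono fun y => ?_
            by_cases hy : y ∈ U
            · rw [indicator_of_mem hy, ← hg k y]
              refine (Measure.restrict_apply_le _ _).trans (measure_mono ?_)
              rintro x ⟨_, hx⟩
              rwa [mem_ball, dist_comm]
            · rw [indicator_of_notMem hy, nonpos_iff_eq_zero]
              convert measure_empty (μ := μ.restrict U)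
              ext x
              simp [hy]
        _ = _ := by rw [lintegral_indicator hU.measurableSet, setLIntegral_const]
    simp only [div_eq_mul_inv (G := ℝ≥0∞)]
    rw [lintegral_mul_const' _ _ (ENNReal.inv_ne_top.2 (hh0 k)), e1, mul_right_comm]
    exact mul_le_mul' e2 le_rfl
  calc μ U = ∫⁻ x in U, Filter.liminf
        (fun k : ℕ => ν (U ∩ ball x (1 / ((k : ℝ) + 1))) / h k) Filter.atTop ∂μ := by
        rw [setLIntegral_congr_fun hU.measurableSet hlim, setLIntegral_const, one_mul]
    _ ≤ Filter.liminf (fun k : ℕ => ∫⁻ x in U, ν (U ∩ ball x (1 / ((k : ℝ) + 1))) / h k ∂μ)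
        Filter.atTop := lintegral_liminf_le hmeas
    _ ≤ Filter.liminf (fun k => g k / h k * ν U) Filter.atTop :=
        Filter.liminf_le_liminf (Filter.Eventually.of_forall hfub)
    _ = _ := by rw [ENNReal.liminf_mul_const_of_ne_top (measure_ne_top _ _), mul_comm]

/-- Two uniformly distributed finite Borel measures are proportional. -/
theorem exists_eq_smul_of_measure_ball_eq (μ ν : Measure X) [IsFiniteMeasure μ]
    [IsFiniteMeasure ν] (hμ : μ ≠ 0) (hν : ν ≠ 0)
    (hμb : ∀ x y r, μ (ball x r) = μ (ball y r)) (hνb : ∀ x y r, ν (ball x r) = ν (ball y r)) :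
    ∃ c : ℝ≥0∞, c ≠ 0 ∧ c ≠ ∞ ∧ μ = c • ν := by
  rcases isEmpty_or_nonempty X with hX | ⟨⟨x₀⟩⟩
  · exact (hν (Subsingleton.elim _ _)).elim
  set g : ℕ → ℝ≥0∞ := fun k => μ (ball x₀ (1 / ((k : ℝ) + 1))) with hg
  set h : ℕ → ℝ≥0∞ := fun k => ν (ball x₀ (1 / ((k : ℝ) + 1))) with hh
  set a := Filter.liminf (fun k => g k / h k) Filter.atTop with ha
  have h1 : ∀ U, IsOpen U → μ U ≤ a * ν U := fun U hU =>
    measure_isOpen_le_liminf_ratio μ ν hν (fun k x => hμb x x₀ _) (fun k x => hνb x x₀ _) hU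
  have h2 : ∀ U, IsOpen U → ν U ≤ a⁻¹ * μ U := fun U hU => by
    refine (measure_isOpen_le_liminf_ratio ν μ hμ (fun k x => hνb x x₀ _)
      (fun k x => hμb x x₀ _) hU).trans (mul_le_mul' ?_ le_rfl)
    rw [ha, ENNReal.inv_liminf]
    have : (fun k => (g k / h k)⁻¹) = fun k => h k / g k := by
      funext k
      exact ENNReal.inv_div (Or.inl (measure_ne_top _ _)) (Or.inl
        (measure_ball_ne_zero_of_forall_eq hν (by positivity) fun x => hνb x x₀ _))
    rw [this]
    exact Filter.liminf_le_limsup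
  have ha0 : a ≠ 0 := fun h0 => hμ <| Measure.measure_univ_eq_zero.1 <| by
    simpa [h0] using h1 univ isOpen_univ
  have hat : a ≠ ∞ := fun h0 => hν <| Measure.measure_univ_eq_zero.1 <| by
    simpa [h0] using h2 univ isOpen_univ
  have h3 : ∀ U, IsOpen U → μ U = (a • ν) U := fun U hU => by
    refine le_antisymm (h1 U hU) ?_
    calc a * ν U ≤ a * (a⁻¹ * μ U) := mul_le_mul' le_rfl (h2 U hU)
      _ = μ U := by rw [← mul_assoc, ENNReal.mul_inv_cancel ha0 hat, one_mul]
  exact ⟨a, ha0, hat, ext_of_generate_finite _ BorelSpace.measurable_eq isPiSystem_isOpen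
    (fun U hU => h3 U hU) (h3 univ isOpen_univ)⟩

end UniformlyDistributed

section SphereMeasure

theorem norm_normalize_sub_le {E : Type*} [NormedAddCommGroup E] [NormedSpace ℝ E] {x y : E}
    (hx : 1 ≤ ‖x‖) (hy : y ≠ 0) : ‖‖x‖⁻¹ • x - ‖y‖⁻¹ • y‖ ≤ 2 * ‖x - y‖ := by
  have hx0 : 0 < ‖x‖ := by linarith
  have hy0 : 0 < ‖y‖ := norm_pos_iff.2 hy
  have e : ‖x‖⁻¹ • x - ‖y‖⁻¹ • y = ‖x‖⁻¹ • (x - y) + (‖x‖⁻¹ * ‖y‖⁻¹ * (‖y‖ - ‖x‖)) • y := by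
    rw [smul_sub, mul_sub, sub_smul]
    have e1 : ‖x‖⁻¹ * ‖y‖⁻¹ * ‖y‖ = ‖x‖⁻¹ := by field_simp
    have e2 : ‖x‖⁻¹ * ‖y‖⁻¹ * ‖x‖ = ‖y‖⁻¹ := by field_simp
    rw [e1, e2]
    abel
  have h1 : ‖x‖⁻¹ ≤ 1 := inv_le_one_of_one_le₀ hx
  have h2 : |‖y‖ - ‖x‖| ≤ ‖x - y‖ := by rw [abs_sub_comm]; exact abs_norm_sub_norm_le x y
  rw [e]
  refine (norm_add_le _ _).trans ?_
  rw [norm_smul, norm_smul, norm_mul, norm_mul, norm_inv, norm_inv, norm_norm, norm_norm,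
    Real.norm_eq_abs]
  calc ‖x‖⁻¹ * ‖x - y‖ + ‖x‖⁻¹ * ‖y‖⁻¹ * |‖y‖ - ‖x‖| * ‖y‖
      = ‖x‖⁻¹ * (‖x - y‖ + |‖y‖ - ‖x‖|) := by field_simp
    _ ≤ 1 * (‖x - y‖ + ‖x - y‖) := by gcongr
    _ = 2 * ‖x - y‖ := by ring

variable {m : ℕ}

theorem inner_hyperplaneMap (b : OrthonormalBasis (Fin (m + 1)) ℝ (Euc (m + 1))) (z : Euc m) :
    ⟪b 0, hyperplaneMap b z⟫ = 0 := by
  have : hyperplaneMap b z ∈ {x | ⟪x, b 0⟫ = 0} := range_hyperplaneMap b ▸ mem_range_self z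
  rw [real_inner_comm]
  exact this

theorem norm_hyperplaneMap (b : OrthonormalBasis (Fin (m + 1)) ℝ (Euc (m + 1))) (z : Euc m) :
    ‖hyperplaneMap b z‖ = ‖z‖ := by
  rw [hyperplaneMap, LinearIsometryEquiv.norm_map, EuclideanSpace.norm_eq, EuclideanSpace.norm_eq,
    Fin.sum_univ_succ]
  simp

theorem hausdorffMeasure_cap_lt_top (b : OrthonormalBasis (Fin (m + 1)) ℝ (Euc (m + 1))) :
    μH[(m : ℝ)] (sphere (0 : Euc (m + 1)) 1 ∩ {y | 1 / 2 < ⟪y, b 0⟫}) < ∞ := by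
  set Φ : Euc m → Euc (m + 1) := fun z =>
    ‖b 0 + hyperplaneMap b z‖⁻¹ • (b 0 + hyperplaneMap b z) with hΦ
  have hn : ∀ z, 1 ≤ ‖b 0 + hyperplaneMap b z‖ := fun z => by
    have h1 := norm_add_sq_eq_norm_sq_add_norm_sq_real (inner_hyperplaneMap b z)
    rw [b.norm_eq_one] at h1
    nlinarith [norm_nonneg (b 0 + hyperplaneMap b z), norm_nonneg (hyperplaneMap b z)]
  have hlip : LipschitzWith 2 Φ := by
    refine LipschitzWith.of_dist_le_mul fun x y => ?_
    rw [dist_eq_norm, ← (isometry_hyperplaneMap b).dist_eq, dist_eq_norm]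
    have := norm_normalize_sub_le (hn x)
      (norm_pos_iff.1 (zero_lt_one.trans_le (hn y)))
    rwa [add_sub_add_left_eq_sub] at this
  have hsub : sphere (0 : Euc (m + 1)) 1 ∩ {y | 1 / 2 < ⟪y, b 0⟫} ⊆ Φ '' closedBall 0 2 := by
    rintro y ⟨hy, hyb⟩
    rw [mem_sphere_zero_iff_norm] at hy
    rw [Set.mem_ofPred_eq] at hyb
    set t := ⟪y, b 0⟫ with ht
    have ht0 : 0 < t := by linarith
    have hw : t⁻¹ • y - b 0 ∈ range (hyperplaneMap b) := by
      rw [range_hyperplaneMap, Set.mem_ofPred_eq, inner_sub_left, inner_smul_left, ← ht,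
        real_inner_self_eq_norm_sq, b.norm_eq_one]
      simp [ht0.ne']
    obtain ⟨z, hz⟩ := hw
    have hz' : b 0 + hyperplaneMap b z = t⁻¹ • y := by rw [hz]; abel
    have hzn : ‖b 0 + hyperplaneMap b z‖ = t⁻¹ := by
      rw [hz', norm_smul, hy, Real.norm_eq_abs, abs_of_pos (by positivity), mul_one]
    refine ⟨z, ?_, ?_⟩
    · rw [mem_closedBall_zero_iff, ← norm_hyperplaneMap b]
      have h1 := norm_add_sq_eq_norm_sq_add_norm_sq_real (inner_hyperplaneMap b z)
      rw [hzn, b.norm_eq_one] at h1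
      have h2 : t⁻¹ ≤ 2 := by rw [inv_le_comm₀ ht0 two_pos]; linarith
      have h3 : 0 < t⁻¹ := by positivity
      nlinarith [norm_nonneg (hyperplaneMap b z)]
    · simp only [hΦ]
      rw [hzn, hz', inv_inv, smul_smul, mul_inv_cancel₀ ht0.ne', one_smul]
  refine (measure_mono hsub).trans_lt ?_
  refine (hlip.hausdorffMeasure_image_le (by positivity) _).trans_lt ?_
  refine ENNReal.mul_lt_top (by simp) ?_
  exact (isCompact_closedBall 0 2).measure_lt_top

theorem hausdorffMeasure_sphere_lt_top (m : ℕ) :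
    μH[(m : ℝ)] (sphere (0 : Euc (m + 1)) 1) < ∞ := by
  refine (isCompact_sphere 0 1).measure_lt_top_of_nhdsWithin fun x hx => ?_
  obtain ⟨b, hb⟩ := exists_orthonormalBasis_zero (mem_sphere_zero_iff_norm.1 hx)
  refine ⟨_, inter_mem_nhdsWithin _ ?_, hausdorffMeasure_cap_lt_top b⟩
  refine (isOpen_lt continuous_const (by fun_prop)).mem_nhds ?_
  rw [Set.mem_ofPred_eq, hb, real_inner_self_eq_norm_sq, mem_sphere_zero_iff_norm.1 hx]
  norm_num

theorem hausdorffMeasure_sphere_ne_zero (m : ℕ) :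
    μH[(m : ℝ)] (sphere (0 : Euc (m + 1)) 1) ≠ 0 := by
  set P : Euc (m + 1) → Euc m := fun y => WithLp.toLp 2 fun i => y i.succ with hP
  have hlip : LipschitzWith 1 P := by
    refine LipschitzWith.of_dist_le_mul fun x y => ?_
    rw [NNReal.coe_one, one_mul, EuclideanSpace.dist_eq, EuclideanSpace.dist_eq]
    refine Real.sqrt_le_sqrt ?_
    rw [Fin.sum_univ_succ (n := m)]
    simp only [hP]
    exact le_add_of_nonneg_left (by positivity)
  have hsub : ball (0 : Euc m) 1 ⊆ P '' sphere (0 : Euc (m + 1)) 1 := by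
    intro z hz
    rw [mem_ball_zero_iff] at hz
    refine ⟨WithLp.toLp 2 (Fin.cons √(1 - ‖z‖ ^ 2) z.ofLp : Fin (m + 1) → ℝ), ?_, ?_⟩
    · rw [mem_sphere_zero_iff_norm, EuclideanSpace.norm_eq, Fin.sum_univ_succ,
        Real.sqrt_eq_one]
      have h1 : 0 ≤ 1 - ‖z‖ ^ 2 := by nlinarith [norm_nonneg z]
      have h2 := EuclideanSpace.real_norm_sq_eq z
      simp only [Fin.cons_zero, Fin.cons_succ, Real.norm_eq_abs, sq_abs]
      rw [Real.sq_sqrt h1, h2]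
      ring
    · simp [hP]
  intro h0
  have h1 := (measure_mono hsub).trans (hlip.hausdorffMeasure_image_le (d := m) (by positivity) _)
  rw [h0, mul_zero, nonpos_iff_eq_zero] at h1
  exact (measure_ball_pos _ _ one_pos).ne' h1

/-- The linear isometries act transitively on the unit sphere. -/
theorem exists_linearIsometryEquiv_apply_eq {x y : Euc (m + 1)} (h : ‖x‖ = ‖y‖) :
    ∃ g : Euc (m + 1) ≃ₗᵢ[ℝ] Euc (m + 1), g x = y :=
  ⟨_, Submodule.reflection_sub h⟩

/-- On the sphere, normalized Hausdorff measure and the cone measure of Lebesgue measure are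
proportional. -/
theorem exists_hausdorffMeasure_eq_smul_toSphere (m : ℕ) : ∃ c : ℝ≥0∞, c ≠ 0 ∧ c ≠ ∞ ∧
    (μH[(m : ℝ)] : Measure (sphere (0 : Euc (m + 1)) 1)) =
      c • (volume : Measure (Euc (m + 1))).toSphere := by
  have hcoe : ∀ s : Set (sphere (0 : Euc (m + 1)) 1),
      μH[(m : ℝ)] s = μH[(m : ℝ)] (Subtype.val '' s) := fun s =>
    (isometry_subtype_coe.hausdorffMeasure_image (Or.inl (by positivity)) s).symm
  have huniv : μH[(m : ℝ)] (univ : Set (sphere (0 : Euc (m + 1)) 1)) =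
      μH[(m : ℝ)] (sphere (0 : Euc (m + 1)) 1) := by
    rw [hcoe, image_univ, Subtype.range_coe]
  have hball : ∀ (x y : sphere (0 : Euc (m + 1)) 1), ∃ g : Euc (m + 1) ≃ₗᵢ[ℝ] Euc (m + 1),
      ∀ r, (Subtype.val '' ball y r : Set (Euc (m + 1))) = g '' (Subtype.val '' ball x r) := by
    intro x y
    obtain ⟨g, hg⟩ := exists_linearIsometryEquiv_apply_eq (x := x.1) (y := y.1)
      (by rw [mem_sphere_zero_iff_norm.1 x.2, mem_sphere_zero_iff_norm.1 y.2])
    refine ⟨g, fun r => ?_⟩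
    have hb : ∀ x : sphere (0 : Euc (m + 1)) 1,
        (Subtype.val '' ball x r : Set (Euc (m + 1))) = ball x.1 r ∩ sphere 0 1 := by
      intro x
      rw [inter_comm, ← Subtype.image_preimage_coe]
      rfl
    rw [hb, hb, image_inter g.injective, g.image_ball, g.image_sphere, hg, map_zero]
  have : IsFiniteMeasure (μH[(m : ℝ)] : Measure (sphere (0 : Euc (m + 1)) 1)) :=
    ⟨by rw [huniv]; exact hausdorffMeasure_sphere_lt_top m⟩
  refine exists_eq_smul_of_measure_ball_eq _ _ ?_ ?_ ?_ ?_
  · intro h0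
    apply hausdorffMeasure_sphere_ne_zero m
    rw [← huniv, h0]
    rfl
  · exact Measure.toSphere_ne_zero _
  · intro x y r
    obtain ⟨g, hg⟩ := hball x y
    rw [hcoe, hcoe, hg, g.isometry.hausdorffMeasure_image (Or.inl (by positivity))]
  · intro x y r
    obtain ⟨g, hg⟩ := hball x y
    rw [Measure.toSphere_apply' _ measurableSet_ball, Measure.toSphere_apply' _ measurableSet_ball,
      hg]
    congr 1
    open Pointwise in
    have himg : (Ioo (0 : ℝ) 1 • g '' (Subtype.val '' ball x r) : Set (Euc (m + 1))) =
        g '' (Ioo (0 : ℝ) 1 • (Subtype.val '' ball x r)) :=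
      (image_image2_distrib_right fun a u => map_smul g a u).symm
    rw [himg, g.image_eq_preimage_symm, g.symm.measurePreserving.measure_preimage_emb
      g.symm.toHomeomorph.measurableEmbedding]

end SphereMeasure

section PolarComparison

variable {m : ℕ}

theorem hausdorffMeasure_le_of_Sdist_le {K L : Set (Euc (m + 1))} {t : ℝ}
    (h : Sdist (m + 1) K t ≤ Sdist (m + 1) L t) :
    μH[(m : ℝ)] ({θ | ENNReal.ofReal t ≤ sectionVol (m + 1) K θ} ∩ sphere 0 1) ≤
      μH[(m : ℝ)] ({θ | ENNReal.ofReal t ≤ sectionVol (m + 1) L θ} ∩ sphere 0 1) := by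
  have e : ((m + 1 : ℕ) : ℝ) - 1 = m := by push_cast; ring
  rw [Sdist, Sdist, sphHaar, sphHaar, e, div_eq_mul_inv, div_eq_mul_inv] at h
  exact (ENNReal.mul_le_mul_iff_left
    (ENNReal.inv_ne_zero.2 (hausdorffMeasure_sphere_lt_top m).ne)
    (ENNReal.inv_ne_top.2 (hausdorffMeasure_sphere_ne_zero m))).1 h

theorem volume_diff_zero_eq_lintegral {C : Set (Euc (m + 1))} (hC : MeasurableSet C) :
    volume ({0}ᶜ ∩ C) = ∫⁻ r, (volume : Measure (Euc (m + 1))).toSphere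
      {θ | (r : ℝ) • (θ : Euc (m + 1)) ∈ C}
        ∂(Measure.volumeIoiPow (Module.finrank ℝ (Euc (m + 1)) - 1)) := by
  have hT : MeasurableSet {p : sphere (0 : Euc (m + 1)) 1 × Ioi (0 : ℝ) |
      (p.2 : ℝ) • (p.1 : Euc (m + 1)) ∈ C} :=
    (by fun_prop : Measurable fun p : sphere (0 : Euc (m + 1)) 1 × Ioi (0 : ℝ) =>
      (p.2 : ℝ) • (p.1 : Euc (m + 1))) hC
  have h1 := ((volume : Measure (Euc (m + 1))).measurePreserving_homeomorphUnitSphereProd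
    ).measure_preimage hT.nullMeasurableSet
  rw [Measure.prod_apply_symm hT] at h1
  refine Eq.trans ?_ h1
  rw [comap_subtype_coe_apply (measurableSet_singleton _).compl, ← Subtype.image_preimage_coe]
  congr 2
  ext x
  have hx : ‖(x : Euc (m + 1))‖ ≠ 0 := norm_ne_zero_iff.2 x.2
  simp [smul_smul, hx]

/-- Comparison of the distribution functions of central sections, in polar coordinates. -/
theorem volume_le_of_Sdist_le {K L C D : Set (Euc (m + 1))} (hC : MeasurableSet C)
    (hD : MeasurableSet D)
    (hCK : ∀ x ∈ C, x ≠ 0 ∧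
      ENNReal.ofReal ‖x‖ * hausdorffScale m ≤ sectionVol (m + 1) K (‖x‖⁻¹ • x))
    (hDL : ∀ x, x ≠ 0 →
      ENNReal.ofReal ‖x‖ * hausdorffScale m ≤ sectionVol (m + 1) L (‖x‖⁻¹ • x) → x ∈ D)
    (hS : ∀ t : ℝ, 0 ≤ t → Sdist (m + 1) K t ≤ Sdist (m + 1) L t) :
    volume C ≤ volume D := by
  obtain ⟨c, hc0, hct, hc⟩ := exists_hausdorffMeasure_eq_smul_toSphere m
  have hCe : C = {0}ᶜ ∩ C := (inter_eq_right.2 fun x hx => (hCK x hx).1).symm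
  refine le_trans ?_ (measure_mono (inter_subset_right (s := {0}ᶜ) (t := D)))
  rw [hCe, volume_diff_zero_eq_lintegral hC, volume_diff_zero_eq_lintegral hD]
  refine lintegral_mono fun r => ?_
  have hr : (0 : ℝ) < r := r.2
  have key : ∀ A : Set (sphere (0 : Euc (m + 1)) 1),
      c * (volume : Measure (Euc (m + 1))).toSphere A = μH[(m : ℝ)] (Subtype.val '' A) := by
    intro A
    rw [isometry_subtype_coe.hausdorffMeasure_image (Or.inl (by positivity)), hc]
    rfl
  refine (ENNReal.mul_le_mul_iff_right hc0 hct).1 ?_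
  rw [key, key]
  have ht : ENNReal.ofReal (r * hausdorffScale m) = ENNReal.ofReal r * hausdorffScale m := by
    rw [ENNReal.ofReal_mul hr.le, ENNReal.ofReal_coe_nnreal]
  have hnorm : ∀ θ : sphere (0 : Euc (m + 1)) 1, ‖(r : ℝ) • (θ : Euc (m + 1))‖ = r := fun θ => by
    rw [norm_smul, mem_sphere_zero_iff_norm.1 θ.2, Real.norm_eq_abs, abs_of_pos hr, mul_one]
  refine le_trans (measure_mono ?_) ((hausdorffMeasure_le_of_Sdist_le
    (hS (r * hausdorffScale m) (by positivity))).trans (measure_mono ?_))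
  · rintro _ ⟨θ, hθ, rfl⟩
    refine ⟨?_, θ.2⟩
    have := (hCK _ hθ).2
    rwa [hnorm, inv_smul_smul₀ hr.ne', ← ht] at this
  · rintro θ ⟨hθ, hθ1⟩
    refine ⟨⟨θ, hθ1⟩, hDL _ ?_ ?_, rfl⟩
    · rw [← norm_ne_zero_iff, hnorm ⟨θ, hθ1⟩]
      exact hr.ne'
    · rw [hnorm ⟨θ, hθ1⟩, inv_smul_smul₀ hr.ne', ← ht]
      exact hθ

end PolarComparison

section MomentBounds

variable {n : ℕ}

theorem setLIntegral_ball_inner_sq_eq {v w : Euc n} (h : ‖v‖ = ‖w‖) (ρ : ℝ) :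
    ∫⁻ z in ball (0 : Euc n) ρ, ENNReal.ofReal (⟪v, z⟫ ^ 2) =
      ∫⁻ z in ball (0 : Euc n) ρ, ENNReal.ofReal (⟪w, z⟫ ^ 2) := by
  obtain ⟨g, hg⟩ : ∃ g : Euc n ≃ₗᵢ[ℝ] Euc n, g v = w := ⟨_, Submodule.reflection_sub h⟩
  have : g ⁻¹' ball 0 ρ = ball 0 ρ := by
    ext z
    simp
  have h2 := g.measurePreserving.setLIntegral_comp_preimage (measurableSet_ball (x := 0) (ε := ρ))
    (f := fun z => ENNReal.ofReal (⟪w, z⟫ ^ 2)) (by fun_prop)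
  rw [← h2, this, ← hg]
  simp only [LinearIsometryEquiv.inner_map_map]

theorem mul_setLIntegral_ball_inner_sq_le (w : Euc n) (ρ : ℝ) :
    n * ∫⁻ z in ball (0 : Euc n) ρ, ENNReal.ofReal (⟪w, z⟫ ^ 2) ≤
      ENNReal.ofReal (‖w‖ ^ 2) * (ENNReal.ofReal (ρ ^ 2) * volume (ball (0 : Euc n) ρ)) := by
  set e := EuclideanSpace.basisFun (Fin n) ℝ with he
  have h1 : ∀ i, ∫⁻ z in ball (0 : Euc n) ρ, ENNReal.ofReal (⟪w, z⟫ ^ 2) =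
      ENNReal.ofReal (‖w‖ ^ 2) * ∫⁻ z in ball (0 : Euc n) ρ, ENNReal.ofReal (⟪e i, z⟫ ^ 2) := by
    intro i
    rw [setLIntegral_ball_inner_sq_eq (v := w) (w := ‖w‖ • e i)
      (by rw [norm_smul, e.norm_eq_one, norm_norm, mul_one]),
      ← lintegral_const_mul _ (by fun_prop)]
    refine lintegral_congr fun z => ?_
    rw [← ENNReal.ofReal_mul (by positivity), inner_smul_left, mul_pow]
    rfl
  have h2 : (n : ℝ≥0∞) * ∫⁻ z in ball (0 : Euc n) ρ, ENNReal.ofReal (⟪w, z⟫ ^ 2) =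
      ∑ i : Fin n, ENNReal.ofReal (‖w‖ ^ 2) *
        ∫⁻ z in ball (0 : Euc n) ρ, ENNReal.ofReal (⟪e i, z⟫ ^ 2) := by
    rw [Finset.sum_congr rfl fun i _ => (h1 i).symm]
    simp
  rw [h2, ← Finset.mul_sum, ← lintegral_finsetSum _ (fun i _ => by fun_prop)]
  refine mul_le_mul' le_rfl ?_
  rw [← setLIntegral_const]
  refine setLIntegral_mono measurable_const fun z hz => ?_
  rw [← ENNReal.ofReal_sum_of_nonneg (fun i _ => by positivity)]
  refine ENNReal.ofReal_le_ofReal ?_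
  have h3 := e.sum_sq_norm_inner_right z
  simp only [Real.norm_eq_abs, sq_abs] at h3
  rw [h3]
  rw [mem_ball_zero_iff] at hz
  gcongr

theorem setLIntegral_le_of_slab {K : Set (Euc n)} {a : ℝ} (ha : 0 < a)
    (hvol : volume K = ENNReal.ofReal a) {x : Euc n}
    (hx : volume (K ∩ {y | |⟪y, x⟫| ≤ a / 4}) < ENNReal.ofReal (2 * (a / 4))) :
    ENNReal.ofReal (a ^ 3 / 32) ≤ ∫⁻ y in K, ENNReal.ofReal (⟪y, x⟫ ^ 2) := by
  have hm : MeasurableSet {y : Euc n | |⟪y, x⟫| ≤ a / 4} :=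
    measurableSet_le (by fun_prop) measurable_const
  have h1 : ENNReal.ofReal (2 * (a / 4)) ≤ volume (K \ {y | |⟪y, x⟫| ≤ a / 4}) := by
    have h2 := measure_inter_add_sdiff K hm (μ := volume)
    by_contra! hcon
    have h3 := ENNReal.add_lt_add hx hcon
    rw [h2, hvol, ← ENNReal.ofReal_add (by positivity) (by positivity)] at h3
    refine h3.ne ?_
    ring_nf
  calc ENNReal.ofReal (a ^ 3 / 32)
      = ENNReal.ofReal ((a / 4) ^ 2) * ENNReal.ofReal (2 * (a / 4)) := by
        rw [← ENNReal.ofReal_mul (by positivity)]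
        ring_nf
    _ ≤ ENNReal.ofReal ((a / 4) ^ 2) * volume (K \ {y | |⟪y, x⟫| ≤ a / 4}) := mul_le_mul' le_rfl h1
    _ = ∫⁻ y in K \ {y | |⟪y, x⟫| ≤ a / 4}, ENNReal.ofReal ((a / 4) ^ 2) :=
        (setLIntegral_const _ _).symm
    _ ≤ ∫⁻ y in K \ {y | |⟪y, x⟫| ≤ a / 4}, ENNReal.ofReal (⟪y, x⟫ ^ 2) := by
        refine setLIntegral_mono (by fun_prop) fun y hy => ENNReal.ofReal_le_ofReal ?_
        have hy2 : a / 4 < |⟪y, x⟫| := not_le.1 hy.2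
        rw [← sq_abs ⟪y, x⟫]
        gcongr
    _ ≤ ∫⁻ y in K, ENNReal.ofReal (⟪y, x⟫ ^ 2) := lintegral_mono_set sdiff_subset

/-- The directions `x` for which the slab `{|⟪y, x⟫| ≤ a / 4}` contains volume at least `a / 2`
of `K`. -/
def slabSet (K : Set (Euc n)) (a : ℝ) : Set (Euc n) :=
  {x | x ≠ 0 ∧ ENNReal.ofReal (2 * (a / 4)) ≤ volume (K ∩ {y | |⟪y, x⟫| ≤ a / 4})}

theorem measurableSet_slabSet {K : Set (Euc n)} (hK : MeasurableSet K) (a : ℝ) :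
    MeasurableSet (slabSet K a) := by
  have hD : MeasurableSet {p : Euc n × Euc n | p.2 ∈ K ∧ |⟪p.2, p.1⟫| ≤ a / 4} :=
    (measurable_snd hK).inter (measurableSet_le
      (by fun_prop : Measurable fun p : Euc n × Euc n => |⟪p.2, p.1⟫|) measurable_const)
  exact (measurableSet_singleton _).compl.inter
    (measurableSet_le measurable_const (measurable_measure_prodMk_left hD))

theorem volume_image_eq_of_abs_det_eq_one {T : Euc n →ₗ[ℝ] Euc n} (hT : |LinearMap.det T| = 1)
    (s : Set (Euc n)) : volume (T '' s) = volume s := by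
  rw [Measure.addHaar_image_linearMap, hT]
  simp

theorem abs_det_adjoint (T : Euc n →ₗ[ℝ] Euc n) :
    |LinearMap.det (LinearMap.adjoint T)| = |LinearMap.det T| := by
  set e := EuclideanSpace.basisFun (Fin n) ℝ
  rw [← LinearMap.det_toMatrix e.toBasis, ← LinearMap.det_toMatrix e.toBasis,
    LinearMap.toMatrix_adjoint, Matrix.det_conjTranspose, star_trivial]

theorem volume_ball_le_two_mul_volume_slabSet {K : Set (Euc n)} (hK : MeasurableSet K) {a : ℝ}
    (ha : 0 < a) (hvol : volume K = ENNReal.ofReal a) (hn : 0 < n) (T : Euc n ≃ₗ[ℝ] Euc n)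
    (hT : |LinearMap.det (T : Euc n →ₗ[ℝ] Euc n)| = 1) {ρ : ℝ} (hρ : 0 < ρ)
    (h : ENNReal.ofReal (64 * ρ ^ 2) * (∫⁻ y in K, ENNReal.ofReal (‖T y‖ ^ 2)) ≤
      ENNReal.ofReal (n * a ^ 3)) :
    volume (ball (0 : Euc n) ρ) ≤ 2 * volume (slabSet K a) := by
  set S : Euc n →ₗ[ℝ] Euc n := LinearMap.adjoint (T : Euc n →ₗ[ℝ] Euc n) with hS
  have hSdet : |LinearMap.det S| = 1 := by
    rw [hS, abs_det_adjoint, hT]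
  have hSm : Measurable S := S.continuous_of_finiteDimensional.measurable
  have hTm : Measurable T := T.toLinearMap.continuous_of_finiteDimensional.measurable
  set V := volume (ball (0 : Euc n) ρ) with hV
  have hVt : V ≠ ∞ := measure_ball_lt_top.ne
  have hin : ∀ y z, ⟪y, S z⟫ = ⟪T y, z⟫ := fun y z => LinearMap.adjoint_inner_right _ _ _
  have hpre : volume (S ⁻¹' slabSet K a) ≤ volume (slabSet K a) := by
    rw [← volume_image_eq_of_abs_det_eq_one hSdet]
    exact measure_mono (image_preimage_subset _ _)
  refine le_trans ?_ (mul_le_mul' le_rfl hpre)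
  have hmS : MeasurableSet (S ⁻¹' slabSet K a) := hSm (measurableSet_slabSet hK a)
  have hfub : (n : ℝ≥0∞) * ∫⁻ z in ball (0 : Euc n) ρ, ∫⁻ y in K, ENNReal.ofReal (⟪y, S z⟫ ^ 2) ≤
      (∫⁻ y in K, ENNReal.ofReal (‖T y‖ ^ 2)) * (ENNReal.ofReal (ρ ^ 2) * V) := by
    rw [lintegral_lintegral_swap (by fun_prop), ← lintegral_const_mul' _ _ (by simp),
      ← lintegral_mul_const' _ _ (ENNReal.mul_ne_top ENNReal.ofReal_ne_top hVt)]
    refine lintegral_mono fun y => ?_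
    simp only [hin]
    exact mul_setLIntegral_ball_inner_sq_le (T y) ρ
  have hlow : ENNReal.ofReal (a ^ 3 / 32) * volume (ball (0 : Euc n) ρ \ S ⁻¹' slabSet K a) ≤
      ∫⁻ z in ball (0 : Euc n) ρ, ∫⁻ y in K, ENNReal.ofReal (⟪y, S z⟫ ^ 2) := by
    have h0 : volume (ball (0 : Euc n) ρ \ S ⁻¹' slabSet K a) =
        volume ((ball (0 : Euc n) ρ \ S ⁻¹' slabSet K a) \ {0}) := by
      have : Nonempty (Fin n) := ⟨⟨0, hn⟩⟩
      exact (measure_sdiff_null (measure_singleton 0)).symm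
    rw [h0, ← setLIntegral_const]
    refine le_trans (setLIntegral_mono' ((measurableSet_ball.diff hmS).diff
      (measurableSet_singleton 0)) ?_)
      (lintegral_mono_set (sdiff_subset.trans sdiff_subset))
    rintro z ⟨⟨-, hz⟩, hz0⟩
    refine setLIntegral_le_of_slab ha hvol ?_
    by_contra! hcon
    refine hz ⟨?_, hcon⟩
    intro hSz
    refine hz0 (inner_self_eq_zero (𝕜 := ℝ).1 ?_)
    have h3 := hin (T.symm z) z
    rwa [hSz, inner_zero_right, T.apply_symm_apply, eq_comm] at h3
  have hhalf : 2 * volume (ball (0 : Euc n) ρ \ S ⁻¹' slabSet K a) ≤ V := by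
    have h1 : ENNReal.ofReal (64 * ρ ^ 2) * (n * (ENNReal.ofReal (a ^ 3 / 32) *
        volume (ball (0 : Euc n) ρ \ S ⁻¹' slabSet K a))) ≤
        ENNReal.ofReal (n * a ^ 3) * (ENNReal.ofReal (ρ ^ 2) * V) :=
      calc _ ≤ ENNReal.ofReal (64 * ρ ^ 2) *
            ((∫⁻ y in K, ENNReal.ofReal (‖T y‖ ^ 2)) * (ENNReal.ofReal (ρ ^ 2) * V)) :=
            mul_le_mul' le_rfl ((mul_le_mul' le_rfl hlow).trans hfub)
        _ ≤ _ := by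
          rw [← mul_assoc]
          exact mul_le_mul' h le_rfl
    have hc0 : ENNReal.ofReal (n * a ^ 3 * ρ ^ 2) ≠ 0 := by
      have : (0 : ℝ) < n := by exact_mod_cast hn
      simp only [ne_eq, ENNReal.ofReal_eq_zero, not_le]
      positivity
    refine (ENNReal.mul_le_mul_iff_right hc0 ENNReal.ofReal_ne_top).1 ?_
    have h5 : ENNReal.ofReal (n * a ^ 3 * ρ ^ 2) * 2 =
        ENNReal.ofReal (64 * ρ ^ 2) * n * ENNReal.ofReal (a ^ 3 / 32) := by
      rw [← ENNReal.ofReal_natCast n, ← ENNReal.ofReal_ofNat 2,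
        ← ENNReal.ofReal_mul (by positivity),
        ← ENNReal.ofReal_mul (by positivity), ← ENNReal.ofReal_mul (by positivity)]
      ring_nf
    convert h1 using 1
    · rw [← mul_assoc, h5, ← mul_assoc, ← mul_assoc]
    · rw [← mul_assoc, ← ENNReal.ofReal_mul (by positivity)]
  have hsum : V ≤ volume (ball (0 : Euc n) ρ \ S ⁻¹' slabSet K a) +
      volume (S ⁻¹' slabSet K a) := by
    rw [hV]
    refine (measure_mono ?_).trans (measure_union_le _ _)
    intro z hz
    by_cases h' : z ∈ S ⁻¹' slabSet K a
    · exact Or.inr h'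
    · exact Or.inl ⟨hz, h'⟩
  have h2 : V + V ≤ V + 2 * volume (S ⁻¹' slabSet K a) := by
    calc V + V = 2 * V := (two_mul V).symm
      _ ≤ 2 * (volume (ball (0 : Euc n) ρ \ S ⁻¹' slabSet K a) +
          volume (S ⁻¹' slabSet K a)) := mul_le_mul' le_rfl hsum
      _ ≤ _ := by
        rw [mul_add]
        exact add_le_add hhalf le_rfl
  exact (ENNReal.add_le_add_iff_left hVt).1 h2

end MomentBounds

section MomentEllipsoid

variable {n : ℕ}

open Matrix in
open scoped MatrixOrder Matrix.Norms.L2Operator in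
theorem exists_forall_dotProduct_mulVec_eq {M : Matrix (Fin n) (Fin n) ℝ} (hM : M.PosSemidef) :
    ∃ A : Euc n →ₗ[ℝ] Euc n, ∀ x : Euc n, x.ofLp ⬝ᵥ M *ᵥ x.ofLp = ‖A x‖ ^ 2 := by
  obtain ⟨B, rfl⟩ := CStarAlgebra.nonneg_iff_eq_star_mul_self.mp hM.nonneg
  refine ⟨Matrix.toEuclideanLin B, fun x => ?_⟩
  rw [← real_inner_self_eq_norm_sq, EuclideanSpace.inner_eq_star_dotProduct]
  rw [← Matrix.mulVec_mulVec, Matrix.dotProduct_mulVec, Matrix.star_eq_conjTranspose,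
    Matrix.vecMul_conjTranspose]
  simp [Matrix.toEuclideanLin]

theorem integral_inner_sq_pos {K : Set (Euc n)} (hK : IsCompact K) (hi : (interior K).Nonempty)
    {x : Euc n} (hx : x ≠ 0) : 0 < ∫ y in K, ⟪y, x⟫ ^ 2 := by
  have hfi : IntegrableOn (fun y => ⟪y, x⟫ ^ 2) K :=
    ContinuousOn.integrableOn_compact hK (by fun_prop)
  have hcont : Continuous fun y => ⟪y, x⟫ ^ 2 := by fun_prop
  refine lt_of_le_of_ne (integral_nonneg fun y => sq_nonneg _) fun h0 => ?_
  have h1 := (integral_eq_zero_iff_of_nonneg (fun y => sq_nonneg _) hfi).1 h0.symm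
  have h2 := Measure.eqOn_open_of_ae_eq (ae_restrict_of_ae_restrict_of_subset interior_subset h1)
    isOpen_interior hcont.continuousOn continuousOn_const
  obtain ⟨p, hp⟩ := hi
  have h3 : ∀ᶠ t in nhds (0 : ℝ), p + t • x ∈ interior K := by
    have hc : ContinuousAt (fun t : ℝ => p + t • x) 0 := by fun_prop
    exact hc (by simpa using isOpen_interior.mem_nhds hp)
  have h4 : ∀ᶠ t in nhdsWithin (0 : ℝ) {0}ᶜ, p + t • x ∈ interior K :=
    h3.filter_mono nhdsWithin_le_nhds
  obtain ⟨t, ht, ht0⟩ := (h4.and self_mem_nhdsWithin).exists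
  have e1 := h2 ht
  have e2 := h2 hp
  simp only [Pi.zero_apply, sq_eq_zero_iff, inner_add_left, inner_smul_left] at e1 e2
  rw [e2, zero_add] at e1
  rcases mul_eq_zero.1 e1 with h | h
  · exact ht0 h
  · exact hx (inner_self_eq_zero.1 h)

theorem exists_linearEquiv_integral_inner_sq_eq {K : Set (Euc n)} (hK : IsCompact K)
    (hi : (interior K).Nonempty) :
    ∃ A : Euc n ≃ₗ[ℝ] Euc n, ∀ x, ∫ y in K, ⟪y, x⟫ ^ 2 = ‖A x‖ ^ 2 := by
  set M : Matrix (Fin n) (Fin n) ℝ := Matrix.of fun i j => ∫ y in K, y i * y j with hM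
  have hMx : ∀ x : Fin n → ℝ, x ⬝ᵥ M.mulVec x = ∫ y in K, ⟪y, WithLp.toLp 2 x⟫ ^ 2 := by
    intro x
    have hfi : ∀ i j, IntegrableOn (fun y : Euc n => x i * (y i * y j * x j)) K := fun i j =>
      ContinuousOn.integrableOn_compact hK (by fun_prop)
    simp only [dotProduct, Matrix.mulVec, hM, Matrix.of_apply, Finset.mul_sum]
    simp only [← integral_mul_const, ← integral_const_mul]
    rw [Finset.sum_congr rfl fun i _ => (integral_finsetSum _ fun j _ => hfi i j).symm,
      ← integral_finsetSum _ fun i _ => integrable_finsetSum _ fun j _ => hfi i j]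
    refine integral_congr_ae (Filter.Eventually.of_forall fun y => ?_)
    simp only [PiLp.inner_apply, sq, Finset.sum_mul_sum]
    refine Finset.sum_congr rfl fun i _ => Finset.sum_congr rfl fun j _ => ?_
    simp
    ring
  have hps : M.PosSemidef := by
    refine Matrix.PosSemidef.of_dotProduct_mulVec_nonneg ?_ fun x => ?_
    · ext i j
      simp [hM, mul_comm]
    · rw [star_trivial, hMx]
      exact integral_nonneg fun y => sq_nonneg _
  obtain ⟨A, hA⟩ := exists_forall_dotProduct_mulVec_eq hps
  have hA' : ∀ x, ∫ y in K, ⟪y, x⟫ ^ 2 = ‖A x‖ ^ 2 := fun x => by rw [← hA, hMx]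
  have hinj : Function.Injective A := by
    rw [← LinearMap.ker_eq_bot, LinearMap.ker_eq_bot']
    intro x hx
    by_contra hx0
    have := integral_inner_sq_pos hK hi hx0
    rw [hA', hx] at this
    simp at this
  exact ⟨LinearEquiv.ofInjectiveEndo A hinj, hA'⟩

/-- The image of `K` under `G = (A⁻¹)ᵀ` is in isotropic position. -/
theorem integral_inner_adjoint_symm_sq {K : Set (Euc n)} {A : Euc n ≃ₗ[ℝ] Euc n}
    (hA : ∀ x, ∫ y in K, ⟪y, x⟫ ^ 2 = ‖A x‖ ^ 2) (x : Euc n) :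
    ∫ y in K, ⟪LinearMap.adjoint (A.symm : Euc n →ₗ[ℝ] Euc n) y, x⟫ ^ 2 = ‖x‖ ^ 2 := by
  have h := hA (A.symm x)
  rw [A.apply_symm_apply] at h
  rw [← h]
  simp only [LinearMap.adjoint_inner_left, LinearEquiv.coe_coe]

theorem integral_norm_sq_eq_of_isotropic {K : Set (Euc n)} (hK : IsCompact K)
    {G : Euc n →ₗ[ℝ] Euc n} (hG : ∀ x, ∫ y in K, ⟪G y, x⟫ ^ 2 = ‖x‖ ^ 2) :
    ∫ y in K, ‖G y‖ ^ 2 = n := by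
  set e := EuclideanSpace.basisFun (Fin n) ℝ
  have hGc : Continuous G := G.continuous_of_finiteDimensional
  have h1 : ∀ y, ‖G y‖ ^ 2 = ∑ i, ⟪G y, e i⟫ ^ 2 := fun y => by
    rw [← e.sum_sq_norm_inner_left]
    simp
  simp only [h1]
  rw [integral_finsetSum _ fun i _ => ContinuousOn.integrableOn_compact hK (by fun_prop)]
  simp [hG]

end MomentEllipsoid

section IsotropicPosition

variable {n : ℕ}

theorem integral_comp_linearEquiv (G : Euc n ≃ₗ[ℝ] Euc n) (f : Euc n → ℝ) :
    ∫ y, f (G y) = |LinearMap.det (G : Euc n →ₗ[ℝ] Euc n)|⁻¹ * ∫ z, f z := by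
  have h1 := integral_map_equiv G.toContinuousLinearEquiv.toHomeomorph.toMeasurableEquiv
    (μ := volume) f
  have h2 := Measure.map_linearMap_addHaar_eq_smul_addHaar (volume : Measure (Euc n))
    (G.isUnit_det'.ne_zero)
  change ∫ y, f y ∂Measure.map (G : Euc n →ₗ[ℝ] Euc n) volume = ∫ y, f (G y) at h1
  rw [← h1, h2, integral_smul_measure, ENNReal.toReal_ofReal (abs_nonneg _), abs_inv, smul_eq_mul]

theorem setIntegral_image_of_abs_det_eq_one (T : Euc n ≃ₗ[ℝ] Euc n)
    (hT : |LinearMap.det (T : Euc n →ₗ[ℝ] Euc n)| = 1) (K : Set (Euc n)) (f : Euc n → ℝ) :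
    ∫ x in T '' K, f x = ∫ y in K, f (T y) := by
  have h2 := Measure.map_linearMap_addHaar_eq_smul_addHaar (volume : Measure (Euc n))
    (T.isUnit_det'.ne_zero)
  rw [abs_inv, hT, inv_one, ENNReal.ofReal_one, one_smul] at h2
  have he := T.toContinuousLinearEquiv.toHomeomorph.measurableEmbedding
  exact MeasurePreserving.setIntegral_image_emb (f := T) ⟨he.measurable, h2⟩ he f K

theorem sq_volume_mul_abs_det_le {K : Set (Euc n)} (hK : IsCompact K)
    (G : Euc n ≃ₗ[ℝ] Euc n) (h : ∫ y in K, ‖G y‖ ^ 2 = n) {b : ℝ} (hb : 0 < b)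
    (hvol : volume K = ENNReal.ofReal b) :
    (b * |LinearMap.det (G : Euc n →ₗ[ℝ] Euc n)|) ^ 2 * b ^ n ≤ 25 ^ n := by
  set g := |LinearMap.det (G : Euc n →ₗ[ℝ] Euc n)| with hg
  have hg0 : 0 < g := abs_pos.2 G.isUnit_det'.ne_zero
  have hGc : Continuous G := G.toLinearMap.continuous_of_finiteDimensional
  have hP : 0 < (Real.pi / (b / 2)) ^ ((n : ℝ) / 2) := by positivity
  have h1 : ∫ y, Real.exp (-(b / 2) * ‖G y‖ ^ 2) =
      g⁻¹ * (Real.pi / (b / 2)) ^ ((n : ℝ) / 2) := by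
    rw [integral_comp_linearEquiv G fun z => Real.exp (-(b / 2) * ‖z‖ ^ 2),
      GaussianFourier.integral_rexp_neg_mul_sq_norm (by positivity)]
    simp [hg]
  have hfi : Integrable fun y => Real.exp (-(b / 2) * ‖G y‖ ^ 2) := by
    by_contra hcon
    rw [integral_undef hcon] at h1
    exact (mul_pos (inv_pos.2 hg0) hP).ne h1
  have h2 : ∫ y in K, Real.exp (-(b / 2) * ‖G y‖ ^ 2) ≤
      g⁻¹ * (Real.pi / (b / 2)) ^ ((n : ℝ) / 2) := by
    rw [← h1]
    exact setIntegral_le_integral hfi (Filter.Eventually.of_forall fun y => (Real.exp_pos _).le)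
  have hi2 : IntegrableOn (fun y => ‖G y‖ ^ 2) K :=
    ContinuousOn.integrableOn_compact hK (by fun_prop)
  have hc : ∀ c : ℝ, IntegrableOn (fun _ : Euc n => c) K := fun c =>
    ContinuousOn.integrableOn_compact hK continuousOn_const
  have h3 : ∫ y in K, Real.exp (-(n / 2)) * ((1 + n / 2) - (b / 2) * ‖G y‖ ^ 2) ≤
      ∫ y in K, Real.exp (-(b / 2) * ‖G y‖ ^ 2) := by
    refine setIntegral_mono (((hc _).sub (hi2.const_mul _)).const_mul _) hfi.integrableOn
      fun y => ?_
    have h4 : -(b / 2) * ‖G y‖ ^ 2 = -(n / 2) + (n / 2 - (b / 2) * ‖G y‖ ^ 2) := by ring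
    simp only
    rw [h4, Real.exp_add]
    refine mul_le_mul_of_nonneg_left ?_ (Real.exp_pos _).le
    have := Real.add_one_le_exp (n / 2 - (b / 2) * ‖G y‖ ^ 2)
    linarith
  have h5 : ∫ y in K, Real.exp (-(n / 2)) * ((1 + n / 2) - (b / 2) * ‖G y‖ ^ 2) =
      Real.exp (-(n / 2)) * b := by
    rw [integral_const_mul, integral_sub (hc _) (hi2.const_mul _), integral_const_mul, h,
      setIntegral_const, measureReal_def, hvol, ENNReal.toReal_ofReal hb.le, smul_eq_mul]
    ring
  rw [h5] at h3
  have h6 : Real.exp (-(n / 2)) * (b * g) ≤ (Real.pi / (b / 2)) ^ ((n : ℝ) / 2) := by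
    have := mul_le_mul_of_nonneg_left (h3.trans h2) hg0.le
    rw [mul_inv_cancel_left₀ hg0.ne'] at this
    linarith
  have h7 : (Real.exp (-(n / 2)) * (b * g)) ^ 2 ≤ (Real.pi / (b / 2)) ^ n := by
    have h8 : ((Real.pi / (b / 2)) ^ ((n : ℝ) / 2)) ^ 2 = (Real.pi / (b / 2)) ^ n := by
      rw [← Real.rpow_natCast, ← Real.rpow_mul (by positivity), ← Real.rpow_natCast]
      congr 1
      push_cast
      ring
    rw [← h8]
    gcongr
  have h9 : Real.exp (-(n / 2)) ^ 2 = (Real.exp 1 ^ n)⁻¹ := by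
    rw [← Real.exp_nat_mul, ← Real.exp_nat_mul, ← Real.exp_neg]
    congr 1
    push_cast
    ring
  rw [mul_pow, h9, inv_mul_le_iff₀ (by positivity)] at h7
  calc (b * g) ^ 2 * b ^ n ≤ Real.exp 1 ^ n * (Real.pi / (b / 2)) ^ n * b ^ n := by gcongr
    _ = (Real.exp 1 * (2 * Real.pi)) ^ n := by
      rw [← mul_pow, ← mul_pow]
      congr 1
      field_simp
    _ ≤ 25 ^ n := by
      have he := Real.exp_one_lt_d9
      have hp := Real.pi_lt_d2
      have hp0 := Real.pi_pos
      gcongr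
      nlinarith [Real.exp_pos 1]

/-- A symmetric convex body whose pushforward under `G` is isotropic contains, after applying `G`,
a ball whose radius depends only on its volume. -/
theorem ball_subset_image_of_isotropic {K : Set (Euc n)} (hK : IsCompact K) (hc : Convex ℝ K)
    (hs : K = -K) {G : Euc n →ₗ[ℝ] Euc n} (hG : ∀ x, ∫ y in K, ⟪G y, x⟫ ^ 2 = ‖x‖ ^ 2) {a : ℝ}
    (ha : 0 < a) (hvol : volume K = ENNReal.ofReal a) :
    ball 0 (√a)⁻¹ ⊆ G '' K := by
  have hGc : Continuous G := G.continuous_of_finiteDimensional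
  intro x hx
  by_contra hcon
  obtain ⟨f, u, hf, hu⟩ := geometric_hahn_banach_closed_point (hc.linear_image G)
    (hK.image hGc).isClosed hcon
  set v := (InnerProductSpace.toDual ℝ (Euc n)).symm f with hv
  have hfv : ∀ z, f z = ⟪z, v⟫ := fun z => by
    rw [real_inner_comm, hv, InnerProductSpace.toDual_symm_apply]
  have hneg : ∀ y ∈ K, -y ∈ K := fun y hy => by
    rw [hs] at hy
    exact hy
  have habs : ∀ y ∈ K, |⟪G y, v⟫| ≤ u := fun y hy => by
    rw [abs_le']
    refine ⟨(hfv _ ▸ hf _ ⟨y, hy, rfl⟩).le, ?_⟩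
    have := hf _ ⟨-y, hneg y hy, rfl⟩
    rw [hfv, map_neg, inner_neg_left] at this
    exact this.le
  have hu0 : 0 ≤ u := by
    by_contra! h
    have hKe : K = ∅ := by
      refine eq_empty_of_forall_notMem fun y hy => ?_
      exact absurd ((abs_nonneg _).trans (habs y hy)) (not_le.2 h)
    rw [hKe, measure_empty] at hvol
    exact (ENNReal.ofReal_pos.2 ha).ne hvol
  have h1 : ‖v‖ ^ 2 ≤ u ^ 2 * a := by
    rw [← hG v]
    have hi : IntegrableOn (fun y => ⟪G y, v⟫ ^ 2) K :=
      ContinuousOn.integrableOn_compact hK (by fun_prop)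
    have hi2 : IntegrableOn (fun _ : Euc n => u ^ 2) K :=
      ContinuousOn.integrableOn_compact hK continuousOn_const
    refine (setIntegral_mono_on hi hi2 hK.measurableSet fun y hy => ?_).trans (le_of_eq ?_)
    · rw [← sq_abs ⟪G y, v⟫]
      have := habs y hy
      gcongr
    · rw [setIntegral_const, measureReal_def, hvol, ENNReal.toReal_ofReal ha.le, smul_eq_mul,
        mul_comm]
  have h2 : ‖v‖ ≤ u * √a := by
    refine le_of_sq_le_sq ?_ (by positivity)
    rwa [mul_pow, Real.sq_sqrt ha.le]
  rw [hfv] at hu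
  have h3 : ⟪x, v⟫ ≤ ‖x‖ * ‖v‖ := real_inner_le_norm x v
  rw [mem_ball_zero_iff] at hx
  have h4 : ‖x‖ * √a < 1 := by
    have ha' : 0 < √a := by positivity
    calc ‖x‖ * √a < (√a)⁻¹ * √a := by gcongr
      _ = 1 := inv_mul_cancel₀ ha'.ne'
  nlinarith [norm_nonneg x, norm_nonneg v]

theorem ofReal_le_volume_ball (hn : 0 < n) {r : ℝ} (hr : 0 < r) :
    ENNReal.ofReal ((r / n) ^ n) ≤ volume (ball (0 : Euc n) r) := by
  have hn' : (0 : ℝ) < n := by exact_mod_cast hn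
  have hsub : WithLp.ofLp ⁻¹' ball (0 : Fin n → ℝ) (r / n) ⊆ ball (0 : Euc n) r := by
    intro x hx
    have : Nonempty (Fin n) := ⟨⟨0, hn⟩⟩
    rw [mem_preimage, mem_ball_zero_iff, pi_norm_lt_iff (by positivity)] at hx
    rw [mem_ball_zero_iff]
    set e := EuclideanSpace.basisFun (Fin n) ℝ
    calc ‖x‖ = ‖∑ i, x i • e i‖ := by
          congr 1
          have := e.sum_repr x
          exact this.symm
      _ ≤ ∑ i, ‖x i • e i‖ := norm_sum_le _ _
      _ < ∑ i : Fin n, r / n := by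
          refine Finset.sum_lt_sum_of_nonempty Finset.univ_nonempty fun i _ => ?_
          rw [norm_smul, e.norm_eq_one, mul_one]
          exact hx i
      _ = r := by
          simp
          field_simp
  refine le_trans ?_ (measure_mono hsub)
  rw [(PiLp.volume_preserving_ofLp (Fin n)).measure_preimage measurableSet_ball.nullMeasurableSet,
    Real.volume_pi_ball _ (by positivity), Fintype.card_fin]
  gcongr
  have : 0 < r / n := by positivity
  linarith

end IsotropicPosition

section Comparison

variable {n m : ℕ}

theorem exists_isotropic_linearEquiv {K : Set (Euc n)} (hK : IsCompact K)
    (hi : (interior K).Nonempty) :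
    ∃ A G : Euc n ≃ₗ[ℝ] Euc n, (∀ x, ∫ y in K, ⟪y, x⟫ ^ 2 = ‖A x‖ ^ 2) ∧
      (∀ x, ∫ y in K, ⟪G y, x⟫ ^ 2 = ‖x‖ ^ 2) ∧
      |LinearMap.det (G : Euc n →ₗ[ℝ] Euc n)| = |LinearMap.det (A : Euc n →ₗ[ℝ] Euc n)|⁻¹ := by
  obtain ⟨A, hA⟩ := exists_linearEquiv_integral_inner_sq_eq hK hi
  set g := LinearMap.adjoint (A.symm : Euc n →ₗ[ℝ] Euc n) with hg
  have hinj : Function.Injective g := by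
    rw [← LinearMap.ker_eq_bot, LinearMap.ker_eq_bot']
    intro y hy
    have h := LinearMap.adjoint_inner_left (A.symm : Euc n →ₗ[ℝ] Euc n) (A y) y
    rw [← hg, hy, inner_zero_left, LinearEquiv.coe_coe, A.symm_apply_apply] at h
    exact inner_self_eq_zero.1 h.symm
  refine ⟨A, LinearEquiv.ofInjectiveEndo g hinj, hA, integral_inner_adjoint_symm_sq hA, ?_⟩
  have h1 : ((LinearEquiv.ofInjectiveEndo g hinj : Euc n ≃ₗ[ℝ] Euc n) : Euc n →ₗ[ℝ] Euc n) = g :=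
    LinearMap.ext fun _ => rfl
  rw [h1, hg, abs_det_adjoint, ← abs_inv]
  congr 1
  exact eq_inv_of_mul_eq_one_left (LinearEquiv.det_symm_mul_det A)

theorem IsConvexBody.volume_eq_ofReal {K : Set (Euc n)} (hK : IsConvexBody K) :
    0 < (volume K).toReal ∧ volume K = ENNReal.ofReal (volume K).toReal := by
  have hfin : volume K ≠ ∞ := hK.2.1.measure_lt_top.ne
  have hpos : volume K ≠ 0 :=
    ((isOpen_interior.measure_pos volume hK.2.2).trans_le (measure_mono interior_subset)).ne'
  exact ⟨ENNReal.toReal_pos hpos hfin, (ENNReal.ofReal_toReal hfin).symm⟩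

theorem exists_measurableSet_of_second_moment_le {L : Set (Euc (m + 1))} (hL : IsConvexBody L)
    {b : ℝ} (hb : 0 < b) (hvol : volume L = ENNReal.ofReal b) :
    ∃ D : Set (Euc (m + 1)), MeasurableSet D ∧
      (∀ x, ∫⁻ y in L, ENNReal.ofReal (⟪y, x⟫ ^ 2) ≤ 1024 * volume L ^ 3 → x ∈ D) ∧
      volume D ≤ ENNReal.ofReal (160 ^ (m + 1) * b ^ m) * volume (ball (0 : Euc (m + 1)) 1) := by
  obtain ⟨A, G, hA, hG, hdet⟩ := exists_isotropic_linearEquiv hL.2.1 hL.2.2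
  have hAc : Continuous A := A.toLinearMap.continuous_of_finiteDimensional
  set R : ℝ := 32 * (b * √b) with hR
  have hR2 : R ^ 2 = 1024 * b ^ 3 := by
    rw [hR, mul_pow, mul_pow, Real.sq_sqrt hb.le]
    ring
  have hR0 : 0 ≤ R := by positivity
  refine ⟨A ⁻¹' closedBall 0 R, hAc.measurable measurableSet_closedBall, fun x hx => ?_, ?_⟩
  · have hi : IntegrableOn (fun y => ⟪y, x⟫ ^ 2) L :=
      ContinuousOn.integrableOn_compact hL.2.1 (by fun_prop)
    rw [← ofReal_integral_eq_lintegral_ofReal hi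
      (Filter.Eventually.of_forall fun y => sq_nonneg _), hA, hvol, ← ENNReal.ofReal_pow hb.le,
      ← ENNReal.ofReal_ofNat 1024, ← ENNReal.ofReal_mul (by norm_num),
      ENNReal.ofReal_le_ofReal_iff (by positivity), ← hR2] at hx
    rw [mem_preimage, mem_closedBall_zero_iff]
    exact le_of_sq_le_sq hx hR0
  · have h1 := Measure.addHaar_preimage_linearMap (volume : Measure (Euc (m + 1)))
      (A.isUnit_det'.ne_zero) (closedBall 0 R)
    rw [LinearEquiv.coe_coe] at h1
    rw [h1, abs_inv, ← hdet, Measure.addHaar_closedBall _ _ hR0, ← mul_assoc,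
      ← ENNReal.ofReal_mul (abs_nonneg _), finrank_euclideanSpace_fin]
    refine mul_le_mul' (ENNReal.ofReal_le_ofReal ?_) le_rfl
    have h2 := sq_volume_mul_abs_det_le hL.2.1 G
      (integral_norm_sq_eq_of_isotropic hL.2.1 (G := (G : Euc (m + 1) →ₗ[ℝ] Euc (m + 1))) hG)
      hb hvol
    set g := |LinearMap.det (G : Euc (m + 1) →ₗ[ℝ] Euc (m + 1))|
    refine le_of_sq_le_sq ?_ (by positivity)
    calc (g * R ^ (m + 1)) ^ 2 = ((b * g) ^ 2 * b ^ (m + 1)) * (1024 ^ (m + 1) * b ^ (2 * m)) := by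
          rw [mul_pow, ← pow_mul, mul_comm (m + 1) 2, pow_mul, hR2, mul_pow]
          ring
      _ ≤ 25 ^ (m + 1) * (1024 ^ (m + 1) * b ^ (2 * m)) := by gcongr
      _ = (160 ^ (m + 1) * b ^ m) ^ 2 := by
          have h3 : (160 ^ (m + 1) * b ^ m) ^ 2 = (160 ^ 2) ^ (m + 1) * b ^ (2 * m) := by
            rw [mul_pow, ← pow_mul, ← pow_mul, ← pow_mul, mul_comm m 2, mul_comm (m + 1) 2]
          rw [h3, ← mul_assoc, ← mul_pow]
          norm_num

theorem pow_le_of_Sdist_le {K L : Set (Euc (m + 1))} (hK : IsConvexBody K) (hL : IsConvexBody L)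
    (hKs : K = -K) (hLs : L = -L) (hS : ∀ t, 0 ≤ t → Sdist (m + 1) K t ≤ Sdist (m + 1) L t)
    {a b : ℝ} (ha : 0 < a) (hvK : volume K = ENNReal.ofReal a) (hb : 0 < b)
    (hvL : volume L = ENNReal.ofReal b) (T : Euc (m + 1) ≃ₗ[ℝ] Euc (m + 1))
    (hT : |LinearMap.det (T : Euc (m + 1) →ₗ[ℝ] Euc (m + 1))| = 1) {ρ : ℝ} (hρ : 0 < ρ)
    (h : 64 * ρ ^ 2 * ∫ y in K, ‖T y‖ ^ 2 ≤ (m + 1) * a ^ 3) :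
    ρ ^ (m + 1) ≤ 2 * (160 ^ (m + 1) * b ^ m) := by
  obtain ⟨D, hD, hDmem, hDvol⟩ := exists_measurableSet_of_second_moment_le hL hb hvL
  have hTc : Continuous T := T.toLinearMap.continuous_of_finiteDimensional
  have hi : IntegrableOn (fun y => ‖T y‖ ^ 2) K :=
    ContinuousOn.integrableOn_compact hK.2.1 (by fun_prop)
  have hL0 : volume L ≠ 0 := by
    rw [hvL]
    exact (ENNReal.ofReal_pos.2 hb).ne'
  have h1 : volume (ball (0 : Euc (m + 1)) ρ) ≤ 2 * volume (slabSet K a) := by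
    refine volume_ball_le_two_mul_volume_slabSet hK.2.1.measurableSet ha hvK (by omega) T hT hρ ?_
    rw [← ofReal_integral_eq_lintegral_ofReal hi
      (Filter.Eventually.of_forall fun y => sq_nonneg _), ← ENNReal.ofReal_mul (by positivity)]
    refine ENNReal.ofReal_le_ofReal ?_
    push_cast
    exact h
  have h2 : volume (slabSet K a) ≤ volume D := by
    refine volume_le_of_Sdist_le (K := K) (L := L) (measurableSet_slabSet hK.2.1.measurableSet a) hD
      (fun x hx => ⟨hx.1, ?_⟩) (fun x hx0 hx => hDmem x ?_) hS
    · exact le_sectionVol_of_slab hK.2.1.measurableSet hK.1 hKs hx.1 (by positivity) hx.2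
    · have h3 := second_moment_le_of_le_sectionVol hL.2.1 hL.1 hLs hL0
        (norm_smul_inv_norm (𝕜 := ℝ) hx0) (norm_nonneg x) hx
      have h4 : ‖x‖ • ‖x‖⁻¹ • x = x := smul_inv_smul₀ (norm_ne_zero_iff.2 hx0) x
      simpa only [RCLike.ofReal_real_eq_id, id, h4] using h3
  have h5 := h1.trans (mul_le_mul' le_rfl (h2.trans hDvol))
  rw [Measure.addHaar_ball _ _ hρ.le, ← mul_assoc, finrank_euclideanSpace_fin] at h5
  have h6 := (ENNReal.mul_le_mul_iff_left (measure_ball_pos volume _ one_pos).ne'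
    measure_ball_lt_top.ne).1 h5
  have h7 : (2 : ℝ≥0∞) = ENNReal.ofReal 2 := by simp
  rwa [h7, ← ENNReal.ofReal_mul (by norm_num), ENNReal.ofReal_le_ofReal_iff (by positivity)] at h6

theorem isoConst_le {K : Set (Euc n)} (hn : 0 < n) (hK : IsConvexBody K) (hs : K = -K) :
    isoConst n K ≤ n := by
  obtain ⟨ha, hvol⟩ := hK.volume_eq_ofReal
  set a := (volume K).toReal with hadef
  have hn' : (0 : ℝ) < n := by exact_mod_cast hn
  obtain ⟨-, G, -, hG, -⟩ := exists_isotropic_linearEquiv hK.2.1 hK.2.2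
  set g := |LinearMap.det (G : Euc n →ₗ[ℝ] Euc n)| with hg
  have hg0 : 0 < g := abs_pos.2 G.isUnit_det'.ne_zero
  have hball := ball_subset_image_of_isotropic hK.2.1 hK.1 hs
    (G := (G : Euc n →ₗ[ℝ] Euc n)) hG ha hvol
  have h1 : ((√a)⁻¹ / n) ^ n ≤ g * a := by
    have h := (ofReal_le_volume_ball hn (r := (√a)⁻¹) (by positivity)).trans (measure_mono hball)
    rwa [Measure.addHaar_image_linearMap, hvol, ← ENNReal.ofReal_mul (abs_nonneg _),
      ENNReal.ofReal_le_ofReal_iff (by positivity)] at h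
  set l : ℝ := g⁻¹ ^ ((1 : ℝ) / n) with hl
  have hl0 : 0 < l := by positivity
  have hln : l ^ n = g⁻¹ := by
    rw [hl, ← Real.rpow_natCast, ← Real.rpow_mul (by positivity), one_div,
      inv_mul_cancel₀ hn'.ne', Real.rpow_one]
  have hl2 : l ^ 2 ≤ n ^ 2 * a ^ (((n : ℝ) + 2) / n) := by
    refine le_of_pow_le_pow_left₀ hn.ne' (by positivity) ?_
    have h2 : (a ^ (((n : ℝ) + 2) / n)) ^ n = a ^ n * a ^ 2 := by
      rw [← Real.rpow_natCast, ← Real.rpow_mul ha.le, div_mul_cancel₀ _ hn'.ne',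
        Real.rpow_add ha, Real.rpow_natCast, Real.rpow_two]
    have h3 : g⁻¹ ≤ a * (n * √a) ^ n := by
      have h4 : ((√a)⁻¹ / n) ^ n = ((n * √a) ^ n)⁻¹ := by
        rw [← inv_pow, mul_inv]
        congr 1
        ring
      rw [h4, inv_le_iff_one_le_mul₀ (by positivity)] at h1
      rw [inv_le_iff_one_le_mul₀ hg0]
      linarith
    calc (l ^ 2) ^ n = (g⁻¹) ^ 2 := by rw [← hln]; ring
      _ ≤ (a * (n * √a) ^ n) ^ 2 := by gcongr
      _ = (n ^ 2) ^ n * ((√a ^ 2) ^ n * a ^ 2) := by ring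
      _ = (n ^ 2 * a ^ (((n : ℝ) + 2) / n)) ^ n := by
        rw [Real.sq_sqrt ha.le, mul_pow _ _ n, h2]
  set T : Euc n ≃ₗ[ℝ] Euc n := G.trans (LinearEquiv.smulOfNeZero ℝ _ l hl0.ne') with hTdef
  have hTG : ∀ y, T y = l • G y := fun y => rfl
  have hT : |LinearMap.det (T : Euc n →ₗ[ℝ] Euc n)| = 1 := by
    have : (T : Euc n →ₗ[ℝ] Euc n) = l • (G : Euc n →ₗ[ℝ] Euc n) := LinearMap.ext hTG
    rw [this, LinearMap.det_smul, finrank_euclideanSpace_fin, hln, abs_mul, abs_inv,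
      abs_of_pos hg0, ← hg, inv_mul_cancel₀ hg0.ne']
  have hM : ∫ x in (T : Euc n → Euc n) '' K, ‖x‖ ^ 2 = l ^ 2 * n := by
    rw [setIntegral_image_of_abs_det_eq_one T hT K fun x => ‖x‖ ^ 2]
    simp only [hTG, norm_smul, mul_pow, Real.norm_eq_abs, sq_abs]
    rw [integral_const_mul]
    congr 1
    exact integral_norm_sq_eq_of_isotropic hK.2.1 (G := (G : Euc n →ₗ[ℝ] Euc n)) hG
  refine csInf_le_of_le ?_ ⟨T, hT, rfl⟩ ?_
  · refine ⟨0, ?_⟩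
    rintro r ⟨T, -, rfl⟩
    have : 0 ≤ ∫ x in (T : Euc n → Euc n) '' K, ‖x‖ ^ 2 := integral_nonneg fun _ => sq_nonneg _
    positivity
  · rw [hM, ← hadef, ← Real.sqrt_eq_rpow]
    refine Real.sqrt_le_iff.2 ⟨hn'.le, ?_⟩
    rw [one_div, inv_mul_le_iff₀ (by positivity)]
    nlinarith

theorem pow_le_isoConst_pow {K L : Set (Euc (m + 1))} (hK : IsConvexBody K) (hL : IsConvexBody L)
    (hKs : K = -K) (hLs : L = -L) (hS : ∀ t, 0 ≤ t → Sdist (m + 1) K t ≤ Sdist (m + 1) L t) :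
    ((volume K).toReal / (volume L).toReal) ^ m ≤ (2560 * isoConst (m + 1) K) ^ (m + 1) := by
  obtain ⟨ha, hvK⟩ := hK.volume_eq_ofReal
  obtain ⟨hb, hvL⟩ := hL.volume_eq_ofReal
  set a := (volume K).toReal with hadef
  set b := (volume L).toReal with hbdef
  set N : ℝ := ((m + 1 : ℕ) : ℝ) with hN
  have hN0 : 0 < N := by positivity
  set W : ℝ := ((a / b) ^ m) ^ ((1 : ℝ) / N) with hW
  have hWn : W ^ (m + 1) = (a / b) ^ m := by
    rw [hW, ← Real.rpow_natCast, ← Real.rpow_mul (by positivity), one_div,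
      inv_mul_cancel₀ hN0.ne', Real.rpow_one]
  have hW0 : 0 ≤ W := by positivity
  suffices h : W / 2560 ≤ isoConst (m + 1) K by
    rw [← hWn]
    gcongr
    linarith
  refine le_csInf ⟨_, LinearEquiv.refl ℝ _, by simp, rfl⟩ ?_
  rintro s ⟨T, hT, hs⟩
  refine le_of_forall_gt_imp_ge_of_dense fun r hr => ?_
  set M := ∫ x in (T : Euc (m + 1) → Euc (m + 1)) '' K, ‖x‖ ^ 2 with hM
  have hM0 : 0 ≤ M := integral_nonneg fun _ => sq_nonneg _
  rw [← hadef, ← Real.sqrt_eq_rpow] at hs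
  have hr0 : 0 < r := by
    refine lt_of_le_of_lt ?_ hr
    rw [hs]
    positivity
  have hMr : M ≤ r ^ 2 * (N * a ^ ((N + 2) / N)) := by
    have h1 := (Real.sqrt_lt' hr0).1 (hs ▸ hr)
    rw [one_div, inv_mul_lt_iff₀ (by positivity)] at h1
    linarith
  set ρ : ℝ := a ^ ((m : ℝ) / N) / (8 * r) with hρ
  have hρ0 : 0 < ρ := by positivity
  have hNm : N = m + 1 := by simp [hN]
  have h2 := pow_le_of_Sdist_le hK hL hKs hLs hS ha hvK hb hvL T hT hρ0 (by
    rw [← setIntegral_image_of_abs_det_eq_one T hT K fun x => ‖x‖ ^ 2, ← hM, ← hNm]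
    have h3 : (a ^ ((m : ℝ) / N)) ^ 2 * a ^ ((N + 2) / N) = a ^ 3 := by
      rw [← Real.rpow_natCast, ← Real.rpow_mul ha.le, ← Real.rpow_add ha, ← Real.rpow_natCast]
      congr 1
      field_simp
      push_cast
      rw [hNm]
      ring
    calc 64 * ρ ^ 2 * M ≤ 64 * ρ ^ 2 * (r ^ 2 * (N * a ^ ((N + 2) / N))) := by gcongr
      _ = N * ((a ^ ((m : ℝ) / N)) ^ 2 * a ^ ((N + 2) / N)) := by
        rw [hρ]
        field_simp
        ring
      _ = N * a ^ 3 := by rw [h3])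
  have h4 : (a ^ ((m : ℝ) / N)) ^ (m + 1) = a ^ m := by
    rw [← Real.rpow_natCast, ← Real.rpow_mul ha.le, ← hN, div_mul_cancel₀ _ hN0.ne',
      Real.rpow_natCast]
  rw [hρ, div_pow, h4, div_le_iff₀ (by positivity)] at h2
  rw [div_le_iff₀ (by norm_num)]
  refine le_of_pow_le_pow_left₀ (Nat.succ_ne_zero m) (by positivity) ?_
  rw [Nat.succ_eq_add_one, hWn, div_pow, div_le_iff₀ (by positivity)]
  refine h2.trans ?_
  have h5 : (2 : ℝ) ≤ 2 ^ (m + 1) := by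
    have := one_le_pow₀ (M₀ := ℝ) one_le_two (n := m)
    rw [pow_succ]
    linarith
  calc 2 * (160 ^ (m + 1) * b ^ m) * (8 * r) ^ (m + 1)
      ≤ 2 ^ (m + 1) * (160 ^ (m + 1) * b ^ m) * (8 * r) ^ (m + 1) := by gcongr
    _ = (2 * 160 * (8 * r)) ^ (m + 1) * b ^ m := by
      rw [mul_pow (2 * 160), mul_pow 2]
      ring
    _ = (r * 2560) ^ (m + 1) * b ^ m := by
      congr 2
      ring

end Comparison

/-- There is an absolute constant `c > 0` such that for all `n ≥ 2` and all
origin-symmetric convex bodies `K, L ⊆ ℝⁿ` with `S_K(t) ≤ S_L(t)` for all `t ≥ 0`,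
one has `|K| ≤ c · L_K · |L|`. -/
theorem stmt_17 : ∃ c : ℝ, 0 < c ∧
    ∀ n : ℕ, 2 ≤ n → ∀ K L : Set (Euc n),
      IsConvexBody K → IsConvexBody L → K = -K → L = -L →
      (∀ t : ℝ, 0 ≤ t → Sdist n K t ≤ Sdist n L t) →
      (volume K).toReal ≤ c * isoConst n K * (volume L).toReal := by
  refine ⟨2560 * 5120, by norm_num, fun n hn K L hK hL hKs hLs hS => ?_⟩
  obtain ⟨m, rfl⟩ : ∃ m, n = m + 1 := ⟨n - 1, by omega⟩
  have hb := hL.volume_eq_ofReal.1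
  have h1 := pow_le_isoConst_pow hK hL hKs hLs hS
  have h2 := isoConst_le (by omega) hK hKs
  have h0 : 0 ≤ isoConst (m + 1) K := by
    refine Real.sInf_nonneg ?_
    rintro r ⟨T, -, rfl⟩
    have : 0 ≤ ∫ x in (T : Euc (m + 1) → Euc (m + 1)) '' K, ‖x‖ ^ 2 :=
      integral_nonneg fun _ => sq_nonneg _
    positivity
  set l := isoConst (m + 1) K
  have hm : m ≠ 0 := by omega
  have h3 : 2560 * l ≤ 5120 ^ m := by
    have h4 : ((m + 1 : ℕ) : ℝ) ≤ 2 ^ m := by exact_mod_cast Nat.lt_two_pow_self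
    have h5 : (2560 : ℝ) ≤ 2560 ^ m := le_self_pow₀ (by norm_num) hm
    calc 2560 * l ≤ 2560 ^ m * 2 ^ m := by gcongr; exact h2.trans h4
      _ = 5120 ^ m := by rw [← mul_pow]; norm_num
  have h6 : ((volume K).toReal / (volume L).toReal) ^ m ≤ (2560 * 5120 * l) ^ m := by
    calc _ ≤ (2560 * l) ^ m * (2560 * l) := by rwa [← pow_succ]
      _ ≤ (2560 * l) ^ m * 5120 ^ m := by gcongr
      _ = (2560 * 5120 * l) ^ m := by
        rw [← mul_pow]
        ring
  have h7 := le_of_pow_le_pow_left₀ hm (by positivity) h6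
  rwa [div_le_iff₀ hb] at h7
end
end

section
/- Let K and L be convex bodies in R^n (n ≥ 2), each containing the origin in its interior. Suppose that for every z ∈ R and every t ≥ 0, σ({θ ∈ S^{n-1} : A_{K,θ}(z) ≥ t}) = σ({θ ∈ S^{n-1} : A_{L,θ}(z) ≥ t}). Then σ({θ ∈ S^{n-1} : ρ_K(θ) ≥ t}) = σ({θ ∈ S^{n-1} : ρ_L(θ) ≥ t}) for every t ≥ 0. That is, the knowledge of the distribution function of the areas of the parallel (non-central) hyperplane sections at every level z determines the distribution of the radial function. -/
open MeasureTheory Metric Set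
open scoped RealInnerProductSpace ENNReal NNReal

noncomputable section

/-- The parallel section function `A_{K,θ}(z) = |K ∩ {x : ⟨x,θ⟩ = z}|`. -/
def parSection (n : ℕ) (K : Set (Euc n)) (θ : Euc n) (z : ℝ) : ℝ≥0∞ :=
  μH[(n : ℝ) - 1] (K ∩ {x : Euc n | ⟪x, θ⟫ = z})


section RotationInvariant

lemma exists_linearIsometryEquiv_apply_eq_s18 {E : Type*} [NormedAddCommGroup E]
    [InnerProductSpace ℝ E] {v w : E} (h : ‖v‖ = ‖w‖) :
    ∃ U : E ≃ₗᵢ[ℝ] E, U v = w :=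
  ⟨_, Submodule.reflection_sub h⟩

variable {E : Type*} [NormedAddCommGroup E] [InnerProductSpace ℝ E] [MeasurableSpace E]

lemma lintegral_inner_pow_ne_top {μ : Measure E} [IsFiniteMeasure μ] (hμ1 : ∀ᵐ x ∂μ, ‖x‖ = 1)
    {e : E} (he : ‖e‖ = 1) (k : ℕ) :
    ∫⁻ θ, ENNReal.ofReal (⟪e, θ⟫ ^ (2 * k)) ∂μ ≠ ∞ := by
  refine ne_top_of_le_ne_top (measure_ne_top μ univ) ?_
  rw [← setLIntegral_univ, ← setLIntegral_one]
  refine setLIntegral_mono_ae aemeasurable_const (hμ1.mono fun θ hθ _ => ?_)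
  rw [ENNReal.ofReal_le_one, pow_mul]
  refine pow_le_one₀ (sq_nonneg _) ?_
  rw [sq_le_one_iff_abs_le_one]
  simpa [he, hθ] using abs_real_inner_le_norm e θ

variable [BorelSpace E]

/-- A measure invariant under all linear isometries. -/
def IsRotationInvariant (μ : Measure E) : Prop :=
  ∀ U : E ≃ₗᵢ[ℝ] E, MeasurePreserving U μ μ

lemma IsRotationInvariant.charFun_eq {μ : Measure E} (hμ : IsRotationInvariant μ) {s t : E}
    (hst : ‖s‖ = ‖t‖) : charFun μ s = charFun μ t := by
  obtain ⟨U, rfl⟩ := exists_linearIsometryEquiv_apply_eq_s18 hst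
  rw [charFun_apply, charFun_apply]
  simpa using ((hμ U).integral_comp U.toHomeomorph.measurableEmbedding
    fun x => Complex.exp (⟪x, U s⟫ * Complex.I))

/-- A rotation invariant probability measure on the unit sphere is unique. -/
theorem IsRotationInvariant.eq_of_ae_norm_eq_one [CompleteSpace E] [SecondCountableTopology E]
    {μ ν : Measure E} [IsProbabilityMeasure μ] [IsProbabilityMeasure ν]
    (hμ : IsRotationInvariant μ) (hν : IsRotationInvariant ν)
    (hμ1 : ∀ᵐ x ∂μ, ‖x‖ = 1) (hν1 : ∀ᵐ x ∂ν, ‖x‖ = 1) : μ = ν := by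
  refine Measure.ext_of_charFun (funext fun t => ?_)
  calc charFun μ t = ∫ _, charFun μ t ∂ν := by simp
    _ = ∫ y, ∫ x, Complex.exp (inner ℝ x (‖t‖ • y) * Complex.I) ∂μ ∂ν := by
        refine integral_congr_ae (hν1.mono fun y hy => ?_)
        exact hμ.charFun_eq (by simp [norm_smul, hy])
    _ = ∫ x, ∫ y, Complex.exp (inner ℝ x (‖t‖ • y) * Complex.I) ∂ν ∂μ := by
        refine integral_integral_swap ?_
        refine (integrable_const (1 : ℝ)).mono (by fun_prop) (.of_forall fun p => ?_)
        simp [Function.uncurry, Complex.norm_exp_ofReal_mul_I]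
    _ = ∫ x, ∫ y, Complex.exp (inner ℝ y (‖t‖ • x) * Complex.I) ∂ν ∂μ := by
        simp only [inner_smul_right, real_inner_comm]
    _ = ∫ _, charFun ν t ∂μ := by
        refine integral_congr_ae (hμ1.mono fun y hy => ?_)
        exact hν.charFun_eq (by simp [norm_smul, hy])
    _ = charFun ν t := by simp

/-- The even moments of the linear functionals under a rotation invariant measure. -/
lemma IsRotationInvariant.lintegral_inner_pow {μ : Measure E} (hμ : IsRotationInvariant μ)
    {e : E} (he : ‖e‖ = 1) (k : ℕ) (x : E) :
    ∫⁻ θ, ENNReal.ofReal (⟪x, θ⟫ ^ (2 * k)) ∂μ =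
      ENNReal.ofReal (‖x‖ ^ (2 * k)) * ∫⁻ θ, ENNReal.ofReal (⟪e, θ⟫ ^ (2 * k)) ∂μ := by
  obtain ⟨U, hU⟩ := exists_linearIsometryEquiv_apply_eq_s18 (v := ‖x‖ • e) (w := x)
    (by simp [norm_smul, he])
  rw [← lintegral_const_mul' _ _ ENNReal.ofReal_ne_top,
    ← (hμ U).lintegral_comp_emb U.toHomeomorph.measurableEmbedding]
  refine lintegral_congr fun θ => ?_
  rw [← ENNReal.ofReal_mul (by positivity), ← mul_pow]
  nth_rw 1 [← hU]
  rw [LinearIsometryEquiv.inner_map_map, real_inner_smul_left]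

lemma IsRotationInvariant.lintegral_inner_pow_ne_zero [FiniteDimensional ℝ E] {μ : Measure E}
    [NeZero μ] (hμ : IsRotationInvariant μ) (hμ1 : ∀ᵐ x ∂μ, ‖x‖ = 1) {e : E}
    (he : ‖e‖ = 1) (k : ℕ) :
    ∫⁻ θ, ENNReal.ofReal (⟪e, θ⟫ ^ (2 * k)) ∂μ ≠ 0 := by
  intro h0
  have key : ∀ x : E, ∀ᵐ θ ∂μ, ⟪x, θ⟫ = 0 := by
    intro x
    have h := hμ.lintegral_inner_pow he k x
    rw [h0, mul_zero, lintegral_eq_zero_iff (by fun_prop)] at h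
    filter_upwards [h] with θ hθ
    have h1 : ⟪x, θ⟫ ^ (2 * k) ≤ 0 := by simpa using hθ
    have h2 : 0 ≤ ⟪x, θ⟫ ^ (2 * k) := (even_two_mul k).pow_nonneg _
    exact eq_zero_of_pow_eq_zero (le_antisymm h1 h2)
  have hall : ∀ᵐ θ ∂μ, ∀ i, ⟪stdOrthonormalBasis ℝ E i, θ⟫ = 0 := ae_all_iff.2 fun i => key _
  obtain ⟨θ, h1, h2⟩ := (hμ1.and hall).exists
  have : θ = 0 := by
    rw [← (stdOrthonormalBasis ℝ E).sum_repr' θ]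
    exact Finset.sum_eq_zero fun i _ => by rw [h2 i, zero_smul]
  simp [this] at h1

lemma IsRotationInvariant.lintegral_lintegral_inner_pow [SecondCountableTopology E]
    {μ : Measure E} [IsFiniteMeasure μ] (hμ : IsRotationInvariant μ) (hμ1 : ∀ᵐ x ∂μ, ‖x‖ = 1)
    {e : E} (he : ‖e‖ = 1) (ν : Measure E) [SFinite ν] (k : ℕ) :
    ∫⁻ θ, ∫⁻ x, ENNReal.ofReal (⟪x, θ⟫ ^ (2 * k)) ∂ν ∂μ =
      (∫⁻ x, ENNReal.ofReal (‖x‖ ^ (2 * k)) ∂ν) *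
        ∫⁻ θ, ENNReal.ofReal (⟪e, θ⟫ ^ (2 * k)) ∂μ := by
  rw [lintegral_lintegral_swap (by fun_prop),
    lintegral_congr fun x => hμ.lintegral_inner_pow he k x,
    lintegral_mul_const' _ _ (lintegral_inner_pow_ne_top hμ1 he k)]

end RotationInvariant

section Moments

/-- Finite measures on a bounded interval are determined by their moments. -/
theorem measure_eq_of_lintegral_pow_eq {μ ν : Measure ℝ} [IsFiniteMeasure μ] [IsFiniteMeasure ν]
    {R : ℝ} (hμ : ∀ᵐ x ∂μ, x ∈ Icc 0 R) (hν : ∀ᵐ x ∂ν, x ∈ Icc 0 R)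
    (h : ∀ k : ℕ, ∫⁻ x, ENNReal.ofReal (x ^ k) ∂μ = ∫⁻ x, ENNReal.ofReal (x ^ k) ∂ν) :
    μ = ν := by
  have integrable_of_continuous : ∀ {ρ : Measure ℝ} [IsFiniteMeasure ρ],
      (∀ᵐ x ∂ρ, x ∈ Icc 0 R) → ∀ f : ℝ → ℝ, Continuous f → Integrable f ρ := by
    intro ρ _ hρ f hf
    rw [← Measure.restrict_eq_self_of_ae_mem hρ]
    exact hf.continuousOn.integrableOn_compact isCompact_Icc
  have integral_pow : ∀ {ρ : Measure ℝ}, (∀ᵐ x ∂ρ, x ∈ Icc 0 R) → ∀ k : ℕ,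
      ∫ x, x ^ k ∂ρ = (∫⁻ x, ENNReal.ofReal (x ^ k) ∂ρ).toReal := by
    intro ρ hρ k
    exact integral_eq_lintegral_of_nonneg_ae (hρ.mono fun x hx => pow_nonneg hx.1 k) (by fun_prop)
  have hpoly : ∀ p : Polynomial ℝ, ∫ x, p.eval x ∂μ = ∫ x, p.eval x ∂ν := by
    intro p
    simp_rw [Polynomial.eval_eq_sum_range]
    rw [integral_finsetSum _ fun i _ => integrable_of_continuous hμ _ (by fun_prop),
      integral_finsetSum _ fun i _ => integrable_of_continuous hν _ (by fun_prop)]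
    refine Finset.sum_congr rfl fun i _ => ?_
    rw [integral_const_mul, integral_const_mul, integral_pow hμ, integral_pow hν, h]
  refine ext_of_forall_integral_eq_of_IsFiniteMeasure fun f => ?_
  have approx : ∀ {ρ : Measure ℝ} [IsFiniteMeasure ρ], (∀ᵐ x ∂ρ, x ∈ Icc 0 R) →
      ∀ (ε : ℝ) (p : Polynomial ℝ), (∀ x ∈ Icc 0 R, |p.eval x - f x| < ε) →
      |∫ x, p.eval x ∂ρ - ∫ x, f x ∂ρ| ≤ ε * ρ.real univ := by
    intro ρ _ hρ ε p hp
    rw [← integral_sub (integrable_of_continuous hρ _ p.continuous)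
      (integrable_of_continuous hρ _ f.continuous)]
    exact norm_integral_le_of_norm_le_const (f := fun x => p.eval x - f x)
      (hρ.mono fun x hx => (hp x hx).le)
  set M := μ.real univ + ν.real univ
  have hM : 0 ≤ M := by positivity
  refine eq_of_abs_sub_le_all fun δ hδ => ?_
  obtain ⟨p, hp⟩ := exists_polynomial_near_of_continuousOn 0 R f f.continuous.continuousOn
    (δ / (M + 1)) (by positivity)
  have h1 := approx hμ _ p hp
  have h2 := approx hν _ p hp
  rw [hpoly p] at h1
  calc |∫ x, f x ∂μ - ∫ x, f x ∂ν| ≤ |∫ x, p.eval x ∂ν - ∫ x, f x ∂μ| +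
        |∫ x, p.eval x ∂ν - ∫ x, f x ∂ν| := by
        rw [abs_sub_comm (∫ x, p.eval x ∂ν) (∫ x, f x ∂μ)]
        exact abs_sub_le _ _ _
    _ ≤ δ / (M + 1) * M := by rw [mul_add]; exact add_le_add h1 h2
    _ ≤ δ := by
        rw [div_mul_eq_mul_div, div_le_iff₀ (by positivity)]
        nlinarith

end Moments

section Polar

variable {E : Type*} [NormedAddCommGroup E] [NormedSpace ℝ E] [MeasurableSpace E] [BorelSpace E]
  [FiniteDimensional ℝ E] {μ : Measure E} [μ.IsAddHaarMeasure]

lemma StarConvex.smul_mem_of_le {F : Type*} [AddCommGroup F] [Module ℝ F] {A : Set F}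
    (hA : StarConvex ℝ 0 A) {r s : ℝ} (hr : 0 < r) (hrs : r ≤ s) {x : F} (hx : s • x ∈ A) :
    r • x ∈ A := by
  have hs : 0 < s := hr.trans_le hrs
  have := hA.smul_mem hx (t := r / s) (by positivity) (div_le_one_of_le₀ hrs hs.le)
  rwa [smul_smul, div_mul_cancel₀ _ hs.ne'] at this

lemma volumeIoiPow_Ioo_ne_zero (n : ℕ) {a b : Ioi (0 : ℝ)} (hab : a < b) :
    Measure.volumeIoiPow n (Ioo a b) ≠ 0 := by
  intro h0
  obtain ⟨c, hac, hcb⟩ := exists_between (show a.1 < b.1 from hab)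
  have hc : 0 < c := a.2.trans hac
  have hsub : Iio b ⊆ Iio (⟨c, hc⟩ : Ioi (0 : ℝ)) ∪ Ioo a b := by
    intro x hx
    rcases lt_or_ge x ⟨c, hc⟩ with hxc | hxc
    · exact .inl hxc
    · exact .inr ⟨lt_of_lt_of_le (show a < ⟨c, hc⟩ from hac) hxc, hx⟩
  have hle := (measure_mono (μ := Measure.volumeIoiPow n) hsub).trans (measure_union_le _ _)
  have hb : 0 < b.1 := b.2
  rw [h0, add_zero, Measure.volumeIoiPow_apply_Iio, Measure.volumeIoiPow_apply_Iio,
    ENNReal.ofReal_le_ofReal_iff (by positivity)] at hle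
  have hlt : c ^ (n + 1) < b.1 ^ (n + 1) := pow_lt_pow_left₀ hcb hc.le (by simp)
  have := div_lt_div_of_pos_right hlt (show (0 : ℝ) < n + 1 by positivity)
  exact this.not_ge hle

lemma lintegral_indicator_norm_eq [Nontrivial E] {K : Set E} (hK : MeasurableSet K) {g : ℝ → ℝ≥0∞}
    (hg : Measurable g) :
    ∫⁻ x in K, g ‖x‖ ∂μ = ∫⁻ r : Ioi (0 : ℝ), g r * μ.toSphere {θ | r.1 • θ.1 ∈ K}
      ∂Measure.volumeIoiPow (Module.finrank ℝ E - 1) := by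
  have hm : Measurable fun x : E => K.indicator (fun x => g ‖x‖) x :=
    (hg.comp measurable_norm).indicator hK
  have hsub : ∫⁻ x in K, g ‖x‖ ∂μ =
      ∫⁻ x : ({0}ᶜ : Set E), K.indicator (fun x => g ‖x‖) x ∂μ.comap Subtype.val := by
    rw [← lintegral_indicator hK, lintegral_subtype_comap (measurableSet_singleton _).compl,
      setLIntegral_congr (t := univ) (by simp [ae_eq_univ, measure_singleton]), setLIntegral_univ]
  have hset : ∀ r : Ioi (0 : ℝ), MeasurableSet {θ : sphere (0 : E) 1 | r.1 • θ.1 ∈ K} := fun r =>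
    (show Continuous fun θ : sphere (0 : E) 1 => r.1 • θ.1 by fun_prop).measurable hK
  rw [hsub, ← (μ.measurePreserving_homeomorphUnitSphereProd.symm
      (homeomorphUnitSphereProd E).toMeasurableEquiv).lintegral_comp
      (f := fun x : ({0}ᶜ : Set E) => K.indicator (fun x => g ‖x‖) x)
      (hm.comp measurable_subtype_coe), lintegral_prod_symm' _ (by fun_prop)]
  refine lintegral_congr fun r => ?_
  rw [← lintegral_indicator_const (hset r)]
  refine lintegral_congr fun θ => ?_
  have hr : 0 < r.1 := r.2
  have hθ : ‖θ.1‖ = 1 := by simp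
  have hv : (((homeomorphUnitSphereProd E).toMeasurableEquiv.symm (θ, r) : ({0}ᶜ : Set E)) : E)
      = r.1 • θ.1 := rfl
  refine (congrArg (K.indicator fun x => g ‖x‖) hv).trans ?_
  simp only [indicator, mem_ofPred_eq, norm_smul, hθ, mul_one, Real.norm_eq_abs,
    abs_of_pos hr]

/-- The distribution of the norm on a star-shaped compact set determines the measures of the
sets of directions in which the set reaches a given radius. -/
theorem toSphere_smul_mem_eq [Nontrivial E] {K L : Set E} (hK : IsClosed K) (hL : IsClosed L)
    (hKs : StarConvex ℝ 0 K) (hLs : StarConvex ℝ 0 L)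
    (h : (μ.restrict K).map norm = (μ.restrict L).map norm) {t : ℝ} (ht : 0 < t) :
    μ.toSphere {θ | t • θ.1 ∈ K} = μ.toSphere {θ | t • θ.1 ∈ L} := by
  set F : Set E → Ioi (0 : ℝ) → ℝ≥0∞ := fun A r => μ.toSphere {θ | r.1 • θ.1 ∈ A} with hF
  have hFm : ∀ {A : Set E}, IsClosed A → Measurable (F A) := fun {A} hA =>
    measurable_measure_prodMk_right (μ := μ.toSphere)
      (s := (fun p : sphere (0 : E) 1 × Ioi (0 : ℝ) => p.2.1 • p.1.1) ⁻¹' A)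
      ((show Continuous fun p : sphere (0 : E) 1 × Ioi (0 : ℝ) => p.2.1 • p.1.1 by
        fun_prop).measurable hA.measurableSet)
  have hmono : ∀ {A : Set E}, StarConvex ℝ 0 A → Antitone (F A) := by
    intro A hA r s hrs
    exact measure_mono fun θ hθ => hA.smul_mem_of_le r.2 hrs hθ
  have hae : F K =ᵐ[Measure.volumeIoiPow (Module.finrank ℝ E - 1)] F L := by
    refine ae_eq_of_forall_setLIntegral_eq_of_sigmaFinite (hFm hK) (hFm hL) fun s hs _ => ?_
    have hs' : MeasurableSet (Subtype.val '' s : Set ℝ) :=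
      (MeasurableEmbedding.subtype_coe measurableSet_Ioi).measurableSet_image.2 hs
    have hg : Measurable ((Subtype.val '' s : Set ℝ).indicator (1 : ℝ → ℝ≥0∞)) :=
      measurable_one.indicator hs'
    have hset : ∀ A : Set E, IsClosed A →
        ∫⁻ r in s, F A r ∂Measure.volumeIoiPow (Module.finrank ℝ E - 1) =
        ∫⁻ x, (Subtype.val '' s : Set ℝ).indicator (1 : ℝ → ℝ≥0∞) x ∂(μ.restrict A).map norm := by
      intro A hA
      rw [lintegral_map hg measurable_norm, lintegral_indicator_norm_eq hA.measurableSet hg,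
        ← lintegral_indicator hs]
      refine lintegral_congr fun r => ?_
      by_cases hr : r ∈ s <;>
        simp [hr, hF, indicator, Subtype.val_injective.mem_set_image]
    rw [hset K hK, hset L hL, h]
  have hle : ∀ {A B : Set E}, IsClosed A → StarConvex ℝ 0 A → StarConvex ℝ 0 B →
      F A =ᵐ[Measure.volumeIoiPow (Module.finrank ℝ E - 1)] F B →
      F B ⟨t, ht⟩ ≤ F A ⟨t, ht⟩ := by
    intro A B hA hAs hBs hAB
    obtain ⟨u, hu, hut, hlim⟩ := exists_seq_strictMono_tendsto' ht
    have hcont : {θ : sphere (0 : E) 1 | t • θ.1 ∈ A} = ⋂ j, {θ | u j • θ.1 ∈ A} := by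
      ext θ
      simp only [mem_ofPred_eq, mem_iInter]
      refine ⟨fun hθ j => ?_, fun hθ => hA.mem_of_tendsto (hlim.smul_const θ.1)
        (Filter.Eventually.of_forall hθ)⟩
      exact hAs.smul_mem_of_le (hut j).1 (hut j).2.le hθ
    have htend := tendsto_measure_iInter_atTop (μ := μ.toSphere)
      (s := fun j => {θ : sphere (0 : E) 1 | u j • θ.1 ∈ A})
      (fun j => ((show Continuous fun θ : sphere (0 : E) 1 => u j • θ.1 by
        fun_prop).measurable hA.measurableSet).nullMeasurableSet)
      (fun i j hij θ hθ => hAs.smul_mem_of_le (hut i).1 (hu.monotone hij) hθ) ⟨0, measure_ne_top _ _⟩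
    rw [← hcont] at htend
    refine ge_of_tendsto' htend fun j => ?_
    obtain ⟨s, hs, hst⟩ : ∃ s ∈ Ioo (⟨u j, (hut j).1⟩ : Ioi (0 : ℝ)) ⟨t, ht⟩, F A s = F B s := by
      by_contra! hcon
      refine volumeIoiPow_Ioo_ne_zero (Module.finrank ℝ E - 1)
        (show (⟨u j, (hut j).1⟩ : Ioi (0 : ℝ)) < ⟨t, ht⟩ from (hut j).2) ?_
      exact measure_mono_null (fun s hs => hcon s hs) hAB
    calc F B ⟨t, ht⟩ ≤ F B s := hmono hBs hs.2.le
      _ = F A s := hst.symm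
      _ ≤ F A ⟨u j, (hut j).1⟩ := hmono hAs hs.1.le
  exact le_antisymm (hle hL hLs hKs hae.symm) (hle hK hKs hLs hae)

end Polar

section Sections

lemma lintegral_eq_of_measure_ofReal_le_eq {Ω : Type*} [MeasurableSpace Ω] {P : Measure Ω}
    {f g : Ω → ℝ≥0∞} (hf : AEMeasurable f P) (hg : AEMeasurable g P)
    (hf' : ∀ᵐ x ∂P, f x ≠ ∞) (hg' : ∀ᵐ x ∂P, g x ≠ ∞)
    (h : ∀ t : ℝ, 0 ≤ t → P {x | ENNReal.ofReal t ≤ f x} = P {x | ENNReal.ofReal t ≤ g x}) :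
    ∫⁻ x, f x ∂P = ∫⁻ x, g x ∂P := by
  have key : ∀ {f : Ω → ℝ≥0∞}, AEMeasurable f P → (∀ᵐ x ∂P, f x ≠ ∞) →
      ∫⁻ x, f x ∂P = ∫⁻ t in Ioi (0 : ℝ), P {x | ENNReal.ofReal t ≤ f x} := by
    intro f hf hf'
    calc ∫⁻ x, f x ∂P = ∫⁻ x, ENNReal.ofReal (f x).toReal ∂P :=
          lintegral_congr_ae (hf'.mono fun x hx => (ENNReal.ofReal_toReal hx).symm)
      _ = ∫⁻ t in Ioi (0 : ℝ), P {x | t ≤ (f x).toReal} :=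
          lintegral_eq_lintegral_meas_le P (.of_forall fun x => ENNReal.toReal_nonneg)
            hf.ennreal_toReal
      _ = _ := by
          refine lintegral_congr fun t => measure_congr ?_
          filter_upwards [hf'] with x hx
          exact propext (ENNReal.ofReal_le_iff_le_toReal hx).symm
  rw [key hf hf', key hg hg']
  exact setLIntegral_congr_fun measurableSet_Ioi fun t ht => h t (le_of_lt ht)

lemma lintegral_mul_lintegral_swap {α β : Type*} [MeasurableSpace α] [MeasurableSpace β]
    {μ : Measure α} {ν : Measure β} [SFinite μ] [SFinite ν] {f : β → α → ℝ≥0∞}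
    (hf : Measurable fun p : β × α => f p.1 p.2) {g : α → ℝ≥0∞} (hg : Measurable g)
    (hg' : ∀ z, g z ≠ ∞) :
    ∫⁻ z, g z * ∫⁻ θ, f θ z ∂ν ∂μ = ∫⁻ θ, ∫⁻ z, g z * f θ z ∂μ ∂ν := by
  have hm : Measurable (Function.uncurry fun (z : α) (θ : β) => g z * f θ z) :=
    (hg.comp measurable_fst).mul (hf.comp measurable_swap)
  rw [← lintegral_lintegral_swap hm.aemeasurable]
  exact lintegral_congr fun z => (lintegral_const_mul' _ _ (hg' z)).symm

variable {m : ℕ}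

/-- The first vector of the standard basis. -/
def firstVec (m : ℕ) : Euc (m + 1) := EuclideanSpace.single 0 1

lemma norm_firstVec : ‖firstVec m‖ = 1 := by simp [firstVec]

/-- The point of `ℝ^{m+1}` with first coordinate `z` and remaining coordinates `y`. -/
def consPt (z : ℝ) (y : Euc m) : Euc (m + 1) := WithLp.toLp 2 (Fin.cons z y.ofLp)

lemma inner_consPt (z : ℝ) (y : Euc m) : ⟪consPt z y, firstVec m⟫ = z := by
  simp [consPt, firstVec, EuclideanSpace.inner_single_right]

lemma isometry_consPt (z : ℝ) : Isometry (consPt z : Euc m → Euc (m + 1)) := by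
  refine Isometry.of_dist_eq fun x y => ?_
  simp [consPt, EuclideanSpace.dist_eq, Fin.sum_univ_succ]

lemma consPt_surj (x : Euc (m + 1)) : ∃ y, consPt ⟪x, firstVec m⟫ y = x := by
  refine ⟨WithLp.toLp 2 (Fin.tail x.ofLp), ?_⟩
  have : ⟪x, firstVec m⟫ = x.ofLp 0 := by
    simp [firstVec, EuclideanSpace.inner_single_right]
  rw [this, consPt, Fin.cons_self_tail]

lemma measurePreserving_consPt :
    MeasurePreserving (fun p : ℝ × Euc m => consPt p.1 p.2) := by
  have h1 : MeasurePreserving (Prod.map id WithLp.ofLp : ℝ × Euc m → ℝ × (Fin m → ℝ)) :=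
    (MeasurePreserving.id volume).prod (PiLp.volume_preserving_ofLp (Fin m))
  have h2 := (volume_preserving_piFinSuccAbove (fun _ : Fin (m + 1) => ℝ) 0).symm
  have h3 := (PiLp.volume_preserving_toLp (Fin (m + 1))).comp (h2.comp h1)
  convert h3 using 1
  ext p : 1
  simp [consPt, MeasurableEquiv.piFinSuccAbove, Fin.insertNthEquiv]

/-- A linear isometry which exchanges the first basis vector and the unit vector `θ`. -/
def swapFirst (θ : Euc (m + 1)) : Euc (m + 1) ≃ₗᵢ[ℝ] Euc (m + 1) :=
  (ℝ ∙ (firstVec m - θ))ᗮ.reflection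

lemma swapFirst_firstVec {θ : Euc (m + 1)} (hθ : ‖θ‖ = 1) : swapFirst θ (firstVec m) = θ :=
  Submodule.reflection_sub (by rw [hθ, norm_firstVec])

lemma swapFirst_swapFirst (θ x : Euc (m + 1)) : swapFirst θ (swapFirst θ x) = x :=
  Submodule.reflection_reflection _ x

lemma measurable_swapFirst :
    Measurable fun p : Euc (m + 1) × Euc (m + 1) => swapFirst p.1 p.2 := by
  have : (fun p : Euc (m + 1) × Euc (m + 1) => swapFirst p.1 p.2) = fun p =>
      p.2 - (2 : ℝ) • (⟪firstVec m - p.1, p.2⟫ / ‖firstVec m - p.1‖ ^ 2) • (firstVec m - p.1) := by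
    ext1 p
    rw [swapFirst, Submodule.reflection_orthogonal_apply, Submodule.reflection_singleton_apply]
    simp [two_smul]
  rw [this]
  fun_prop

/-- The section function in the coordinates given by `swapFirst`. -/
def coordSection (m : ℕ) (K : Set (Euc (m + 1))) (θ : Euc (m + 1)) (z : ℝ) : ℝ≥0∞ :=
  μH[(m : ℝ)] {y : Euc m | swapFirst θ (consPt z y) ∈ K}

lemma isAddHaarMeasure_hausdorffMeasure_euc (m : ℕ) :
    (μH[(m : ℝ)] : Measure (Euc m)).IsAddHaarMeasure := by
  simpa using MeasureTheory.isAddHaarMeasure_hausdorffMeasure (E := Euc m)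

attribute [local instance] isAddHaarMeasure_hausdorffMeasure_euc

/-- The ratio of Hausdorff measure to Lebesgue measure on `ℝ^m`. -/
def hausdorffFactor (m : ℕ) : ℝ≥0 :=
  (μH[(m : ℝ)] : Measure (Euc m)).addHaarScalarFactor volume

lemma hausdorffFactor_ne_zero (m : ℕ) : (hausdorffFactor m : ℝ≥0∞) ≠ 0 :=
  ENNReal.coe_ne_zero.2 (Measure.addHaarScalarFactor_pos_of_isAddHaarMeasure _ _).ne'

lemma hausdorffMeasure_apply_eq (m : ℕ) (s : Set (Euc m)) :
    μH[(m : ℝ)] s = hausdorffFactor m * volume s := by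
  rw [Measure.isAddLeftInvariant_eq_smul (μH[(m : ℝ)] : Measure (Euc m)) volume]
  rfl

lemma inner_swapFirst_consPt {θ : Euc (m + 1)} (hθ : ‖θ‖ = 1) (z : ℝ) (y : Euc m) :
    ⟪swapFirst θ (consPt z y), θ⟫ = z := by
  nth_rw 2 [← swapFirst_firstVec hθ]
  rw [LinearIsometryEquiv.inner_map_map, inner_consPt]

lemma parSection_eq_coordSection (K : Set (Euc (m + 1))) {θ : Euc (m + 1)} (hθ : ‖θ‖ = 1)
    (z : ℝ) : parSection (m + 1) K θ z = coordSection m K θ z := by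
  have hiso : Isometry fun y : Euc m => swapFirst θ (consPt z y) :=
    (swapFirst θ).isometry.comp (isometry_consPt z)
  have hd : ((m + 1 : ℕ) : ℝ) - 1 = m := by push_cast; ring
  rw [parSection, coordSection, hd, ← hiso.hausdorffMeasure_image (.inl m.cast_nonneg)]
  congr 1
  ext x
  constructor
  · rintro ⟨hx, hxz⟩
    obtain ⟨y, hy⟩ := consPt_surj (swapFirst θ x)
    have hz : ⟪swapFirst θ x, firstVec m⟫ = z := by
      rw [← swapFirst_swapFirst θ (firstVec m), LinearIsometryEquiv.inner_map_map,
        swapFirst_firstVec hθ]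
      exact hxz
    have hyx : swapFirst θ (consPt z y) = x := by rw [← hz, hy, swapFirst_swapFirst]
    exact ⟨y, by simpa [hyx] using hx, hyx⟩
  · rintro ⟨y, hy, rfl⟩
    exact ⟨hy, inner_swapFirst_consPt hθ z y⟩

lemma coordSection_ne_top {K : Set (Euc (m + 1))} (hK : IsCompact K) (θ : Euc (m + 1)) (z : ℝ) :
    coordSection m K θ z ≠ ∞ := by
  have hiso : Isometry fun y : Euc m => swapFirst θ (consPt z y) :=
    (swapFirst θ).isometry.comp (isometry_consPt z)
  exact (hiso.isClosedEmbedding.isCompact_preimage hK).measure_ne_top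

lemma measurableSet_swapFirst_consPt {K : Set (Euc (m + 1))} (hK : MeasurableSet K) :
    MeasurableSet {p : (Euc (m + 1) × ℝ) × Euc m | swapFirst p.1.1 (consPt p.1.2 p.2) ∈ K} := by
  have h1 : Measurable fun p : (Euc (m + 1) × ℝ) × Euc m => consPt p.1.2 p.2 :=
    measurePreserving_consPt.measurable.comp (by fun_prop : Measurable
      fun p : (Euc (m + 1) × ℝ) × Euc m => (p.1.2, p.2))
  exact (measurable_swapFirst.comp ((by fun_prop : Measurable
    fun p : (Euc (m + 1) × ℝ) × Euc m => p.1.1).prodMk h1)) hK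

lemma measurable_measure_swapFirst_consPt (ν : Measure (Euc m)) [SFinite ν]
    {K : Set (Euc (m + 1))} (hK : MeasurableSet K) :
    Measurable fun p : Euc (m + 1) × ℝ => ν {y | swapFirst p.1 (consPt p.2 y) ∈ K} :=
  measurable_measure_prodMk_left (measurableSet_swapFirst_consPt hK)

lemma measurable_coordSection {K : Set (Euc (m + 1))} (hK : MeasurableSet K) :
    Measurable fun p : Euc (m + 1) × ℝ => coordSection m K p.1 p.2 :=
  measurable_measure_swapFirst_consPt μH[(m : ℝ)] hK

/-- Fubini's theorem for the sections orthogonal to a unit vector. -/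
lemma lintegral_mul_coordSection {K : Set (Euc (m + 1))} (hK : MeasurableSet K)
    {θ : Euc (m + 1)} (hθ : ‖θ‖ = 1) {g : ℝ → ℝ≥0∞} (hg : Measurable g) :
    ∫⁻ z, g z * coordSection m K θ z =
      hausdorffFactor m * ∫⁻ x in K, g ⟪x, θ⟫ := by
  have hf : Measurable fun x : Euc (m + 1) => K.indicator (fun x => g ⟪x, θ⟫) x :=
    (hg.comp (by fun_prop)).indicator hK
  have hmp := (swapFirst θ).measurePreserving.comp (measurePreserving_consPt (m := m))
  rw [← lintegral_indicator hK, ← hmp.lintegral_comp hf, Measure.volume_eq_prod,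
    lintegral_prod _ (show Measurable fun p : ℝ × Euc m => K.indicator (fun x => g ⟪x, θ⟫)
      ((swapFirst θ ∘ fun p : ℝ × Euc m => consPt p.1 p.2) p) from
        hf.comp hmp.measurable).aemeasurable,
    ← lintegral_const_mul' _ _ ENNReal.coe_ne_top]
  refine lintegral_congr fun z => ?_
  have hs : MeasurableSet {y : Euc m | swapFirst θ (consPt z y) ∈ K} :=
    (hmp.measurable.comp measurable_prodMk_left) hK
  have hsec : coordSection m K θ z =
      hausdorffFactor m * volume {y : Euc m | swapFirst θ (consPt z y) ∈ K} :=
    hausdorffMeasure_apply_eq m _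
  rw [hsec, mul_left_comm, ← lintegral_indicator_const hs]
  congr 1
  refine lintegral_congr fun y => ?_
  simp [indicator, inner_swapFirst_consPt hθ]

/-- The even moments of the averaged section function are multiples of the moments of the
norm over the body. -/
lemma lintegral_pow_mul_lintegral_parSection {K : Set (Euc (m + 1))} (hK : MeasurableSet K)
    {P : Measure (Euc (m + 1))} [IsProbabilityMeasure P] (hP : IsRotationInvariant P)
    (hP1 : ∀ᵐ θ ∂P, ‖θ‖ = 1) (k : ℕ) :
    ∫⁻ z : ℝ, ENNReal.ofReal (z ^ (2 * k)) * ∫⁻ θ, parSection (m + 1) K θ z ∂P =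
      hausdorffFactor m *
        ((∫⁻ x in K, ENNReal.ofReal (‖x‖ ^ (2 * k))) *
          ∫⁻ θ, ENNReal.ofReal (⟪firstVec m, θ⟫ ^ (2 * k)) ∂P) := by
  calc ∫⁻ z : ℝ, ENNReal.ofReal (z ^ (2 * k)) * ∫⁻ θ, parSection (m + 1) K θ z ∂P
      = ∫⁻ z : ℝ, ENNReal.ofReal (z ^ (2 * k)) * ∫⁻ θ, coordSection m K θ z ∂P := by
        refine lintegral_congr fun z => ?_
        congr 1
        exact lintegral_congr_ae (hP1.mono fun θ hθ => parSection_eq_coordSection K hθ z)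
    _ = ∫⁻ θ, ∫⁻ z : ℝ, ENNReal.ofReal (z ^ (2 * k)) * coordSection m K θ z ∂volume ∂P :=
        lintegral_mul_lintegral_swap (measurable_coordSection hK) (by fun_prop)
          fun _ => ENNReal.ofReal_ne_top
    _ = ∫⁻ θ, hausdorffFactor m *
          ∫⁻ x in K, ENNReal.ofReal (⟪x, θ⟫ ^ (2 * k)) ∂volume ∂P := by
        refine lintegral_congr_ae (hP1.mono fun θ hθ => ?_)
        exact lintegral_mul_coordSection hK hθ (g := fun z => ENNReal.ofReal (z ^ (2 * k)))
          (by fun_prop)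
    _ = _ := by
        rw [lintegral_const_mul' _ _ ENNReal.coe_ne_top,
          hP.lintegral_lintegral_inner_pow hP1 norm_firstVec]

lemma map_norm_restrict_eq {K L : Set (Euc (m + 1))} (hK : IsCompact K) (hL : IsCompact L)
    {P : Measure (Euc (m + 1))} [IsProbabilityMeasure P] (hP : IsRotationInvariant P)
    (hP1 : ∀ᵐ θ ∂P, ‖θ‖ = 1)
    (h : ∀ z t : ℝ, 0 ≤ t → P {θ | ENNReal.ofReal t ≤ parSection (m + 1) K θ z} =
      P {θ | ENNReal.ofReal t ≤ parSection (m + 1) L θ z}) :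
    (volume.restrict K).map norm = (volume.restrict L).map norm := by
  have hmom : ∀ k : ℕ, ∫⁻ x in K, ENNReal.ofReal (‖x‖ ^ (2 * k)) =
      ∫⁻ x in L, ENNReal.ofReal (‖x‖ ^ (2 * k)) := by
    intro k
    have hsec : ∀ {A : Set (Euc (m + 1))}, IsCompact A → ∀ z,
        AEMeasurable (fun θ => parSection (m + 1) A θ z) P ∧
          ∀ᵐ θ ∂P, parSection (m + 1) A θ z ≠ ∞ := by
      intro A hA z
      have hcongr : ∀ᵐ θ ∂P, parSection (m + 1) A θ z = coordSection m A θ z :=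
        hP1.mono fun θ hθ => parSection_eq_coordSection A hθ z
      refine ⟨⟨_, (measurable_coordSection hA.measurableSet).comp
        (by fun_prop : Measurable fun θ : Euc (m + 1) => (θ, z)), hcongr⟩, ?_⟩
      filter_upwards [hcongr] with θ hθ
      rw [hθ]
      exact coordSection_ne_top hA θ z
    have havg : ∀ z, ∫⁻ θ, parSection (m + 1) K θ z ∂P = ∫⁻ θ, parSection (m + 1) L θ z ∂P :=
      fun z => lintegral_eq_of_measure_ofReal_le_eq (hsec hK z).1 (hsec hL z).1 (hsec hK z).2
        (hsec hL z).2 (h z)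
    have h1 := lintegral_pow_mul_lintegral_parSection hK.measurableSet hP hP1 k
    simp_rw [havg] at h1
    rw [lintegral_pow_mul_lintegral_parSection hL.measurableSet hP hP1 k] at h1
    rw [ENNReal.mul_right_inj (hausdorffFactor_ne_zero m) ENNReal.coe_ne_top, ENNReal.mul_left_inj
      (hP.lintegral_inner_pow_ne_zero hP1 norm_firstVec k)
      (lintegral_inner_pow_ne_top hP1 norm_firstVec k)] at h1
    exact h1.symm
  obtain ⟨R, hR⟩ := (hK.union hL).isBounded.exists_norm_le
  have hsupp : ∀ {A : Set (Euc (m + 1))}, IsCompact A → A ⊆ K ∪ L →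
      ∀ᵐ x ∂(volume.restrict A).map fun x => ‖x‖ ^ 2, x ∈ Icc 0 (R ^ 2) := by
    intro A hA hsub
    refine (ae_map_iff (by fun_prop) measurableSet_Icc).2 ?_
    filter_upwards [ae_restrict_mem hA.measurableSet] with x hx
    exact ⟨sq_nonneg _, pow_le_pow_left₀ (norm_nonneg x) (hR x (hsub hx)) 2⟩
  have hfin : ∀ {A : Set (Euc (m + 1))}, IsCompact A →
      IsFiniteMeasure ((volume.restrict A).map fun x => ‖x‖ ^ 2) := by
    intro A hA
    have : IsFiniteMeasure (volume.restrict A) := isFiniteMeasure_restrict.2 hA.measure_ne_top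
    infer_instance
  have := hfin hK
  have := hfin hL
  have hsq : (volume.restrict K).map (fun x => ‖x‖ ^ 2) =
      (volume.restrict L).map fun x => ‖x‖ ^ 2 := by
    refine measure_eq_of_lintegral_pow_eq (hsupp hK subset_union_left)
      (hsupp hL subset_union_right) fun k => ?_
    rw [lintegral_map (by fun_prop) (by fun_prop), lintegral_map (by fun_prop) (by fun_prop)]
    simpa only [← pow_mul] using hmom k
  have hsqrt : (norm : Euc (m + 1) → ℝ) = Real.sqrt ∘ fun x => ‖x‖ ^ 2 := by
    ext x
    simp
  rw [hsqrt, ← Measure.map_map (by fun_prop) (by fun_prop), hsq,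
    Measure.map_map (by fun_prop) (by fun_prop)]

end Sections

section Sphere

variable {E : Type*} [NormedAddCommGroup E] [InnerProductSpace ℝ E] [MeasurableSpace E]

lemma IsRotationInvariant.smul {μ : Measure E} (hμ : IsRotationInvariant μ) (c : ℝ≥0∞) :
    IsRotationInvariant (c • μ) := fun U => (hμ U).smul_measure c

variable [BorelSpace E]

lemma isRotationInvariant_hausdorffMeasure_restrict_sphere (d : ℝ) :
    IsRotationInvariant (μH[d].restrict (sphere (0 : E) 1)) := by
  intro U
  have h := (U.toIsometryEquiv.measurePreserving_hausdorffMeasure d).restrict_preimage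
    (isClosed_sphere (x := (0 : E)) (ε := 1)).measurableSet
  have hs : U.toIsometryEquiv ⁻¹' sphere (0 : E) 1 = sphere 0 1 := by
    ext x
    simp
  rw [hs] at h
  exact h

open scoped Pointwise in
lemma isRotationInvariant_map_toSphere [FiniteDimensional ℝ E] :
    IsRotationInvariant ((volume : Measure E).toSphere.map Subtype.val) := by
  intro U
  refine ⟨U.continuous.measurable, Measure.ext fun A hA => ?_⟩
  have hA' : MeasurableSet (U ⁻¹' A) := U.continuous.measurable hA
  have key : ∀ B : Set E, MeasurableSet B →
      (volume : Measure E).toSphere.map Subtype.val B =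
        Module.finrank ℝ E * volume (Ioo (0 : ℝ) 1 • (sphere (0 : E) 1 ∩ B)) := by
    intro B hB
    rw [Measure.map_apply measurable_subtype_coe hB,
      Measure.toSphere_apply' _ (measurable_subtype_coe hB), Subtype.image_preimage_coe]
  rw [Measure.map_apply U.continuous.measurable hA, key _ hA', key _ hA]
  congr 1
  rw [← U.measurePreserving.measure_preimage_emb U.toHomeomorph.measurableEmbedding
    (Ioo (0 : ℝ) 1 • (sphere (0 : E) 1 ∩ A))]
  congr 1
  ext x
  simp only [Set.mem_smul, mem_inter_iff, mem_sphere_zero_iff_norm, mem_preimage]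
  constructor
  · rintro ⟨r, hr, y, ⟨hy, hyA⟩, rfl⟩
    exact ⟨r, hr, U y, ⟨by simpa using hy, hyA⟩, by simp⟩
  · rintro ⟨r, hr, y, ⟨hy, hyA⟩, hxy⟩
    exact ⟨r, hr, U.symm y, ⟨by simpa using hy, by simpa using hyA⟩, by
      rw [← map_smul, hxy, U.symm_apply_apply]⟩

lemma isProbabilityMeasure_inv_smul {Ω : Type*} [MeasurableSpace Ω] {μ : Measure Ω}
    (h0 : μ univ ≠ 0) (h1 : μ univ ≠ ∞) : IsProbabilityMeasure ((μ univ)⁻¹ • μ) :=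
  ⟨by simp [ENNReal.inv_mul_cancel h0 h1]⟩

/-- The normalized Hausdorff measure on the sphere, when it makes sense, is the normalized
surface measure. -/
lemma inv_smul_hausdorffMeasure_restrict_sphere_eq [FiniteDimensional ℝ E] [Nontrivial E] {d : ℝ}
    (h0 : μH[d] (sphere (0 : E) 1) ≠ 0) (h1 : μH[d] (sphere (0 : E) 1) ≠ ∞) :
    (μH[d] (sphere (0 : E) 1))⁻¹ • μH[d].restrict (sphere (0 : E) 1) =
      ((volume : Measure E).toSphere univ)⁻¹ • (volume : Measure E).toSphere.map Subtype.val := by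
  have hP : IsProbabilityMeasure
      ((μH[d] (sphere (0 : E) 1))⁻¹ • μH[d].restrict (sphere (0 : E) 1)) := by
    have := isProbabilityMeasure_inv_smul (μ := μH[d].restrict (sphere (0 : E) 1))
      (by simpa using h0) (by simpa using h1)
    simpa using this
  have hemb : MeasurableEmbedding (Subtype.val : sphere (0 : E) 1 → E) :=
    .subtype_coe isClosed_sphere.measurableSet
  have hQ : IsProbabilityMeasure (((volume : Measure E).toSphere univ)⁻¹ •
      (volume : Measure E).toSphere.map Subtype.val) := by
    have hu : (volume : Measure E).toSphere.map Subtype.val univ =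
        (volume : Measure E).toSphere univ := by rw [hemb.map_apply, preimage_univ]
    rw [← hu]
    refine isProbabilityMeasure_inv_smul ?_ ?_ <;> rw [hu]
    · exact Measure.measure_univ_ne_zero.2 (Measure.toSphere_ne_zero _)
    · exact measure_ne_top _ _
  refine IsRotationInvariant.eq_of_ae_norm_eq_one
    ((isRotationInvariant_hausdorffMeasure_restrict_sphere d).smul _)
    (isRotationInvariant_map_toSphere.smul _) ?_ ?_
  · refine Measure.ae_smul_measure ?_ _
    filter_upwards [ae_restrict_mem isClosed_sphere.measurableSet] with x hx
    simpa using hx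
  · refine Measure.ae_smul_measure ?_ _
    rw [hemb.ae_map_iff]
    exact .of_forall fun x => by simp

end Sphere

lemma le_radial_iff {n : ℕ} {K : Set (Euc n)} (hK : IsCompact K) (hs : StarConvex ℝ 0 K)
    (h0 : (0 : Euc n) ∈ K) {θ : Euc n} (hθ : ‖θ‖ = 1) {t : ℝ} (ht : 0 < t) :
    t ≤ radial K θ ↔ t • θ ∈ K := by
  obtain ⟨R, hR⟩ := hK.isBounded.exists_norm_le
  have hbdd : BddAbove {a : ℝ | 0 ≤ a ∧ a • θ ∈ K} := ⟨R, fun a ha => by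
    simpa [norm_smul, hθ, abs_of_nonneg ha.1] using hR _ ha.2⟩
  refine ⟨fun h => ?_, fun h => le_csSup hbdd ⟨ht.le, h⟩⟩
  have hclosed : IsClosed {a : ℝ | 0 ≤ a ∧ a • θ ∈ K} :=
    isClosed_Ici.inter (hK.isClosed.preimage (by fun_prop : Continuous fun a : ℝ => a • θ))
  have hmem := hclosed.csSup_mem ⟨0, le_rfl, by simpa using h0⟩ hbdd
  exact hs.smul_mem_of_le ht h hmem.2

/-- If two convex bodies containing the origin in their interiors have
equidistributed parallel section functions at every level `z`, then their radial
functions are equidistributed. -/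
theorem stmt_18 (n : ℕ) (hn : 2 ≤ n) (K L : Set (Euc n))
    (hK : IsConvexBody K) (hL : IsConvexBody L)
    (hK0 : (0 : Euc n) ∈ interior K) (hL0 : (0 : Euc n) ∈ interior L)
    (h : ∀ z : ℝ, ∀ t : ℝ, 0 ≤ t →
      sphHaar n {θ : Euc n | ENNReal.ofReal t ≤ parSection n K θ z} =
      sphHaar n {θ : Euc n | ENNReal.ofReal t ≤ parSection n L θ z}) :
    ∀ t : ℝ, 0 ≤ t →
      sphHaar n {θ : Euc n | t ≤ radial K θ} =
      sphHaar n {θ : Euc n | t ≤ radial L θ} := by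
  intro t ht
  rcases ht.eq_or_lt with rfl | ht
  · have huniv : ∀ A : Set (Euc n), {θ : Euc n | 0 ≤ radial A θ} = univ := fun A =>
      eq_univ_of_forall fun θ => Real.sSup_nonneg fun a ha => ha.1
    rw [huniv, huniv]
  obtain ⟨m, rfl⟩ : ∃ m, n = m + 1 := ⟨n - 1, by omega⟩
  by_cases h0 : μH[((m + 1 : ℕ) : ℝ) - 1] (sphere (0 : Euc (m + 1)) 1) = 0
  · have hnull : ∀ A : Set (Euc (m + 1)), sphHaar (m + 1) A = 0 := fun A => by
      rw [sphHaar, measure_mono_null inter_subset_right h0, ENNReal.zero_div]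
    rw [hnull, hnull]
  by_cases h1 : μH[((m + 1 : ℕ) : ℝ) - 1] (sphere (0 : Euc (m + 1)) 1) = ∞
  · have hnull : ∀ A : Set (Euc (m + 1)), sphHaar (m + 1) A = 0 := fun A => by
      rw [sphHaar, h1, ENNReal.div_top]
    rw [hnull, hnull]
  set P : Measure (Euc (m + 1)) := ((volume : Measure (Euc (m + 1))).toSphere univ)⁻¹ •
    (volume : Measure (Euc (m + 1))).toSphere.map Subtype.val with hPdef
  have hPeq := inv_smul_hausdorffMeasure_restrict_sphere_eq h0 h1
  have hsph : ∀ A : Set (Euc (m + 1)), sphHaar (m + 1) A = P A := fun A => by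
    rw [sphHaar, hPdef, ← hPeq, Measure.smul_apply,
      Measure.restrict_apply' isClosed_sphere.measurableSet, smul_eq_mul, div_eq_mul_inv, mul_comm]
  have hemb : MeasurableEmbedding (Subtype.val : sphere (0 : Euc (m + 1)) 1 → Euc (m + 1)) :=
    .subtype_coe isClosed_sphere.measurableSet
  have hP : IsProbabilityMeasure P := ⟨by
    rw [← hsph, sphHaar, univ_inter, ENNReal.div_self h0 h1]⟩
  have hP1 : ∀ᵐ θ ∂P, ‖θ‖ = 1 := by
    refine Measure.ae_smul_measure ?_ _
    rw [hemb.ae_map_iff]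
    exact .of_forall fun x => by simp
  have hKs := hK.1.starConvex (interior_subset hK0)
  have hLs := hL.1.starConvex (interior_subset hL0)
  have hmap := map_norm_restrict_eq hK.2.1 hL.2.1 (isRotationInvariant_map_toSphere.smul _) hP1
    fun z s hs => by simpa only [hsph] using h z s hs
  have hset : ∀ A : Set (Euc (m + 1)), IsCompact A → StarConvex ℝ 0 A → (0 : Euc (m + 1)) ∈ A →
      P {θ | t ≤ radial A θ} = ((volume : Measure (Euc (m + 1))).toSphere univ)⁻¹ *
        (volume : Measure (Euc (m + 1))).toSphere {θ | t • θ.1 ∈ A} := by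
    intro A hA hAs hA0
    rw [hPdef, Measure.smul_apply, hemb.map_apply, smul_eq_mul]
    congr 2
    ext θ
    exact le_radial_iff hA hAs hA0 (by simp) ht
  rw [hsph, hsph, hset K hK.2.1 hKs (interior_subset hK0), hset L hL.2.1 hLs (interior_subset hL0),
    toSphere_smul_mem_eq hK.2.1.isClosed hL.2.1.isClosed hKs hLs hmap ht]
end
end

section
/- Let n ≥ 2, let f : S^{n-1} → R be an infinitely differentiable even function (f(-x) = f(x)), and let p ≠ 0 be a real number. Then there exists ε₀ > 0 such that for every ε ∈ (0, ε₀): (i) the set K_ε = {0} ∪ {x ∈ R^n \ {0} : |x| ≤ (1 + ε f(x/|x|))^p} is a convex body (so that (1+εf)^p is the radial function of a convex body), and (ii) the positively 1-homogeneous function h_ε defined by h_ε(x) = |x|·(1 + ε f(x/|x|))^p for x ≠ 0 and h_ε(0) = 0 is a convex function on R^n (so that (1+εf)^p is the support function of a convex body). -/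
open MeasureTheory Metric Set
open scoped RealInnerProductSpace ENNReal NNReal

noncomputable section

section ConvexityOfPerturbations

variable {E : Type*} [NormedAddCommGroup E]

/-- A `C²` function near a compact convex set has a quadratic first-order Taylor estimate there,
together with bounds on the function, its derivative, and its Lipschitz constant. -/
theorem exists_quadratic_taylor_bound [NormedSpace ℝ E] {s : Set E} (hs : IsCompact s)
    (hsc : Convex ℝ s) {F : E → ℝ} (hF : ∀ x ∈ s, ContDiffAt ℝ 2 F x) :
    ∃ C : ℝ, 0 ≤ C ∧ (∀ x ∈ s, |F x| ≤ C) ∧ (∀ x ∈ s, ‖fderiv ℝ F x‖ ≤ C) ∧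
      (∀ x ∈ s, ∀ y ∈ s, |F y - F x| ≤ C * ‖y - x‖) ∧
      ∀ x ∈ s, ∀ y ∈ s, |F y - F x - fderiv ℝ F x (y - x)| ≤ C * ‖y - x‖ ^ 2 := by
  have hF1 : ∀ x ∈ s, ContDiffAt ℝ 1 (fderiv ℝ F) x := fun x hx =>
    (hF x hx).fderiv_right (by norm_num)
  have hF2 : ∀ x ∈ s, ContDiffAt ℝ 0 (fderiv ℝ (fderiv ℝ F)) x := fun x hx =>
    (hF1 x hx).fderiv_right (by norm_num)
  obtain ⟨C₀, h₀⟩ := hs.exists_bound_of_continuousOn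
    (fun x hx => (hF x hx).continuousAt.continuousWithinAt)
  obtain ⟨C₁, h₁⟩ := hs.exists_bound_of_continuousOn
    (fun x hx => (hF1 x hx).continuousAt.continuousWithinAt)
  obtain ⟨C₂, h₂⟩ := hs.exists_bound_of_continuousOn (f := fderiv ℝ (fderiv ℝ F))
    (fun x hx => (hF2 x hx).continuousAt.continuousWithinAt)
  have hd : ∀ x ∈ s, DifferentiableAt ℝ F x := fun x hx =>
    (hF x hx).differentiableAt (by norm_num)
  have hlip : ∀ x ∈ s, ∀ y ∈ s, ‖fderiv ℝ F y - fderiv ℝ F x‖ ≤ C₂ * ‖y - x‖ :=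
    fun x hx y hy => hsc.norm_image_sub_le_of_norm_fderiv_le
      (fun z hz => (hF1 z hz).differentiableAt (by norm_num)) h₂ hx hy
  have e₀ : C₀ ≤ max 0 (max C₀ (max C₁ C₂)) := by simp
  have e₁ : C₁ ≤ max 0 (max C₀ (max C₁ C₂)) := by simp
  have e₂ : C₂ ≤ max 0 (max C₀ (max C₁ C₂)) := by simp
  refine ⟨max 0 (max C₀ (max C₁ C₂)), by simp, fun x hx => (h₀ x hx).trans e₀,
    fun x hx => (h₁ x hx).trans e₁, fun x hx y hy => ?_, fun x hx y hy => ?_⟩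
  · exact (hsc.norm_image_sub_le_of_norm_fderiv_le hd h₁ hx hy).trans (by gcongr)
  · have hC₂ : 0 ≤ C₂ := (norm_nonneg _).trans (h₂ x hx)
    have hseg : segment ℝ x y ⊆ s := hsc.segment_subset hx hy
    have := (convex_segment x y).norm_image_sub_le_of_norm_fderiv_le' (f := F)
      (φ := fderiv ℝ F x) (C := C₂ * ‖y - x‖) (fun z hz => hd z (hseg hz))
      (fun z hz => (hlip x hx z (hseg hz)).trans
        (mul_le_mul_of_nonneg_left (norm_sub_le_of_mem_segment hz) hC₂))
      (left_mem_segment ℝ x y) (right_mem_segment ℝ x y)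
    calc |F y - F x - fderiv ℝ F x (y - x)| ≤ C₂ * ‖y - x‖ * ‖y - x‖ := this
      _ = C₂ * ‖y - x‖ ^ 2 := by ring
      _ ≤ _ := by gcongr

/-- A nonnegative function vanishing at `0` with a supporting linear functional at every nonzero
point is convex. -/
theorem convexOn_univ_of_support [NormedSpace ℝ E] {h : E → ℝ} (h0 : h 0 = 0)
    (hnn : ∀ x, 0 ≤ h x)
    (hsupp : ∀ z, z ≠ 0 → ∃ l : E →L[ℝ] ℝ, l z = h z ∧ ∀ x, l x ≤ h x) :
    ConvexOn ℝ univ h := by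
  refine ⟨convex_univ, fun x _ y _ a b ha hb _ => ?_⟩
  by_cases hz : a • x + b • y = 0
  · rw [hz, h0]
    exact add_nonneg (smul_nonneg ha (hnn x)) (smul_nonneg hb (hnn y))
  · obtain ⟨l, hl, hle⟩ := hsupp _ hz
    rw [← hl, map_add, map_smul, map_smul]
    exact add_le_add (smul_le_smul_of_nonneg_left (hle x) ha)
      (smul_le_smul_of_nonneg_left (hle y) hb)

/-- The error terms in the supporting inequality are absorbed by the curvature of the sphere. -/
theorem support_error_bound {A B m s ε d ge gu Δ C₁ C₂ : ℝ} (hC₁ : 0 ≤ C₁) (hC₂ : 0 ≤ C₂)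
    (hε : 0 ≤ ε) (hε1 : ε ≤ 1) (hεm : ε * (2 * C₁ * C₂ + C₁ ^ 2 * C₂) ≤ m / 2)
    (hA : m ≤ A) (hs : |s| ≤ C₂) (hgu : |gu| ≤ C₁) (hΔ : |Δ| ≤ C₁ * d)
    (hT : |Δ - ge| ≤ C₁ * d ^ 2) (hB : |B - A - ε * Δ * s| ≤ C₂ * (ε * Δ) ^ 2) :
    A * (1 - d ^ 2 / 2) + s * ε * (ge + d ^ 2 / 2 * gu) ≤ B := by
  have h1 : |s * (Δ - ge)| ≤ C₂ * (C₁ * d ^ 2) := by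
    rw [abs_mul]; gcongr
  have h2 : |s * gu| ≤ C₂ * C₁ := by
    rw [abs_mul]; gcongr
  have h3 : Δ ^ 2 ≤ (C₁ * d) ^ 2 := sq_le_sq' (by linarith [abs_le.1 hΔ]) (abs_le.1 hΔ).2
  have h4 : (ε * Δ) ^ 2 ≤ ε * (C₁ * d) ^ 2 := by
    rw [mul_pow]
    have : ε ^ 2 ≤ ε := by nlinarith
    gcongr
  have h5 : C₂ * (ε * Δ) ^ 2 ≤ C₂ * (ε * (C₁ * d) ^ 2) := by gcongr
  have h6 := mul_le_mul_of_nonneg_left (neg_le_of_abs_le h1) hε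
  have h7 := mul_le_mul_of_nonneg_left (le_of_abs_le h2) (by positivity : 0 ≤ ε * (d ^ 2 / 2))
  have h8 := mul_le_mul_of_nonneg_right hεm (sq_nonneg d)
  have h9 := mul_le_mul_of_nonneg_right hA (sq_nonneg d)
  have h10 := neg_le_of_abs_le hB
  have h11 : 0 ≤ ε * (d ^ 2 / 2) * (C₂ * C₁) := by positivity
  nlinarith

/-- On the interval `[1/2, 3/2]`, real powers are bounded below by a positive constant. -/
theorem exists_pos_le_rpow (q : ℝ) : ∃ m : ℝ, 0 < m ∧ ∀ t ∈ Icc (1 / 2 : ℝ) (3 / 2), m ≤ t ^ q := by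
  have hne : ∀ t ∈ Icc (1 / 2 : ℝ) (3 / 2), (0 : ℝ) < t := fun t ht => by linarith [ht.1]
  obtain ⟨t, ht, hmin⟩ := (isCompact_Icc (a := (1 / 2 : ℝ)) (b := 3 / 2)).exists_isMinOn
    (nonempty_Icc.2 (by norm_num)) (f := fun t : ℝ => t ^ q)
    (fun t ht => (Real.continuousAt_rpow_const t q (Or.inl (hne t ht).ne')).continuousWithinAt)
  exact ⟨t ^ q, Real.rpow_pos_of_pos (hne t ht) q, fun x hx => hmin hx⟩

/-- Small smooth perturbations of the Euclidean norm, with any real exponent, are convex and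
bounded below by a multiple of the norm. -/
theorem exists_convexOn_norm_mul_rpow [InnerProductSpace ℝ E] [FiniteDimensional ℝ E]
    {f : E → ℝ} (hf : ContDiff ℝ 2 f) (q : ℝ) :
    ∃ ε₀ : ℝ, 0 < ε₀ ∧ ∀ ε : ℝ, 0 < ε → ε < ε₀ →
      (∀ x : E, x ≠ 0 → 0 < 1 + ε * f (‖x‖⁻¹ • x)) ∧
      (∃ m : ℝ, 0 < m ∧ ∀ x : E, m * ‖x‖ ≤ ‖x‖ * (1 + ε * f (‖x‖⁻¹ • x)) ^ q) ∧
      ConvexOn ℝ univ (fun x : E => ‖x‖ * (1 + ε * f (‖x‖⁻¹ • x)) ^ q) := by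
  obtain ⟨C₁, hC₁, hf0, hf1, hfl, hf2⟩ := exists_quadratic_taylor_bound
    (isCompact_closedBall (0 : E) 1) (convex_closedBall _ _) (fun x _ => hf.contDiffAt)
  obtain ⟨C₂, hC₂, -, hP1, -, hP2⟩ := exists_quadratic_taylor_bound
    (isCompact_Icc (a := (1 / 2 : ℝ)) (b := 3 / 2)) (convex_Icc _ _)
    (F := fun t : ℝ => t ^ q)
    (fun t ht => Real.contDiffAt_rpow_const_of_ne (by linarith [ht.1] : (0 : ℝ) < t).ne')
  obtain ⟨m, hm, hmle⟩ := exists_pos_le_rpow q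
  have hD : 0 < 2 * C₁ * C₂ + C₁ ^ 2 * C₂ + 1 := by positivity
  refine ⟨min 1 (min (1 / (2 * (C₁ + 1))) (m / 2 / (2 * C₁ * C₂ + C₁ ^ 2 * C₂ + 1))),
    by positivity, fun ε hε hlt => ?_⟩
  obtain ⟨hε1, hlt⟩ := lt_min_iff.1 hlt
  obtain ⟨hεC, hεm⟩ := lt_min_iff.1 hlt
  rw [lt_div_iff₀ (by positivity)] at hεC hεm
  have hball : ∀ x : E, ‖x‖⁻¹ • x ∈ closedBall (0 : E) 1 := fun x => by
    rw [mem_closedBall_zero_iff, norm_smul, norm_inv, norm_norm]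
    exact inv_mul_le_one
  have hmem : ∀ x ∈ closedBall (0 : E) 1, 1 + ε * f x ∈ Icc (1 / 2 : ℝ) (3 / 2) := fun x hx => by
    have := mul_le_mul_of_nonneg_left (hf0 x hx) hε.le
    rw [← abs_of_pos hε, ← abs_mul, abs_of_pos hε] at this
    have := abs_le.1 this
    constructor <;> nlinarith
  have hlow : ∀ x : E, m * ‖x‖ ≤ ‖x‖ * (1 + ε * f (‖x‖⁻¹ • x)) ^ q := fun x => by
    rw [mul_comm]
    exact mul_le_mul_of_nonneg_left (hmle _ (hmem _ (hball x))) (norm_nonneg x)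
  refine ⟨fun x _ => by linarith [(hmem _ (hball x)).1], ⟨m, hm, hlow⟩,
    convexOn_univ_of_support (by simp)
      (fun x => le_trans (by positivity) (hlow x)) fun z hz => ?_⟩
  have hunit : ∀ x : E, x ≠ 0 → ‖(‖x‖⁻¹ • x)‖ = 1 := fun x hx => norm_smul_inv_norm (𝕜 := ℝ) hx
  have hscale : ∀ x : E, x ≠ 0 → ‖x‖ • ‖x‖⁻¹ • x = x := fun x hx =>
    smul_inv_smul₀ (norm_ne_zero_iff.2 hx) x
  set u := ‖z‖⁻¹ • z with hu
  set A := 1 + ε * f u with hA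
  set s := fderiv ℝ (fun t : ℝ => t ^ q) A 1 with hs
  set l : E →L[ℝ] ℝ := A ^ q • innerSL ℝ u +
    (s * ε) • (fderiv ℝ f u - fderiv ℝ f u u • innerSL ℝ u) with hl
  have hl_apply : ∀ x, l x = A ^ q * ⟪u, x⟫ +
      s * ε * (fderiv ℝ f u x - fderiv ℝ f u u * ⟪u, x⟫) := fun x => by simp [hl]
  have huu : ⟪u, u⟫ = (1 : ℝ) := by rw [real_inner_self_eq_norm_sq, hunit z hz, one_pow]
  refine ⟨l, ?_, fun x => ?_⟩
  · conv_lhs => rw [← hscale z hz]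
    rw [map_smul, smul_eq_mul, ← hu, hl_apply, huu]
    ring
  · rcases eq_or_ne x 0 with rfl | hx
    · simp
    conv_lhs => rw [← hscale x hx]
    rw [map_smul, smul_eq_mul]
    refine mul_le_mul_of_nonneg_left ?_ (norm_nonneg x)
    have hθb := hball x
    have hub := hball z
    have hθ1 := hunit x hx
    have hu1 := hunit z hz
    rw [← hu] at hub hu1
    set θ := ‖x‖⁻¹ • x
    have hinner : ⟪u, θ⟫ = 1 - ‖θ - u‖ ^ 2 / 2 := by
      rw [norm_sub_sq_real, hθ1, hu1, real_inner_comm]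
      ring
    have hP := hP2 A (hmem u hub) (1 + ε * f θ) (hmem θ hθb)
    have hBA : 1 + ε * f θ - A = ε * (f θ - f u) := by rw [hA]; ring
    rw [hBA, fderiv_eq_smul_deriv, ← fderiv_apply_one_eq_deriv, Real.norm_eq_abs, sq_abs,
      smul_eq_mul] at hP
    have hs_le : |s| ≤ C₂ := by
      simpa [hs] using (ContinuousLinearMap.le_opNorm _ (1 : ℝ)).trans
        (mul_le_mul_of_nonneg_right (hP1 A (hmem u hub)) (norm_nonneg _))
    have hgu : |fderiv ℝ f u u| ≤ C₁ := by
      simpa [hu1] using (ContinuousLinearMap.le_opNorm _ u).trans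
        (mul_le_mul_of_nonneg_right (hf1 u hub) (norm_nonneg _))
    have key := support_error_bound (ge := fderiv ℝ f u (θ - u)) hC₁ hC₂ hε.le hε1.le
      (by nlinarith) (hmle A (hmem u hub)) hs_le hgu (hfl u hub θ hθb) (hf2 u hub θ hθb) hP
    rw [map_sub] at key
    rw [hl_apply, hinner]
    linarith

end ConvexityOfPerturbations

/-- For a smooth even function `f` on the sphere (given as the restriction
of a smooth function on `ℝⁿ`, even on the sphere) and `p ≠ 0`, for all small enough
`ε > 0` the function `(1 + ε f)^p` is the radial function of a convex body and its
1-homogeneous extension `x ↦ |x|·(1 + ε f(x/|x|))^p` is convex (hence a support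
function of a convex body). -/
theorem stmt_19 (n : ℕ) (hn : 2 ≤ n) (f : Euc n → ℝ)
    (hf : ContDiff ℝ (⊤ : ℕ∞) f)
    (hfeven : ∀ x : Euc n, ‖x‖ = 1 → f (-x) = f x)
    (p : ℝ) (hp : p ≠ 0) :
    ∃ ε₀ : ℝ, 0 < ε₀ ∧ ∀ ε : ℝ, 0 < ε → ε < ε₀ →
      IsConvexBody
        ({0} ∪ {x : Euc n | x ≠ 0 ∧ ‖x‖ ≤ (1 + ε * f (‖x‖⁻¹ • x)) ^ p}) ∧
      ConvexOn ℝ Set.univ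
        (fun x : Euc n => ‖x‖ * (1 + ε * f (‖x‖⁻¹ • x)) ^ p) := by
  have hf2 : ContDiff ℝ 2 f := contDiff_infty.1 hf 2
  obtain ⟨ε₁, hε₁, h₁⟩ := exists_convexOn_norm_mul_rpow hf2 (-p)
  obtain ⟨ε₂, hε₂, h₂⟩ := exists_convexOn_norm_mul_rpow hf2 p
  refine ⟨min ε₁ ε₂, lt_min hε₁ hε₂, fun ε hε hlt => ?_⟩
  obtain ⟨hlt₁, hlt₂⟩ := lt_min_iff.1 hlt
  refine ⟨?_, (h₂ ε hε hlt₂).2.2⟩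
  obtain ⟨hpos, ⟨m, hm, hlow⟩, hconv⟩ := h₁ ε hε hlt₁
  set h : Euc n → ℝ := fun x => ‖x‖ * (1 + ε * f (‖x‖⁻¹ • x)) ^ (-p) with hh
  have hK : ({0} ∪ {x : Euc n | x ≠ 0 ∧ ‖x‖ ≤ (1 + ε * f (‖x‖⁻¹ • x)) ^ p}) =
      {x | h x ≤ 1} := by
    ext x
    rcases eq_or_ne x 0 with rfl | hx
    · simp [hh]
    · have := Real.rpow_pos_of_pos (hpos x hx) p
      simp [hh, hx, Real.rpow_neg (hpos x hx).le, ← div_eq_mul_inv, div_le_one this]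
  have hcont : Continuous h := hconv.locallyLipschitz.continuous
  rw [hK]
  refine ⟨by simpa using hconv.convex_le 1, ?_, 0, ?_⟩
  · refine isCompact_of_isClosed_isBounded (isClosed_le hcont continuous_const)
      (isBounded_closedBall (x := (0 : Euc n)) (r := 1 / m) |>.subset fun x hx => ?_)
    rw [mem_closedBall_zero_iff, le_div_iff₀ hm, mul_comm]
    exact (hlow x).trans hx
  · exact interior_maximal (fun x (hx : h x < 1) => hx.le) (isOpen_lt hcont continuous_const)
      (show h 0 < 1 by simp [hh])
end
end
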